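/- arXiv:2312.12626 — 6 statements merged into one kernel-verified Lean document; each statement's English description precedes it below -/
import Mathlib

section
/- Fix integers n ≥ 2 and r ≥ 1 with r ≤ n/2. There exists a constant C > 0 (depending only on n and r) such that for all integers H ≥ 2, the number R_{n,r}(H) of matrices in M_n(ℤ;H) whose characteristic polynomial has an irreducible factor over ℚ of degree at most r satisfies R_{n,r}(H) ≤ C · H^(n² − n + r(r+1)/2) · log H. -/
open Matrix Polynomial

/-- Integer vectors with sup norm at most `H`. -/
noncomputable def bx (n H : ℕ) : Finset (Fin n → ℤ) :=
  Fintype.piFinset fun _ => Finset.Icc (-(H : ℤ)) H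

lemma mem_bx {n H : ℕ} {x : Fin n → ℤ} : x ∈ bx n H ↔ ∀ i, |x i| ≤ (H : ℤ) := by
  simp [bx, abs_le]

lemma card_bx (n H : ℕ) : (bx n H).card = (2 * H + 1) ^ n := by
  simp only [bx, Fintype.card_piFinset, Int.card_Icc, Finset.prod_const, Finset.card_univ,
    Fintype.card_fin]
  congr 1
  omega

/-- Matrices with the `i`-th row in `s i`. -/
noncomputable def mbox {n : ℕ} (s : Fin n → Finset (Fin n → ℤ)) :
    Finset (Matrix (Fin n) (Fin n) ℤ) :=
  Fintype.piFinset s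

lemma mem_mbox {n : ℕ} {s : Fin n → Finset (Fin n → ℤ)} {A : Matrix (Fin n) (Fin n) ℤ} :
    A ∈ mbox s ↔ ∀ i, A i ∈ s i :=
  Fintype.mem_piFinset

lemma card_mbox {n : ℕ} (s : Fin n → Finset (Fin n → ℤ)) :
    (mbox s).card = ∏ i, (s i).card :=
  Fintype.card_piFinset s

/-- Rows of `A`, shifted by the rows of `B` outside `S`. -/
def shm {n : ℕ} (B : Matrix (Fin n) (Fin n) ℂ) (S : Finset (Fin n))
    (A : Matrix (Fin n) (Fin n) ℤ) : Matrix (Fin n) (Fin n) ℂ :=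
  Matrix.of fun i => if i ∈ S then (fun k => (A i k : ℂ)) else fun k => (A i k : ℂ) + B i k

open Classical in
/-- Solution sets in the row-by-row replacement argument. -/
noncomputable def sol {n : ℕ} (B : Matrix (Fin n) (Fin n) ℂ) (H : ℕ) (S : Finset (Fin n)) :
    Finset (Matrix (Fin n) (Fin n) ℤ) :=
  (mbox fun i => bx n (if i ∈ S then 2 * H else H)).filter
    fun A : Matrix (Fin n) (Fin n) ℤ => (shm B S A).det = 0

lemma mem_sol {n : ℕ} {B : Matrix (Fin n) (Fin n) ℂ} {H : ℕ} {S : Finset (Fin n)}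
    {A : Matrix (Fin n) (Fin n) ℤ} : A ∈ sol B H S ↔
      (∀ i, A i ∈ bx n (if i ∈ S then 2 * H else H)) ∧ (shm B S A).det = 0 := by
  unfold sol
  rw [Finset.mem_filter, mem_mbox]

lemma shm_update_not {n : ℕ} (B : Matrix (Fin n) (Fin n) ℂ) (S : Finset (Fin n))
    (A : Matrix (Fin n) (Fin n) ℤ) (j : Fin n) (hj : j ∉ S) (x : Fin n → ℤ) :
    shm B S (A.updateRow j x) = (shm B S A).updateRow j (fun k => (x k : ℂ) + B j k) := by
  ext i k
  by_cases h : i = j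
  · subst h; simp [shm, hj]
  · simp [shm, h, Matrix.updateRow_ne]

lemma shm_update_ins {n : ℕ} (B : Matrix (Fin n) (Fin n) ℂ) (S : Finset (Fin n))
    (A : Matrix (Fin n) (Fin n) ℤ) (j : Fin n) (x : Fin n → ℤ) :
    shm B (insert j S) (A.updateRow j x) = (shm B S A).updateRow j (fun k => (x k : ℂ)) := by
  ext i k
  by_cases h : i = j
  · subst h; simp [shm]
  · simp [shm, h, Matrix.updateRow_ne]

lemma sol_step {n : ℕ} (B : Matrix (Fin n) (Fin n) ℂ) (H : ℕ) (S : Finset (Fin n))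
    (j : Fin n) (hj : j ∉ S) : (sol B H S).card ≤ (sol B H (insert j S)).card := by
  classical
  let c : Matrix (Fin n) (Fin n) ℤ → (Fin n → ℤ) := fun A0 =>
    if h : ∃ x, A0.updateRow j x ∈ sol B H S then h.choose else 0
  have hc : ∀ A ∈ sol B H S, A.updateRow j (c (A.updateRow j 0)) ∈ sol B H S := by
    intro A hA
    have h : ∃ x, (A.updateRow j 0).updateRow j x ∈ sol B H S := ⟨A j, by simpa using hA⟩
    have := h.choose_spec
    simp only [c, dif_pos h]
    simpa using this
  refine Finset.card_le_card_of_injOn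
    (fun A => A.updateRow j (A j - c (A.updateRow j 0))) ?_ ?_
  · intro A hA
    have hA' := hc A hA
    set x := c (A.updateRow j 0)
    have h1 := mem_sol.1 hA
    have h2 := mem_sol.1 hA'
    refine mem_sol.2 ⟨fun i => ?_, ?_⟩
    · by_cases h : i = j
      · subst h
        have e1 := mem_bx.1 (h1.1 i)
        have e2 := mem_bx.1 (h2.1 i)
        simp only [hj, if_false, Matrix.updateRow_self] at e1 e2
        simp only [Matrix.updateRow_self, Finset.mem_insert_self, if_true]
        refine mem_bx.2 fun k => ?_
        have := abs_sub (A i k) (x k)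
        have := e1 k
        have := e2 k
        simp only [Pi.sub_apply]
        push_cast
        linarith
      · have := h1.1 i
        simpa [Matrix.updateRow_ne, h] using this
    · rw [shm_update_ins]
      have e1 : (shm B S (A.updateRow j (A j))).det = 0 := by simpa using h1.2
      have e2 := h2.2
      rw [shm_update_not _ _ _ _ hj] at e1 e2
      have : (fun k => (((A j - x) k : ℤ) : ℂ)) =
          (fun k => (A j k : ℂ) + B j k) + (-1 : ℂ) • (fun k => (x k : ℂ) + B j k) := by
        ext k; simp; ring
      rw [this, Matrix.det_updateRow_add, Matrix.det_updateRow_smul, e1, e2]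
      simp
  · intro A _ A' _ hAA
    simp only at hAA
    have h0 : A.updateRow j 0 = A'.updateRow j 0 := by
      have := congrArg (fun M => Matrix.updateRow M j 0) hAA
      simpa using this
    rw [h0] at hAA
    ext i k
    by_cases h : i = j
    · subst h
      have := congrFun (congrFun hAA i) k
      simpa using this
    · have := congrFun (congrFun h0 i) k
      simpa [Matrix.updateRow_ne, h] using this

open Classical in
/-- Singular integer matrices in a box. -/
noncomputable def sing (n H : ℕ) : Finset (Matrix (Fin n) (Fin n) ℤ) :=
  (mbox fun _ => bx n H).filter fun A : Matrix (Fin n) (Fin n) ℤ => A.det = 0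

lemma mem_sing {n H : ℕ} {A : Matrix (Fin n) (Fin n) ℤ} :
    A ∈ sing n H ↔ (∀ i, A i ∈ bx n H) ∧ A.det = 0 := by
  unfold sing
  rw [Finset.mem_filter, mem_mbox]

lemma sol_le_sing {n : ℕ} (B : Matrix (Fin n) (Fin n) ℂ) (H : ℕ) :
    (sol B H ∅).card ≤ (sing n (2 * H)).card := by
  classical
  have key : ∀ S : Finset (Fin n), (sol B H ∅).card ≤ (sol B H S).card := by
    intro S
    induction S using Finset.induction_on with
    | empty => rfl
    | insert j S hj ih => exact ih.trans (sol_step B H S j hj)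
  refine (key Finset.univ).trans (Finset.card_le_card ?_)
  intro A hA
  have h := mem_sol.1 hA
  refine mem_sing.2 ⟨fun i => by simpa using h.1 i, ?_⟩
  have h2 : shm B Finset.univ A = (Int.castRingHom ℂ).mapMatrix A := by
    ext i k; simp [shm]
  have h3 := h.2
  rw [h2, ← RingHom.map_det] at h3
  simpa using h3

lemma card_slice (n H : ℕ) (j : Fin n) (s : Finset ℤ) :
    ((bx n H).filter fun x => x j ∈ s).card ≤ s.card * (2 * H + 1) ^ (n - 1) := by
  classical
  have hsub : ((bx n H).filter fun x => x j ∈ s) ⊆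
      Fintype.piFinset fun k : Fin n => if k = j then s
        else Finset.Icc (-(H : ℤ)) H := by
    intro x hx
    rw [Finset.mem_filter, mem_bx] at hx
    rw [Fintype.mem_piFinset]
    intro k
    by_cases h : k = j
    · subst h; simp [hx.2]
    · simpa [h, abs_le] using hx.1 k
  refine (Finset.card_le_card hsub).trans ?_
  rw [Fintype.card_piFinset, ← Finset.mul_prod_erase _ _ (Finset.mem_univ j)]
  have : ∀ k ∈ Finset.univ.erase j, (if k = j then s
        else Finset.Icc (-(H : ℤ)) H).card = 2 * H + 1 := by
    intro k hk
    rw [if_neg (Finset.ne_of_mem_erase hk), Int.card_Icc]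
    omega
  rw [Finset.prod_congr rfl this]
  simp

lemma hyp_count (n H : ℕ) (v w : Fin n → ℤ) (hw : w ⬝ᵥ v = 1) (j : Fin n) (hj : v j ≠ 0)
    {ι : Type*} [Fintype ι] (hι : Fintype.card ι + 1 ≤ n) (b : ι → Fin n → ℤ)
    (hb : ∀ i, b i ∈ bx n H) (hbv : ∀ i, b i ⬝ᵥ v = 0)
    (hspan : ∀ y : Fin n → ℤ, ∃ t : ι → ℚ, ∀ k, k ≠ j → (y k : ℚ) = ∑ i, t i * b i k) :
    ((bx n H).filter fun a => a ⬝ᵥ v = 0).card * (v j).natAbs ≤ (2 * (n * H) + 1) ^ (n - 1) := by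
  classical
  have hrep : ∀ c : ℕ, ∃ y : Fin n → ℤ, y j = 0 ∧ (∀ k, |y k| ≤ ((n : ℤ) - 1) * H) ∧
      v j ∣ y ⬝ᵥ v - c := by
    intro c
    obtain ⟨t, ht⟩ := hspan ((c : ℤ) • w)
    let z : Fin n → ℤ := (c : ℤ) • w - ∑ i, ⌊t i⌋ • b i
    refine ⟨z - Pi.single j (z j), by simp, fun k => ?_, ?_⟩
    · by_cases h : k = j
      · subst h
        simp only [Pi.sub_apply, Pi.single_eq_same, sub_self, abs_zero]
        have : (1 : ℤ) ≤ n := by have := k.2; omega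
        have : (0 : ℤ) ≤ H := by positivity
        nlinarith
      · have e1 : (z - (Pi.single j (z j) : Fin n → ℤ)) k = z k := by simp [h]
        rw [e1]
        have e2 : ((z k : ℤ) : ℚ) = ∑ i, Int.fract (t i) * b i k := by
          have := ht k h
          simp only [z, Pi.sub_apply, Finset.sum_apply, Pi.smul_apply, smul_eq_mul] at this ⊢
          rw [Int.cast_sub, this, Int.cast_sum, ← Finset.sum_sub_distrib]
          refine Finset.sum_congr rfl fun i _ => ?_
          rw [Int.fract]; push_cast; ring
        have e3 : |((z k : ℤ) : ℚ)| ≤ ∑ _i : ι, (H : ℚ) := by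
          rw [e2]
          refine (Finset.abs_sum_le_sum_abs _ _).trans (Finset.sum_le_sum fun i _ => ?_)
          rw [abs_mul, abs_of_nonneg (Int.fract_nonneg _)]
          have h1 := (Int.fract_lt_one (t i)).le
          have h2 : |(b i k : ℚ)| ≤ H := by exact_mod_cast mem_bx.1 (hb i) k
          calc _ ≤ 1 * |(b i k : ℚ)| := by gcongr
            _ ≤ H := by linarith
        rw [Finset.sum_const, Finset.card_univ, nsmul_eq_mul] at e3
        have e4 : |z k| ≤ (Fintype.card ι : ℤ) * H := by exact_mod_cast e3
        refine e4.trans ?_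
        have : (Fintype.card ι : ℤ) ≤ (n : ℤ) - 1 := by omega
        gcongr
    · have e1 : z ⬝ᵥ v = c := by
        simp only [z, sub_dotProduct, smul_dotProduct, hw, sum_dotProduct, hbv]
        simp
      rw [sub_dotProduct, single_dotProduct, e1]
      exact ⟨- z j, by ring⟩
  choose y hy0 hyb hyv using hrep
  rw [← Finset.card_range (v j).natAbs, ← Finset.card_product]
  refine le_trans ?_ ((card_slice n (n * H) j {0}).trans (by simp))
  refine Finset.card_le_card_of_injOn
    (fun p => p.1 - Pi.single j (p.1 j) + y p.2) ?_ ?_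
  · rintro ⟨a, c⟩ hac
    simp only [Finset.coe_product, Set.mem_prod, Finset.mem_coe, Finset.mem_filter,
      Finset.mem_range] at hac
    simp only [Finset.mem_coe, Finset.mem_filter]
    refine ⟨mem_bx.2 fun k => ?_, by simp [hy0]⟩
    have h1 := mem_bx.1 hac.1.1 k
    have h2 := hyb c k
    by_cases h : k = j
    · subst h; simp [hy0]; positivity
    · have : (a - (Pi.single j (a j) : Fin n → ℤ) + y c) k = a k + y c k := by simp [h]
      rw [this]
      have := abs_add_le (a k) (y c k)
      push_cast
      linarith
  · rintro ⟨a, c⟩ hac ⟨a', c'⟩ hac' heq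
    simp only [Finset.coe_product, Set.mem_prod, Finset.mem_coe, Finset.mem_filter,
      Finset.mem_range] at hac hac'
    simp only at heq
    have hd := congrArg (fun x => x ⬝ᵥ v) heq
    simp only [add_dotProduct, sub_dotProduct, single_dotProduct, hac.1.2, hac'.1.2] at hd
    obtain ⟨p, hp⟩ := hyv c
    obtain ⟨q, hq⟩ := hyv c'
    have hdv : v j ∣ (c : ℤ) - c' := ⟨a j - a' j - p + q, by linear_combination hd - hp + hq⟩
    have hcc : c = c' := by
      have h1 := Int.natAbs_dvd_natAbs.2 hdv
      have h2 := Nat.eq_zero_of_dvd_of_lt h1 (by omega)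
      omega
    subst hcc
    have hs : a - Pi.single j (a j) = a' - Pi.single j (a' j) := add_right_cancel heq
    have haj : a j = a' j := by
      have h3 := congrArg (fun x => x ⬝ᵥ v) hs
      simp only [sub_dotProduct, single_dotProduct, hac.1.2, hac'.1.2] at h3
      have : (a j - a' j) * v j = 0 := by linarith
      rcases mul_eq_zero.1 this with h | h
      · linarith
      · exact absurd h hj
    rw [haj] at hs
    rw [sub_left_injective hs]

/-- Cast of an integer vector to a rational one. -/
def qv {n : ℕ} (y : Fin n → ℤ) : Fin n → ℚ := fun k => (y k : ℚ)

lemma prim_functional {n : ℕ} (φ : (Fin n → ℚ) →ₗ[ℚ] ℚ) (hφ : φ ≠ 0) :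
    ∃ (D : ℚ) (v w : Fin n → ℤ), D ≠ 0 ∧ w ⬝ᵥ v = 1 ∧
      ∀ y : Fin n → ℤ, φ (qv y) = D * ((y ⬝ᵥ v : ℤ) : ℚ) := by
  classical
  obtain ⟨⟨m, hm⟩, hint⟩ := IsLocalization.exist_integer_multiples (nonZeroDivisors ℤ)
    (Finset.univ : Finset (Fin n)) (fun k => φ (Pi.single k 1))
  have hm0 : (m : ℚ) ≠ 0 := by exact_mod_cast nonZeroDivisors.ne_zero hm
  have : ∀ k, ∃ u : ℤ, (u : ℚ) = m * φ (Pi.single k 1) := by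
    intro k
    obtain ⟨u, hu⟩ := hint k (Finset.mem_univ k)
    refine ⟨u, ?_⟩
    simpa using hu
  choose u hu using this
  have hφu : ∀ x : Fin n → ℚ, (m : ℚ) * φ x = ∑ k, x k * u k := by
    intro x
    conv_lhs => rw [← Finset.univ_sum_single x]
    rw [map_sum, Finset.mul_sum]
    refine Finset.sum_congr rfl fun k _ => ?_
    have : (Pi.single k (x k) : Fin n → ℚ) = x k • Pi.single k (1 : ℚ) := by
      rw [← Pi.single_smul]; simp
    rw [this, map_smul, hu, smul_eq_mul]; ring
  let L : (Fin n → ℤ) →ₗ[ℤ] ℤ :=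
    { toFun := fun y => y ⬝ᵥ u
      map_add' := fun a b => add_dotProduct a b u
      map_smul' := fun c a => smul_dotProduct c a u }
  obtain ⟨g, hg⟩ := (IsPrincipalIdealRing.principal (LinearMap.range L)).principal
  have hgm : g ∈ LinearMap.range L := by rw [hg]; exact Submodule.mem_span_singleton_self g
  obtain ⟨w, hw⟩ := hgm
  have hdiv : ∀ k, ∃ a : ℤ, a * g = u k := by
    intro k
    have h1 : u k ∈ LinearMap.range L := ⟨Pi.single k 1, by simp [L]⟩
    rw [hg, Submodule.mem_span_singleton] at h1
    simpa using h1
  choose v hv using hdiv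
  have hyu : ∀ y : Fin n → ℤ, y ⬝ᵥ u = g * (y ⬝ᵥ v) := by
    intro y
    simp only [dotProduct, Finset.mul_sum]
    exact Finset.sum_congr rfl fun k _ => by rw [← hv]; ring
  have hg0 : g ≠ 0 := by
    rintro rfl
    apply hφ
    ext k
    have h1 := hu k
    rw [← hv k] at h1
    have : φ (Pi.single k 1) = 0 := by simpa [hm0] using h1
    simpa using this
  refine ⟨g / m, v, w, by positivity, ?_, fun y => ?_⟩
  · have : g * (w ⬝ᵥ v) = g * 1 := by
      rw [← hyu, mul_one]; exact hw
    exact mul_left_cancel₀ hg0 this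
  · have h1 := hφu (qv y)
    have h2 : ∑ k, qv y k * (u k : ℚ) = ((y ⬝ᵥ u : ℤ) : ℚ) := by
      simp [dotProduct, qv]
    rw [h2, hyu] at h1
    push_cast at h1 ⊢
    field_simp
    linarith

lemma exists_hyperplane {n H : ℕ} (hn : 1 ≤ n) (hH : 1 ≤ H) {A : Matrix (Fin n) (Fin n) ℤ}
    (hA : A ∈ sing n H) : ∃ (v : Fin n → ℤ) (j : Fin n), v j ≠ 0 ∧ (∀ k, |v k| ≤ |v j|) ∧
      (∀ i, A i ⬝ᵥ v = 0) ∧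
      ((bx n H).filter fun a => a ⬝ᵥ v = 0).card * (v j).natAbs ≤
        (2 * (n * H) + 1) ^ (n - 1) := by
  classical
  obtain ⟨hAb, hdet⟩ := mem_sing.1 hA
  let s : Set (Fin n → ℚ) := Set.range fun i => qv (A i)
  let T : Set (Fin n → ℚ) := qv '' (bx n H : Set (Fin n → ℤ))
  have hsT : s ⊆ T := by
    rintro _ ⟨i, rfl⟩
    exact ⟨A i, hAb i, rfl⟩
  have hs : Submodule.span ℚ s ≠ ⊤ := by
    intro htop
    obtain ⟨u, hu0, hu⟩ := Matrix.exists_mulVec_eq_zero_iff.2 hdet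
    let ψ : (Fin n → ℚ) →ₗ[ℚ] ℚ :=
      { toFun := fun y => y ⬝ᵥ qv u
        map_add' := fun a b => add_dotProduct a b _
        map_smul' := fun c a => smul_dotProduct c a _ }
    have hψ : Submodule.span ℚ s ≤ LinearMap.ker ψ := by
      rw [Submodule.span_le]
      rintro _ ⟨i, rfl⟩
      have := congrFun hu i
      simp only [Matrix.mulVec, dotProduct, Pi.zero_apply] at this
      simp only [SetLike.mem_coe, LinearMap.mem_ker, ψ, LinearMap.coe_mk, AddHom.coe_mk,
        dotProduct, qv]
      exact_mod_cast this
    rw [htop] at hψ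
    apply hu0
    ext k
    have h1 : Pi.single k (1 : ℚ) ∈ LinearMap.ker ψ := hψ Submodule.mem_top
    simpa [ψ, qv] using h1
  have hT : ⊤ ≤ Submodule.span ℚ T := by
    intro x _
    rw [← Finset.univ_sum_single x]
    refine Submodule.sum_mem _ fun k _ => ?_
    have : (Pi.single k (x k) : Fin n → ℚ) = x k • Pi.single k (1 : ℚ) := by
      rw [← Pi.single_smul]; simp
    rw [this]
    refine Submodule.smul_mem _ _ (Submodule.subset_span ⟨Pi.single k 1, ?_, ?_⟩)
    · refine mem_bx.2 fun i => ?_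
      by_cases h : i = k
      · subst h; simpa using hH
      · simp [h]
    · ext i
      by_cases h : i = k
      · subst h; simp [qv]
      · simp [qv, h]
  obtain ⟨t, hts, htspan, htli⟩ := exists_linearIndependent ℚ s
  have htli' : LinearIndepOn ℚ id t := htli
  let bs := Module.Basis.extendLe htli' (hts.trans hsT) hT
  have hbs : ∀ x, bs x = x := Module.Basis.extendLe_apply_self htli' (hts.trans hsT) hT
  have hex : ∃ x : htli'.extend (hts.trans hsT), (x : Fin n → ℚ) ∉ t := by
    by_contra! hcon
    apply hs
    rw [eq_top_iff, ← htspan, ← bs.span_eq]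
    apply Submodule.span_mono
    rintro _ ⟨x, rfl⟩
    rw [hbs]
    exact hcon x
  obtain ⟨x, hx⟩ := hex
  have hfin : Finite (htli'.extend (hts.trans hsT)) := Module.Finite.finite_basis bs
  have : Fintype (htli'.extend (hts.trans hsT)) := Fintype.ofFinite _
  have hcard : Fintype.card (htli'.extend (hts.trans hsT)) = n := by
    rw [← Module.finrank_eq_card_basis bs]; simp
  let φ := bs.coord x
  have hφx : φ (bs x) = 1 := by simp [φ]
  have hφne : ∀ y, y ≠ x → φ (bs y) = 0 := by
    intro y hy
    simp [φ, hy]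
  have hφ0 : φ ≠ 0 := by
    intro h
    rw [h] at hφx
    simp at hφx
  have hφs : ∀ y ∈ s, φ y = 0 := by
    have : Submodule.span ℚ t ≤ LinearMap.ker φ := by
      rw [Submodule.span_le]
      intro y hy
      have hy' := htli'.subset_extend (hts.trans hsT) hy
      have h1 := hφne ⟨y, hy'⟩ (by rintro rfl; exact hx hy)
      rw [hbs] at h1
      exact h1
    intro y hy
    rw [htspan] at this
    exact this (Submodule.subset_span hy)
  obtain ⟨D, v, w, hD, hw, hφv⟩ := prim_functional φ hφ0
  have hne : Nonempty (Fin n) := ⟨⟨0, by omega⟩⟩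
  obtain ⟨j, hj⟩ := Finite.exists_max fun k => |v k|
  have hvj : v j ≠ 0 := by
    intro h
    have : v = 0 := by
      ext k
      have := hj k
      rw [h] at this
      simpa using this
    rw [this] at hw
    simp at hw
  have hzero : ∀ y : Fin n → ℤ, φ (qv y) = 0 → y ⬝ᵥ v = 0 := by
    intro y hy
    rw [hφv] at hy
    rcases mul_eq_zero.1 hy with h | h
    · exact absurd h hD
    · exact_mod_cast h
  refine ⟨v, j, hvj, hj, fun i => hzero _ (hφs _ ⟨i, rfl⟩), ?_⟩
  have hbT : ∀ y : htli'.extend (hts.trans hsT), ∃ z ∈ bx n H, qv z = y := by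
    intro y
    obtain ⟨z, hz, hzy⟩ := htli'.extend_subset (hts.trans hsT) y.2
    exact ⟨z, hz, hzy⟩
  choose z hzb hzq using hbT
  refine hyp_count n H v w hw j hvj (ι := {y // y ≠ x}) ?_ (fun y => z y.1)
    (fun y => hzb _) (fun y => ?_) (fun y => ?_)
  · have hpos : 0 < Fintype.card (htli'.extend (hts.trans hsT)) := Fintype.card_pos_iff.2 ⟨x⟩
    rw [Fintype.card_subtype_compl, hcard]
    simp only [Fintype.card_unique]
    omega
  · apply hzero
    rw [hzq, ← hbs, hφne _ y.2]
  · have hej : φ (Pi.single j 1) ≠ 0 := by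
      have h1 := hφv (Pi.single j 1)
      have h2 : qv (Pi.single j (1 : ℤ)) = Pi.single j (1 : ℚ) := by
        ext i
        by_cases h : i = j
        · subst h; simp [qv]
        · simp [qv, h]
      rw [h2] at h1
      rw [h1]
      simp [hD, hvj]
    let q : Fin n → ℚ := qv y - (φ (qv y) / φ (Pi.single j 1)) • Pi.single j 1
    have hq : φ q = 0 := by
      simp only [q, map_sub, map_smul, smul_eq_mul]
      field_simp
      ring
    refine ⟨fun i => bs.repr q i.1, fun k hk => ?_⟩
    have h1 := bs.sum_repr q
    rw [Fintype.sum_eq_add_sum_subtype_ne _ x] at h1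
    have h2 : bs.repr q x = 0 := hq
    rw [h2, zero_smul, zero_add] at h1
    have h3 := congrFun h1 k
    have h4 : q k = y k := by simp [q, qv, hk]
    rw [h4] at h3
    rw [← h3, Finset.sum_apply]
    refine Finset.sum_congr rfl fun i _ => ?_
    rw [hbs, ← hzq]
    simp [qv]

lemma sing_card_le {n H : ℕ} (hn : 1 ≤ n) (hH : 1 ≤ H) :
    ((sing n H).card : ℝ) ≤ 2 * n * 3 ^ (n - 1) * (((2 * (n * H) + 1) ^ (n - 1) : ℕ) : ℝ) ^ n *
      (1 + Real.log (((2 * (n * H) + 1) ^ (n - 1) : ℕ) : ℝ)) := by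
  classical
  set M := (2 * (n * H) + 1) ^ (n - 1) with hM
  let W : ℕ → Fin n → Finset (Fin n → ℤ) := fun m j =>
    ((bx n m).filter fun v => v j ∈ ({(m : ℤ), -(m : ℤ)} : Finset ℤ)).filter fun v =>
      ((bx n H).filter fun a => a ⬝ᵥ v = 0).card * m ≤ M
  have hsub : sing n H ⊆ (Finset.range M).biUnion fun m => Finset.univ.biUnion fun j =>
      (W (m + 1) j).biUnion fun v => mbox fun _ => (bx n H).filter fun a => a ⬝ᵥ v = 0 := by
    intro A hA
    obtain ⟨v, j, hvj, hmax, hAv, hN⟩ := exists_hyperplane hn hH hA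
    have hpos : 0 < (v j).natAbs := Int.natAbs_pos.2 hvj
    have hm1 : (v j).natAbs - 1 + 1 = (v j).natAbs := by omega
    have hN1 : 1 ≤ ((bx n H).filter fun a => a ⬝ᵥ v = 0).card := by
      refine Finset.card_pos.2 ⟨0, Finset.mem_filter.2 ⟨mem_bx.2 fun i => ?_, by simp⟩⟩
      simp
    simp only [Finset.mem_biUnion, Finset.mem_range, Finset.mem_univ, true_and]
    refine ⟨(v j).natAbs - 1, ?_, j, v, ?_, ?_⟩
    · have : (v j).natAbs ≤ M := le_trans (by nlinarith) hN
      omega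
    · rw [hm1]
      refine Finset.mem_filter.2 ⟨Finset.mem_filter.2 ⟨mem_bx.2 fun k => ?_, ?_⟩, hN⟩
      · rw [Int.natCast_natAbs]; exact hmax k
      · simp only [Finset.mem_insert, Finset.mem_singleton]
        omega
    · exact mem_mbox.2 fun i => Finset.mem_filter.2 ⟨(mem_sing.1 hA).1 i, hAv i⟩
  have hcard : (sing n H).card ≤ ∑ m ∈ Finset.range M, ∑ j : Fin n, ∑ v ∈ W (m + 1) j,
      ((bx n H).filter fun a => a ⬝ᵥ v = 0).card ^ n := by
    refine (Finset.card_le_card hsub).trans (Finset.card_biUnion_le.trans ?_)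
    refine Finset.sum_le_sum fun m _ => Finset.card_biUnion_le.trans ?_
    refine Finset.sum_le_sum fun j _ => Finset.card_biUnion_le.trans ?_
    refine Finset.sum_le_sum fun v _ => ?_
    rw [card_mbox]; simp
  have hW : ∀ m j, ((W (m + 1) j).card : ℝ) ≤ 2 * 3 ^ (n - 1) * ((m : ℝ) + 1) ^ (n - 1) := by
    intro m j
    have h1 : (W (m + 1) j).card ≤ 2 * (2 * (m + 1) + 1) ^ (n - 1) := by
      refine (Finset.card_filter_le _ _).trans ((card_slice n (m + 1) j _).trans ?_)
      exact Nat.mul_le_mul_right _ Finset.card_le_two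
    have h2 : ((W (m + 1) j).card : ℝ) ≤ 2 * (2 * ((m : ℝ) + 1) + 1) ^ (n - 1) := by
      exact_mod_cast h1
    refine h2.trans ?_
    rw [mul_assoc, ← mul_pow]
    gcongr
    have : (0 : ℝ) ≤ m := by positivity
    linarith
  have hinner : ∀ m j, ((∑ v ∈ W (m + 1) j,
      ((bx n H).filter fun a => a ⬝ᵥ v = 0).card ^ n : ℕ) : ℝ) ≤
      2 * 3 ^ (n - 1) * (M : ℝ) ^ n * ((m : ℝ) + 1)⁻¹ := by
    intro m j
    have hp : (0 : ℝ) < (m : ℝ) + 1 := by positivity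
    have h1 : ∀ v ∈ W (m + 1) j, (((bx n H).filter fun a => a ⬝ᵥ v = 0).card : ℝ) ^ n ≤
        ((M : ℝ) / ((m : ℝ) + 1)) ^ n := by
      intro v hv
      have h := (Finset.mem_filter.1 hv).2
      gcongr
      rw [le_div_iff₀ hp]
      exact_mod_cast h
    push_cast
    calc _ ≤ ∑ v ∈ W (m + 1) j, ((M : ℝ) / ((m : ℝ) + 1)) ^ n := Finset.sum_le_sum h1
      _ = ((W (m + 1) j).card : ℝ) * ((M : ℝ) / ((m : ℝ) + 1)) ^ n := by
        rw [Finset.sum_const, nsmul_eq_mul]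
      _ ≤ (2 * 3 ^ (n - 1) * ((m : ℝ) + 1) ^ (n - 1)) * ((M : ℝ) / ((m : ℝ) + 1)) ^ n := by
        gcongr; exact hW m j
      _ = _ := by
        obtain ⟨k, rfl⟩ : ∃ k, n = k + 1 := ⟨n - 1, by omega⟩
        simp only [Nat.add_sub_cancel, div_pow]
        field_simp
        ring
  have hharm : ∑ m ∈ Finset.range M, ((m : ℝ) + 1)⁻¹ ≤ 1 + Real.log M := by
    have := harmonic_le_one_add_log M
    simpa [harmonic] using this
  calc ((sing n H).card : ℝ) ≤ ((∑ m ∈ Finset.range M, ∑ j : Fin n, ∑ v ∈ W (m + 1) j,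
      ((bx n H).filter fun a => a ⬝ᵥ v = 0).card ^ n : ℕ) : ℝ) := by exact_mod_cast hcard
    _ ≤ ∑ m ∈ Finset.range M, ∑ j : Fin n, 2 * 3 ^ (n - 1) * (M : ℝ) ^ n * ((m : ℝ) + 1)⁻¹ := by
      rw [Nat.cast_sum]
      refine Finset.sum_le_sum fun m _ => ?_
      rw [Nat.cast_sum]
      exact Finset.sum_le_sum fun j _ => hinner m j
    _ = 2 * n * 3 ^ (n - 1) * (M : ℝ) ^ n * ∑ m ∈ Finset.range M, ((m : ℝ) + 1)⁻¹ := by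
      simp only [Finset.sum_const, Finset.card_univ, Fintype.card_fin, nsmul_eq_mul]
      rw [Finset.mul_sum]
      refine Finset.sum_congr rfl fun m _ => ?_
      ring
    _ ≤ _ := by gcongr

lemma sing_count (n : ℕ) (hn : 1 ≤ n) : ∃ C : ℝ, 0 < C ∧ ∀ H : ℕ, 2 ≤ H →
    ((sing n (2 * H)).card : ℝ) ≤ C * (H : ℝ) ^ (n ^ 2 - n) * Real.log H := by
  have hn' : (1 : ℝ) ≤ n := by exact_mod_cast hn
  have hl0 : 0 ≤ Real.log (5 * n) := Real.log_nonneg (by linarith)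
  refine ⟨2 * n * 3 ^ (n - 1) * (5 * n : ℝ) ^ ((n - 1) * n) *
    (2 + (n - 1 : ℕ) * (2 * Real.log (5 * n) + 1)), by positivity, fun H hH => ?_⟩
  have hH' : (2 : ℝ) ≤ H := by exact_mod_cast hH
  have hlog : 1 ≤ 2 * Real.log H := by
    have h1 := Real.log_two_gt_d9
    have h2 := Real.log_le_log (by norm_num) hH'
    linarith
  refine (sing_card_le hn (by omega : 1 ≤ 2 * H)).trans ?_
  have hM : (((2 * (n * (2 * H)) + 1) ^ (n - 1) : ℕ) : ℝ) ≤ (5 * n * H : ℝ) ^ (n - 1) := by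
    push_cast
    gcongr
    nlinarith
  have hM1 : (1 : ℝ) ≤ (((2 * (n * (2 * H)) + 1) ^ (n - 1) : ℕ) : ℝ) := by
    exact_mod_cast Nat.one_le_pow _ _ (by omega)
  set M : ℝ := (((2 * (n * (2 * H)) + 1) ^ (n - 1) : ℕ) : ℝ)
  have e1 : M ^ n ≤ (5 * n : ℝ) ^ ((n - 1) * n) * (H : ℝ) ^ (n ^ 2 - n) := by
    have : n ^ 2 - n = (n - 1) * n := by rw [Nat.sub_mul, one_mul, sq]
    rw [this, ← mul_pow, pow_mul]
    gcongr
  have e2 : 1 + Real.log M ≤ (2 + (n - 1 : ℕ) * (2 * Real.log (5 * n) + 1)) * Real.log H := by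
    have h1 : Real.log M ≤ (n - 1 : ℕ) * (Real.log (5 * n) + Real.log H) := by
      refine (Real.log_le_log (by linarith) hM).trans ?_
      rw [Real.log_pow, Real.log_mul (by positivity) (by positivity)]
    have h2 : Real.log (5 * n) ≤ 2 * Real.log (5 * n) * Real.log H := by nlinarith
    have h3 : (0 : ℝ) ≤ (n - 1 : ℕ) := by positivity
    nlinarith
  have hl1 : 0 ≤ 1 + Real.log M := by
    have := Real.log_nonneg hM1
    linarith
  calc _ ≤ 2 * n * 3 ^ (n - 1) * ((5 * n : ℝ) ^ ((n - 1) * n) * (H : ℝ) ^ (n ^ 2 - n)) *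
      ((2 + (n - 1 : ℕ) * (2 * Real.log (5 * n) + 1)) * Real.log H) := by gcongr
    _ = _ := by ring

lemma det_of_root {n : ℕ} (A : Matrix (Fin n) (Fin n) ℤ) (α : ℂ)
    (h : (A.charpoly.map (Int.castRingHom ℂ)).eval α = 0) :
    (shm (-(Matrix.scalar (Fin n) α)) ∅ A).det = 0 := by
  rw [← Matrix.charpoly_map, Matrix.eval_charpoly] at h
  have : shm (-(Matrix.scalar (Fin n) α)) ∅ A =
      -(Matrix.scalar (Fin n) α - A.map (Int.castRingHom ℂ)) := by
    ext i k
    simp [shm]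
    ring
  rw [this, Matrix.det_neg, h, mul_zero]

lemma root_bound {n H : ℕ} (hn : 1 ≤ n) (A : Matrix (Fin n) (Fin n) ℤ)
    (hA : ∀ i j, |A i j| ≤ (H : ℤ)) (α : ℂ)
    (h : (A.charpoly.map (Int.castRingHom ℂ)).eval α = 0) : ‖α‖ ≤ n * H := by
  by_contra! hα
  have h0 := det_of_root A α h
  have hA' : ∀ i j, ‖(A i j : ℂ)‖ ≤ H := by
    intro i j
    rw [Complex.norm_intCast]
    exact_mod_cast hA i j
  refine det_ne_zero_of_sum_row_lt_diag (fun k => ?_) h0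
  have h1 : ∀ j ∈ Finset.univ.erase k, ‖shm (-(Matrix.scalar (Fin n) α)) ∅ A k j‖ ≤ H := by
    intro j hj
    have hjk : k ≠ j := (Finset.ne_of_mem_erase hj).symm
    simpa [shm, hjk] using hA' k j
  have h2 := Finset.sum_le_sum h1
  rw [Finset.sum_const, Finset.card_erase_of_mem (Finset.mem_univ k), Finset.card_univ,
    Fintype.card_fin, nsmul_eq_mul, Nat.cast_sub hn] at h2
  have h3 : shm (-(Matrix.scalar (Fin n) α)) ∅ A k k = A k k - α := by
    simp [shm, sub_eq_add_neg]
  rw [h3]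
  have h4 := norm_sub_norm_le α (A k k)
  rw [norm_sub_rev] at h4
  have h5 := hA' k k
  push_cast at h2
  linarith

lemma int_factor {n H : ℕ} (hn : 1 ≤ n) (A : Matrix (Fin n) (Fin n) ℤ)
    (hA : ∀ i j, |A i j| ≤ (H : ℤ)) (g : ℚ[X]) (hg : g.Monic)
    (hdvd : g ∣ Polynomial.map (Int.castRingHom ℚ) A.charpoly) :
    ∃ f : ℤ[X], f.Monic ∧ f.natDegree = g.natDegree ∧
      (∀ α : ℂ, (f.map (Int.castRingHom ℂ)).eval α = 0 →
        (A.charpoly.map (Int.castRingHom ℂ)).eval α = 0) ∧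
      ∀ i, |f.coeff i| ≤ (((2 * n) ^ g.natDegree * H ^ (g.natDegree - i) : ℕ) : ℤ) := by
  obtain ⟨f, hf⟩ := IsIntegrallyClosed.eq_map_mul_C_of_dvd ℚ A.charpoly_monic (g := g)
    (by simpa using hdvd)
  rw [hg.leadingCoeff, C_1, mul_one] at hf
  have hfm : f.Monic := by
    refine Polynomial.monic_of_injective (f := algebraMap ℤ ℚ) ?_ (by rw [hf]; exact hg)
    exact IsFractionRing.injective ℤ ℚ
  have hdeg : f.natDegree = g.natDegree := by
    rw [← hf, hfm.natDegree_map]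
  have hroot : ∀ α : ℂ, (f.map (Int.castRingHom ℂ)).eval α = 0 →
        (A.charpoly.map (Int.castRingHom ℂ)).eval α = 0 := by
    intro α hα
    have h1 := Polynomial.map_dvd (algebraMap ℚ ℂ) hdvd
    rw [← hf, Polynomial.map_map, Polynomial.map_map] at h1
    have e1 : (algebraMap ℚ ℂ).comp (algebraMap ℤ ℚ) = Int.castRingHom ℂ := Subsingleton.elim _ _
    have e2 : (algebraMap ℚ ℂ).comp (Int.castRingHom ℚ) = Int.castRingHom ℂ :=
      Subsingleton.elim _ _
    rw [e1, e2] at h1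
    exact Polynomial.eval_eq_zero_of_dvd_of_eval_eq_zero h1 hα
  refine ⟨f, hfm, hdeg, hroot, fun i => ?_⟩
  rw [← hdeg]
  set d := f.natDegree
  have hb := Polynomial.coeff_le_of_roots_le (K := ℂ) (p := g) (f := algebraMap ℚ ℂ)
    (B := n * H) i hg (IsAlgClosed.splits _) (by
      intro z hz
      apply root_bound hn A hA z
      apply hroot
      have := (Polynomial.mem_roots'.1 hz).2
      rw [← hf, Polynomial.map_map] at this
      have e1 : (algebraMap ℚ ℂ).comp (algebraMap ℤ ℚ) = Int.castRingHom ℂ :=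
        Subsingleton.elim _ _
      rw [e1] at this
      exact this)
  rw [← hdeg] at hb
  have hc : ‖(g.map (algebraMap ℚ ℂ)).coeff i‖ = ((|f.coeff i| : ℤ) : ℝ) := by
    rw [← hf, Polynomial.map_map, Polynomial.coeff_map]
    simp
  rw [hc] at hb
  have hn' : (1 : ℝ) ≤ n := by exact_mod_cast hn
  have : ((|f.coeff i| : ℤ) : ℝ) ≤ (2 * n : ℝ) ^ d * (H : ℝ) ^ (d - i) := by
    refine hb.trans ?_
    rw [mul_pow, mul_pow]
    have h1 : (n : ℝ) ^ (d - i) ≤ (n : ℝ) ^ d := pow_le_pow_right₀ hn' (Nat.sub_le _ _)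
    have h2 : ((d.choose i : ℕ) : ℝ) ≤ 2 ^ d := by exact_mod_cast Nat.choose_le_two_pow d i
    calc _ ≤ (n : ℝ) ^ d * (H : ℝ) ^ (d - i) * 2 ^ d := by gcongr
      _ = _ := by ring
  exact_mod_cast this

lemma sum_sub_range (d : ℕ) : ∑ i ∈ Finset.range d, (d - i) = d * (d + 1) / 2 := by
  have h1 : ∀ d : ℕ, (∑ i ∈ Finset.range d, (i + 1)) * 2 = d * (d + 1) := by
    intro d
    induction d with
    | zero => simp
    | succ k ih => rw [Finset.sum_range_succ, add_mul, ih]; ring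
  have h2 := Finset.sum_range_reflect (fun i => i + 1) d
  have h3 : ∑ i ∈ Finset.range d, (d - i) = ∑ i ∈ Finset.range d, (d - 1 - i + 1) := by
    refine Finset.sum_congr rfl fun i hi => ?_
    have := Finset.mem_range.1 hi
    omega
  rw [h3, h2]
  have := h1 d
  omega

open Classical in
/-- Matrices in the box whose characteristic polynomial has an irreducible factor of degree `d`. -/
noncomputable def facs (n H d : ℕ) : Finset (Matrix (Fin n) (Fin n) ℤ) :=
  (mbox fun _ => bx n H).filter fun A =>
    ∃ g : Polynomial ℚ, g.Monic ∧ Irreducible g ∧ g.natDegree = d ∧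
          g ∣ Polynomial.map (Int.castRingHom ℚ) A.charpoly

lemma facs_count {n H d : ℕ} (hn : 1 ≤ n) (hH : 1 ≤ H) (hd : 1 ≤ d) :
    (facs n H d).card ≤ (sing n (2 * H)).card *
      ((3 * (2 * n) ^ d) ^ d * H ^ (d * (d + 1) / 2)) := by
  classical
  have hex : ∀ A ∈ facs n H d, ∃ f : ℤ[X], f.Monic ∧ f.natDegree = d ∧
      (∀ α : ℂ, (f.map (Int.castRingHom ℂ)).eval α = 0 →
        (A.charpoly.map (Int.castRingHom ℂ)).eval α = 0) ∧
      ∀ i, |f.coeff i| ≤ (((2 * n) ^ d * H ^ (d - i) : ℕ) : ℤ) := by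
    intro A hA
    obtain ⟨hA1, g, hg, -, hgd, hdvd⟩ := Finset.mem_filter.1 hA
    obtain ⟨f, h1, h2, h3, h4⟩ := int_factor hn A
      (fun i j => mem_bx.1 (mem_mbox.1 hA1 i) j) g hg hdvd
    rw [hgd] at h2 h4
    exact ⟨f, h1, h2, h3, h4⟩
  choose! F hF1 hF2 hF3 hF4 using hex
  let t : Finset (Fin d → ℤ) := Fintype.piFinset fun i : Fin d =>
    Finset.Icc (-(((2 * n) ^ d * H ^ (d - (i : ℕ)) : ℕ) : ℤ))
      (((2 * n) ^ d * H ^ (d - (i : ℕ)) : ℕ) : ℤ)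
  have hcard : t.card ≤ (3 * (2 * n) ^ d) ^ d * H ^ (d * (d + 1) / 2) := by
    have h1 : t.card ≤ ∏ i : Fin d, (3 * (2 * n) ^ d * H ^ (d - (i : ℕ))) := by
      rw [Fintype.card_piFinset]
      refine Finset.prod_le_prod' fun i _ => ?_
      rw [Int.card_Icc]
      have : 1 ≤ (2 * n) ^ d * H ^ (d - (i : ℕ)) := Nat.one_le_iff_ne_zero.2 (by positivity)
      rw [mul_assoc]
      omega
    refine h1.trans (le_of_eq ?_)
    rw [Finset.prod_mul_distrib, Finset.prod_const, Finset.card_univ, Fintype.card_fin,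
      Finset.prod_pow_eq_pow_sum, Fin.sum_univ_eq_sum_range (fun i => d - i) d, sum_sub_range]
  refine le_trans (Finset.card_le_mul_card_image_of_maps_to (t := t)
    (f := fun A => fun i : Fin d => (F A).coeff i) ?_ _ ?_) (Nat.mul_le_mul_left _ hcard)
  · intro A hA
    refine Fintype.mem_piFinset.2 fun i => ?_
    rw [Finset.mem_Icc, ← abs_le]
    exact hF4 A hA i
  · intro c _
    rcases Finset.eq_empty_or_nonempty ((facs n H d).filter
      fun A => (fun i : Fin d => (F A).coeff i) = c) with h | ⟨A₀, hA₀⟩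
    · rw [h]; simp
    · obtain ⟨h1, h2⟩ := Finset.mem_filter.1 hA₀
      have hdeg : ((F A₀).map (Int.castRingHom ℂ)).degree ≠ 0 := by
        intro h0
        have h3 := natDegree_eq_zero_iff_degree_le_zero.2 h0.le
        rw [(hF1 A₀ h1).natDegree_map, hF2 A₀ h1] at h3
        omega
      obtain ⟨α, hα⟩ := IsAlgClosed.exists_root _ hdeg
      refine le_trans (Finset.card_le_card ?_) (sol_le_sing (-(Matrix.scalar (Fin n) α)) H)
      intro A hA
      obtain ⟨h3, h4⟩ := Finset.mem_filter.1 hA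
      have hFF : F A = F A₀ := by
        ext i
        rcases lt_trichotomy i d with hi | hi | hi
        · have := congrFun (h4.trans h2.symm) ⟨i, hi⟩
          exact this
        · have e1 := (hF1 A h3).coeff_natDegree
          have e2 := (hF1 A₀ h1).coeff_natDegree
          rw [hF2 A h3] at e1
          rw [hF2 A₀ h1] at e2
          rw [hi, e1, e2]
        · rw [coeff_eq_zero_of_natDegree_lt (by rw [hF2 A h3]; exact hi),
            coeff_eq_zero_of_natDegree_lt (by rw [hF2 A₀ h1]; exact hi)]
      refine mem_sol.2 ⟨fun i => ?_, det_of_root A α (hF3 A h3 α (by rw [hFF]; exact hα))⟩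
      simpa using mem_mbox.1 (Finset.mem_filter.1 h3).1 i

/-- Lemma 2.4: for `1 ≤ r ≤ n/2`, the number of matrices in `M_n(ℤ;H)` whose characteristic
polynomial has an irreducible factor over `ℚ` of degree at most `r` is
`O(H^(n²-n+r(r+1)/2) log H)`. -/
theorem low_degree_eigenvalue_matrix_count (n r : ℕ) (hn : 2 ≤ n) (hr : 1 ≤ r)
    (hrn : 2 * r ≤ n) :
    ∃ C : ℝ, 0 < C ∧ ∀ H : ℕ, 2 ≤ H →
      (Set.ncard {A : Matrix (Fin n) (Fin n) ℤ | (∀ i j, |A i j| ≤ (H : ℤ)) ∧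
        ∃ g : Polynomial ℚ, g.Monic ∧ Irreducible g ∧ g.natDegree ≤ r ∧
          g ∣ Polynomial.map (Int.castRingHom ℚ) A.charpoly} : ℝ) ≤
      C * (H : ℝ) ^ (n ^ 2 - n + r * (r + 1) / 2) * Real.log H := by
  classical
  obtain ⟨C, hC, hS⟩ := sing_count n (by omega)
  refine ⟨C * (r * (3 * (2 * n) ^ r) ^ r : ℕ), by positivity, fun H hH => ?_⟩
  have hsub : {A : Matrix (Fin n) (Fin n) ℤ | (∀ i j, |A i j| ≤ (H : ℤ)) ∧
        ∃ g : Polynomial ℚ, g.Monic ∧ Irreducible g ∧ g.natDegree ≤ r ∧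
          g ∣ Polynomial.map (Int.castRingHom ℚ) A.charpoly} ⊆
      (((Finset.Icc 1 r).biUnion fun d => facs n H d : Finset (Matrix (Fin n) (Fin n) ℤ)) :
        Set (Matrix (Fin n) (Fin n) ℤ)) := by
    rintro A ⟨hA, g, hg, hirr, hdeg, hdvd⟩
    rw [Finset.mem_coe, Finset.mem_biUnion]
    refine ⟨g.natDegree, Finset.mem_Icc.2 ⟨hirr.natDegree_pos, hdeg⟩, ?_⟩
    exact Finset.mem_filter.2 ⟨mem_mbox.2 fun i => mem_bx.2 (hA i), g, hg, hirr, rfl, hdvd⟩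
  have h1 := Set.ncard_le_ncard hsub (Finset.finite_toSet _)
  rw [Set.ncard_coe_finset] at h1
  have h2 : ((Finset.Icc 1 r).biUnion fun d => facs n H d).card ≤
      (Finset.Icc 1 r).card * ((sing n (2 * H)).card *
        ((3 * (2 * n) ^ r) ^ r * H ^ (r * (r + 1) / 2))) := by
    refine Finset.card_biUnion_le_card_mul _ _ _ fun d hd => ?_
    obtain ⟨hd1, hdr⟩ := Finset.mem_Icc.1 hd
    refine (facs_count (by omega) (by omega) hd1).trans (Nat.mul_le_mul_left _ ?_)
    have e1 : (2 * n) ^ d ≤ (2 * n) ^ r := Nat.pow_le_pow_right (by omega) hdr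
    have e2 : (3 * (2 * n) ^ d) ^ d ≤ (3 * (2 * n) ^ r) ^ r :=
      (Nat.pow_le_pow_left (Nat.mul_le_mul_left 3 e1) d).trans
        (Nat.pow_le_pow_right (by positivity) hdr)
    have e3 : d * (d + 1) / 2 ≤ r * (r + 1) / 2 :=
      Nat.div_le_div_right (Nat.mul_le_mul hdr (by omega))
    exact Nat.mul_le_mul e2 (Nat.pow_le_pow_right (by omega) e3)
  rw [Nat.card_Icc, Nat.add_sub_cancel] at h2
  have h3 := h1.trans h2
  have h4 : ((Set.ncard {A : Matrix (Fin n) (Fin n) ℤ | (∀ i j, |A i j| ≤ (H : ℤ)) ∧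
        ∃ g : Polynomial ℚ, g.Monic ∧ Irreducible g ∧ g.natDegree ≤ r ∧
          g ∣ Polynomial.map (Int.castRingHom ℚ) A.charpoly} : ℕ) : ℝ) ≤
      ((r * (3 * (2 * n) ^ r) ^ r : ℕ) : ℝ) * (H : ℝ) ^ (r * (r + 1) / 2) *
        ((sing n (2 * H)).card : ℝ) := by
    refine (Nat.cast_le.2 h3).trans (le_of_eq ?_)
    push_cast
    ring
  refine h4.trans ?_
  calc _ ≤ ((r * (3 * (2 * n) ^ r) ^ r : ℕ) : ℝ) * (H : ℝ) ^ (r * (r + 1) / 2) *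
        (C * (H : ℝ) ^ (n ^ 2 - n) * Real.log H) := by
        gcongr
        exact hS H hH
    _ = _ := by rw [pow_add]; ring
end

section
/- Fix integers n ≥ 1 and r ≥ 1. There exists a constant C > 0 (depending only on n and r) such that for all integers H ≥ 1, the set of complex numbers λ that are algebraic of degree at most r over ℚ and are an eigenvalue of at least one matrix A ∈ M_n(ℤ;H) has cardinality at most C · H^(r(r+1)/2). -/
open Matrix Polynomial

lemma aux_eig_bound (n H : ℕ) (A : Matrix (Fin n) (Fin n) ℤ) (hA : ∀ i j, |A i j| ≤ (H : ℤ)) (z : ℂ)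
    (hz : (A.charpoly.map (Int.castRingHom ℂ)).IsRoot z) : ‖z‖ ≤ (n : ℝ) * H := by
  rw [← Matrix.charpoly_map] at hz
  have h2 : Module.End.HasEigenvalue (Matrix.toLin' (A.map (Int.castRingHom ℂ))) z := by
    rw [Module.End.hasEigenvalue_iff_isRoot_charpoly, Matrix.charpoly_toLin']
    exact hz
  obtain ⟨k, hk⟩ := eigenvalue_mem_ball h2
  have hb : ∀ j, ‖(A.map (Int.castRingHom ℂ)) k j‖ ≤ (H : ℝ) := by
    intro j
    simp only [Matrix.map_apply, eq_intCast, Complex.norm_intCast]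
    exact_mod_cast hA k j
  rw [mem_closedBall_iff_norm] at hk
  have h3 : ‖z‖ ≤ ‖z - (A.map (Int.castRingHom ℂ)) k k‖ + ‖(A.map (Int.castRingHom ℂ)) k k‖ := by
    simpa using norm_add_le (z - (A.map (Int.castRingHom ℂ)) k k) ((A.map (Int.castRingHom ℂ)) k k)
  calc ‖z‖ ≤ ∑ j ∈ Finset.univ.erase k, ‖(A.map (Int.castRingHom ℂ)) k j‖ +
        ‖(A.map (Int.castRingHom ℂ)) k k‖ := h3.trans (by gcongr)
    _ = ∑ j, ‖(A.map (Int.castRingHom ℂ)) k j‖ :=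
        Finset.sum_erase_add _ (f := fun j => ‖(A.map (Int.castRingHom ℂ)) k j‖) (Finset.mem_univ k)
    _ ≤ ∑ j : Fin n, (H : ℝ) := Finset.sum_le_sum fun j _ => hb j
    _ = n * H := by simp

lemma aux_poly (n r H : ℕ) (hn : 1 ≤ n) (A : Matrix (Fin n) (Fin n) ℤ)
    (hA : ∀ i j, |A i j| ≤ (H : ℤ)) (lam : ℂ)
    (hd : (minpoly ℚ lam).natDegree ≤ r)
    (hdet : (A.map (Int.cast : ℤ → ℂ) - lam • (1 : Matrix (Fin n) (Fin n) ℂ)).det = 0) :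
    ∃ p : ℤ[X], p.Monic ∧ p.natDegree = r ∧ (p.map (Int.castRingHom ℂ)).IsRoot lam ∧
      ∀ k < r, |p.coeff k| ≤ ((2 * n) ^ r : ℕ) * (H : ℤ) ^ (r - k) := by
  have hroot : (A.charpoly.map (Int.castRingHom ℂ)).IsRoot lam := by
    rw [← Matrix.charpoly_map, IsRoot, Matrix.eval_charpoly]
    have : (Matrix.scalar (Fin n) lam - A.map (Int.castRingHom ℂ)) =
      -(A.map (Int.cast : ℤ → ℂ) - lam • (1 : Matrix (Fin n) (Fin n) ℂ)) := by
      rw [neg_sub, Matrix.smul_one_eq_diagonal]; rfl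
    rw [this, Matrix.det_neg, hdet, mul_zero]
  have haev : aeval lam A.charpoly = 0 := by
    rw [IsRoot, eval_map] at hroot
    exact hroot
  have hint : IsIntegral ℤ lam := ⟨A.charpoly, A.charpoly_monic, haev⟩
  have hdvd : minpoly ℤ lam ∣ A.charpoly := minpoly.isIntegrallyClosed_dvd hint haev
  have hm := minpoly.monic hint
  have hdeg : (minpoly ℤ lam).natDegree ≤ r := by
    rw [minpoly.isIntegrallyClosed_eq_field_fractions' ℚ hint, hm.natDegree_map] at hd
    exact hd
  have hpm : (minpoly ℤ lam * X ^ (r - (minpoly ℤ lam).natDegree)).Monic := hm.mul (monic_X_pow _)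
  have hpd : (minpoly ℤ lam * X ^ (r - (minpoly ℤ lam).natDegree)).natDegree = r := by
    rw [hm.natDegree_mul (monic_X_pow _), natDegree_X_pow]; omega
  refine ⟨_, hpm, hpd, ?_, ?_⟩
  · have : aeval lam (minpoly ℤ lam) = 0 := minpoly.aeval ℤ lam
    rw [aeval_def] at this
    simp only [IsRoot, Polynomial.map_mul, eval_mul, eval_map]
    rw [show Int.castRingHom ℂ = algebraMap ℤ ℂ from rfl, this, zero_mul]
  · intro k hk
    have hB : ∀ z ∈ ((minpoly ℤ lam * X ^ (r - (minpoly ℤ lam).natDegree)).map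
        (Int.castRingHom ℂ)).roots, ‖z‖ ≤ (n : ℝ) * H := by
      intro z hz
      have hz' := (mem_roots'.1 hz).2
      rw [Polynomial.map_mul, IsRoot, eval_mul, mul_eq_zero] at hz'
      rcases hz' with h | h
      · exact aux_eig_bound n H A hA z (IsRoot.dvd h (Polynomial.map_dvd _ hdvd))
      · have : z = 0 := by
          simp only [Polynomial.map_pow, map_X, eval_pow, eval_X] at h
          exact eq_zero_of_pow_eq_zero h
        rw [this, norm_zero]; positivity
    have h := Polynomial.coeff_le_of_roots_le (p := minpoly ℤ lam * X ^ (r - (minpoly ℤ lam).natDegree))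
      (f := Int.castRingHom ℂ) k hpm (IsAlgClosed.splits _) hB
    rw [hpd] at h
    set p := minpoly ℤ lam * X ^ (r - (minpoly ℤ lam).natDegree)
    rw [coeff_map, eq_intCast, Complex.norm_intCast] at h
    have hc : ((r.choose k : ℕ) : ℝ) ≤ 2 ^ r := by exact_mod_cast Nat.choose_le_two_pow r k
    have hn' : (1 : ℝ) ≤ n := by exact_mod_cast hn
    have : (|p.coeff k| : ℝ) ≤ ((2 * n) ^ r : ℕ) * (H : ℝ) ^ (r - k) := by
      calc _ ≤ _ := h
        _ ≤ ((n : ℝ) ^ r * (H : ℝ) ^ (r - k)) * 2 ^ r := by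
            rw [mul_pow]
            gcongr
            · omega
        _ = _ := by push_cast; ring
    exact_mod_cast this

/-- Bound (2.4): the set of complex numbers that are algebraic of degree at most `r` over `ℚ`
and are an eigenvalue of some matrix in `M_n(ℤ;H)` has cardinality `O(H^(r(r+1)/2))`. -/
theorem low_degree_eigenvalue_count (n r : ℕ) (hn : 1 ≤ n) (hr : 1 ≤ r) :
    ∃ C : ℝ, 0 < C ∧ ∀ H : ℕ, 1 ≤ H →
      (Set.ncard {lam : ℂ | IsAlgebraic ℚ lam ∧ (minpoly ℚ lam).natDegree ≤ r ∧
        ∃ A : Matrix (Fin n) (Fin n) ℤ, (∀ i j, |A i j| ≤ (H : ℤ)) ∧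
          (A.map (Int.cast : ℤ → ℂ) - lam • (1 : Matrix (Fin n) (Fin n) ℂ)).det = 0} : ℝ) ≤
      C * (H : ℝ) ^ (r * (r + 1) / 2) := by
  classical
  set K : ℕ := (2 * n) ^ r with hK
  have hKpos : 1 ≤ K := Nat.one_le_pow _ _ (by omega)
  refine ⟨(((3 * K) ^ r * r : ℕ) : ℝ), by positivity, fun H hH => ?_⟩
  set S := {lam : ℂ | IsAlgebraic ℚ lam ∧ (minpoly ℚ lam).natDegree ≤ r ∧
        ∃ A : Matrix (Fin n) (Fin n) ℤ, (∀ i j, |A i j| ≤ (H : ℤ)) ∧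
          (A.map (Int.cast : ℤ → ℂ) - lam • (1 : Matrix (Fin n) (Fin n) ℂ)).det = 0} with hS
  let T : Finset (Fin r → ℤ) := Fintype.piFinset fun k : Fin r =>
    Finset.Icc (-((K : ℤ) * (H : ℤ) ^ (r - (k : ℕ)))) ((K : ℤ) * (H : ℤ) ^ (r - (k : ℕ)))
  let P : (Fin r → ℤ) → ℤ[X] := fun f => X ^ r + ∑ k : Fin r, C (f k) * X ^ (k : ℕ)
  let R : (Fin r → ℤ) → Finset ℂ := fun f =>
    if (P f).Monic ∧ (P f).natDegree = r then ((P f).map (Int.castRingHom ℂ)).roots.toFinset else ∅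
  have hsub : S ⊆ ↑(T.biUnion R) := by
    rintro lam ⟨-, hd, A, hA, hdet⟩
    obtain ⟨p, hpm, hpd, hroot, hc⟩ := aux_poly n r H hn A hA lam hd hdet
    have hPp : P (fun k => p.coeff k) = p := by
      conv_rhs => rw [hpm.as_sum, hpd]
      simp only [P]
      rw [Fin.sum_univ_eq_sum_range (fun k => C (p.coeff k) * X ^ k) r]
    rw [Finset.mem_coe, Finset.mem_biUnion]
    refine ⟨fun k => p.coeff k, ?_, ?_⟩
    · simp only [T, Fintype.mem_piFinset, Finset.mem_Icc]
      intro k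
      exact abs_le.1 (hc k k.2)
    · simp only [R, hPp, hpm, hpd, and_self, if_true, Multiset.mem_toFinset]
      exact (mem_roots (hpm.map _).ne_zero).2 hroot
  have h1 : S.ncard ≤ (T.biUnion R).card := by
    rw [← Set.ncard_coe_finset]
    exact Set.ncard_le_ncard hsub (Finset.finite_toSet _)
  have hR : ∀ f ∈ T, (R f).card ≤ r := by
    intro f _
    simp only [R]
    split_ifs with h
    · refine (Multiset.toFinset_card_le _).trans ((card_roots' _).trans ?_)
      exact natDegree_map_le.trans h.2.le
    · simp
  have hsum : ∑ k : Fin r, (r - (k : ℕ)) = r * (r + 1) / 2 := by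
    rw [Fin.sum_univ_eq_sum_range (fun k => r - k) r, ← Finset.sum_range_reflect]
    have : ∀ j ∈ Finset.range r, r - (r - 1 - j) = j + 1 := by
      intro j hj
      have := Finset.mem_range.1 hj
      omega
    rw [Finset.sum_congr rfl this]
    have h := Finset.sum_range_succ' (fun i => i) r
    rw [Finset.sum_range_id] at h
    simp only [add_zero, Nat.add_sub_cancel] at h
    rw [← h, mul_comm]
  have hT : T.card ≤ (3 * K) ^ r * H ^ (r * (r + 1) / 2) := by
    simp only [T, Fintype.card_piFinset, Int.card_Icc]
    calc _ ≤ ∏ k : Fin r, (3 * K) * H ^ (r - (k : ℕ)) := by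
          refine Finset.prod_le_prod' fun k _ => ?_
          have h0 : 1 ≤ K * H ^ (r - (k : ℕ)) := Nat.mul_pos hKpos (Nat.pow_pos hH)
          have e : (K : ℤ) * (H : ℤ) ^ (r - (k : ℕ)) = ((K * H ^ (r - (k : ℕ)) : ℕ) : ℤ) := by
            push_cast; rfl
          rw [e, mul_assoc]
          omega
      _ = _ := by
          rw [Finset.prod_mul_distrib, Finset.prod_pow_eq_pow_sum, hsum]
          simp
  have h2 : S.ncard ≤ (3 * K) ^ r * r * H ^ (r * (r + 1) / 2) :=
    calc _ ≤ _ := h1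
      _ ≤ T.card * r := Finset.card_biUnion_le_card_mul _ _ _ hR
      _ ≤ ((3 * K) ^ r * H ^ (r * (r + 1) / 2)) * r := Nat.mul_le_mul_right _ hT
      _ = _ := by ring
  exact_mod_cast h2
end

section
/- Let n ≥ 2 be an integer and d ∈ ℤ. Let D_n be the polynomial in the n² variables X_{ij} (1 ≤ i,j ≤ n) over ℚ obtained as the discriminant of the characteristic polynomial of the generic matrix (X_{ij}). Then the polynomial D_n − d is absolutely irreducible over ℚ, i.e., its image under the base change ℚ → ℂ is irreducible in the ring of polynomials in the n² variables X_{ij} over ℂ. -/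
open Matrix Polynomial

/-- The Sylvester matrix of `f` and `g`, where `f` is regarded as a polynomial of degree `m`
and `g` as a polynomial of degree `n`: the `(m+n) × (m+n)` matrix whose first `n` rows carry
the shifted coefficient vectors of `f` and whose last `m` rows carry those of `g`. -/
def sylvesterMatrix {R : Type*} [CommRing R] (m n : ℕ) (f g : Polynomial R) :
    Matrix (Fin (m + n)) (Fin (m + n)) R := fun i j =>
  if (i : ℕ) < n then
    (if (i : ℕ) ≤ (j : ℕ) ∧ (j : ℕ) ≤ m + (i : ℕ) then f.coeff (m + (i : ℕ) - (j : ℕ)) else 0)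
  else
    (if (i : ℕ) - n ≤ (j : ℕ) ∧ (j : ℕ) ≤ n + ((i : ℕ) - n) then
      g.coeff (n + ((i : ℕ) - n) - (j : ℕ)) else 0)

/-- The resultant `Res(f,g)` of `f` (regarded as having degree `m`) and `g` (regarded as
having degree `n`), i.e. the determinant of their Sylvester matrix. -/
def polyResultant {R : Type*} [CommRing R] (m n : ℕ) (f g : Polynomial R) : R :=
  (sylvesterMatrix m n f g).det

/-- The discriminant `(-1)^(n(n-1)/2) · Res(f, f')` of a monic polynomial `f` of degree `n`. -/
noncomputable def polyDiscr {R : Type*} [CommRing R] (n : ℕ) (f : Polynomial R) : R :=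
  (-1) ^ (n * (n - 1) / 2) * polyResultant n (n - 1) f (Polynomial.derivative f)

/-- The generic `n × n` matrix, whose entries are the `n²` independent variables `X_{ij}`. -/
noncomputable def genericMatrix (n : ℕ) :
    Matrix (Fin n) (Fin n) (MvPolynomial (Fin n × Fin n) ℚ) :=
  Matrix.of fun i j => MvPolynomial.X (i, j)

namespace DiscrIrr

theorem polyResultant_eq {R : Type*} [CommRing R] (m n : ℕ) (f g : Polynomial R) :
    polyResultant m n f g = Polynomial.resultant f g m n := by
  have h : sylvesterMatrix m n f g =
      ((Polynomial.sylvester f g m n)ᵀ).submatrix Fin.revPerm Fin.revPerm := by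
    ext i j
    obtain ⟨i', rfl⟩ := Fin.revPerm.surjective i
    simp only [Matrix.submatrix_apply, Matrix.transpose_apply, Polynomial.sylvester,
      Matrix.of_apply, Fin.revPerm_apply, Fin.rev_rev]
    have hj := j.isLt
    induction i' using Fin.addCases with
    | left a =>
      have ha := a.isLt
      simp only [Fin.addCases_left, sylvesterMatrix, Fin.val_rev, Fin.val_castAdd, Set.mem_Icc]
      rw [if_neg (by omega)]
      split_ifs <;> first | omega | rfl | (congr 1; omega)
    | right a =>
      have ha := a.isLt
      simp only [Fin.addCases_right, sylvesterMatrix, Fin.val_rev, Fin.val_natAdd, Set.mem_Icc]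
      rw [if_pos (by omega)]
      split_ifs <;> first | omega | rfl | (congr 1; omega)
  rw [polyResultant, h, Matrix.det_submatrix_equiv_self, Matrix.det_transpose]
  rfl

theorem polyDiscr_map {R S : Type*} [CommRing R] [CommRing S] (φ : R →+* S) (n : ℕ)
    (f : Polynomial R) : φ (polyDiscr n f) = polyDiscr n (f.map φ) := by
  simp only [polyDiscr, polyResultant_eq, Polynomial.derivative_map,
    Polynomial.resultant_map_map, map_mul, map_pow, map_neg, map_one]

theorem polyDiscr_diagonal {R : Type*} [CommRing R] [IsDomain R] (n : ℕ) (x : Fin n → R) :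
    polyDiscr n (Matrix.charpoly (Matrix.diagonal x)) = (-1) ^ (n * (n - 1) / 2) *
      ∏ p ∈ (Finset.univ : Finset (Fin n)).offDiag, (x p.1 - x p.2) := by
  rw [polyDiscr, polyResultant_eq, Matrix.charpoly_diagonal]
  congr 1
  have hdeg : (∏ i, (X - C (x i)) : R[X]).natDegree = n := by
    simp
  have h := Polynomial.resultant_prod_left (Finset.univ : Finset (Fin n)) (fun i => X - C (x i))
    (derivative (∏ i, (X - C (x i)))) (n - 1) (by simp)
    ((Polynomial.natDegree_derivative_le _).trans (by rw [hdeg]))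
  rw [hdeg] at h
  rw [h, Finset.prod_finset_product' (Finset.univ : Finset (Fin n)).offDiag Finset.univ
    (fun i => Finset.univ.erase i) (by intro p; simp [eq_comm]) (f := fun a b => x a - x b)]
  refine Finset.prod_congr rfl fun i _ => ?_
  rw [Polynomial.natDegree_X_sub_C, Polynomial.resultant_X_sub_C_left _ _ _
    ((Polynomial.natDegree_derivative_le _).trans (by rw [hdeg]))]
  have := Lagrange.eval_nodal_derivative_eval_node_eq (s := Finset.univ) (v := x)
    (Finset.mem_univ i)
  rw [Lagrange.nodal, Lagrange.eval_nodal] at this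
  exact this

theorem charpoly_smul_coeff {R : Type*} [CommRing R] [IsDomain R] {n : ℕ} (s : R) (hs : s ≠ 0)
    (M : Matrix (Fin n) (Fin n) R) :
    (s • M).charpoly = M.charpoly.scaleRoots s := by
  have h1 : (s • M).charpoly.comp (C s * X) = C (s ^ n) * M.charpoly := by
    rw [Matrix.charpoly, Matrix.charpoly, ← Polynomial.coe_compRingHom_apply, RingHom.map_det]
    have : C (s ^ n) = (C s) ^ (Fintype.card (Fin n)) := by simp
    rw [this, ← Matrix.det_smul]
    congr 1
    ext i j : 2
    by_cases hij : i = j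
    · subst hij
      simp [Matrix.charmatrix_apply, mul_sub]
    · simp [Matrix.charmatrix_apply, hij]
  ext k
  have h2 := congrArg (fun p => p.coeff k) h1
  simp only [Polynomial.comp_C_mul_X_coeff, Polynomial.coeff_C_mul] at h2
  rw [Polynomial.coeff_scaleRoots, Matrix.charpoly_natDegree_eq_dim, Fintype.card_fin]
  by_cases hk : k ≤ n
  · apply mul_right_cancel₀ (pow_ne_zero k hs)
    rw [h2, mul_assoc, ← pow_add, Nat.sub_add_cancel hk, mul_comm]
  · rw [Polynomial.coeff_eq_zero_of_natDegree_lt, Polynomial.coeff_eq_zero_of_natDegree_lt,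
      zero_mul] <;> simpa [Matrix.charpoly_natDegree_eq_dim] using hk

theorem polyDiscr_smul {R : Type*} [CommRing R] [IsDomain R] [CharZero R] {n : ℕ}
    (s : R) (hs : s ≠ 0) (M : Matrix (Fin n) (Fin n) R) :
    polyDiscr n (s • M).charpoly = s ^ (n * (n - 1)) * polyDiscr n M.charpoly := by
  rw [charpoly_smul_coeff s hs, polyDiscr, polyDiscr, polyResultant_eq, polyResultant_eq]
  have hd : M.charpoly.natDegree = n := by simp [Matrix.charpoly_natDegree_eq_dim]
  have hd' : (derivative M.charpoly).natDegree = n - 1 := by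
    rw [Polynomial.natDegree_derivative, hd]
  have hder : derivative (M.charpoly.scaleRoots s) = (derivative M.charpoly).scaleRoots s := by
    ext k
    rw [Polynomial.coeff_derivative, Polynomial.coeff_scaleRoots, Polynomial.coeff_scaleRoots,
      Polynomial.coeff_derivative, hd, hd', show n - (k+1) = n - 1 - k by omega]
    ring
  have h := Polynomial.resultant_scaleRoots M.charpoly (derivative M.charpoly) s
  rw [Polynomial.natDegree_scaleRoots, Polynomial.natDegree_scaleRoots, hd, hd'] at h
  rw [hder, h]
  ring

/-- The path of unimodular matrices. -/
noncomputable def pathP {R : Type*} [CommRing R] {n : ℕ} (i j : Fin n) (t : R) :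
    Matrix (Fin n) (Fin n) R :=
  transvection i j t * transvection j i (-t) * transvection i j t

theorem pathP_mul {R : Type*} [CommRing R] {n : ℕ} {i j : Fin n} (h : i ≠ j) (t : R) :
    pathP i j t * pathP i j (-t) = 1 := by
  have e1 : ∀ s : R, transvection i j s * transvection i j (-s) = 1 := fun s => by
    rw [transvection_mul_transvection_same _ _ h, add_neg_cancel, transvection_zero]
  have e2 : ∀ s : R, transvection j i s * transvection j i (-s) = 1 := fun s => by
    rw [transvection_mul_transvection_same _ _ h.symm, add_neg_cancel, transvection_zero]
  simp only [pathP]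
  calc _ = transvection i j t * (transvection j i (-t) * (transvection i j t *
        transvection i j (-t)) * transvection j i (-(-t))) * transvection i j (-t) := by
        simp only [Matrix.mul_assoc]
    _ = 1 := by rw [e1, Matrix.mul_one, e2, Matrix.mul_one, e1]

theorem pathP_zero {R : Type*} [CommRing R] {n : ℕ} (i j : Fin n) :
    pathP i j (0 : R) = 1 := by
  simp [pathP]

theorem pathP_map {R S : Type*} [CommRing R] [CommRing S] (φ : R →+* S) {n : ℕ} (i j : Fin n)
    (t : R) : (pathP i j t).map φ = pathP i j (φ t) := by
  have e : ∀ (a b : Fin n) (s : R), (transvection a b s).map φ = transvection a b (φ s) := by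
    intro a b s
    simp [transvection, Matrix.map_add, Matrix.map_single]
  simp only [pathP, Matrix.map_mul, e, map_neg]

theorem pathP_one_diag {R : Type*} [CommRing R] {n : ℕ} {i j : Fin n} (h : i ≠ j)
    (x : Fin n → R) :
    pathP i j (1 : R) * diagonal x = diagonal (fun k => x (Equiv.swap i j k)) * pathP i j 1 := by
  have e : pathP i j (1 : R) = 1 - single i i 1 - single j j 1 + single i j 1 - single j i 1 := by
    simp only [pathP, transvection, Matrix.mul_add, Matrix.add_mul, Matrix.mul_one, Matrix.one_mul]
    simp [h, h.symm, Matrix.single_mul_single_same, Matrix.single_mul_single_of_ne]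
    simp only [← Matrix.single_neg]
    abel
  rw [e]
  ext k l
  simp only [Matrix.mul_diagonal, Matrix.diagonal_mul, Matrix.sub_apply, Matrix.add_apply,
    Matrix.one_apply, Matrix.single_apply]
  by_cases hki : k = i <;> by_cases hkj : k = j <;> by_cases hli : l = i <;>
    by_cases hlj : l = j <;> by_cases hkl : k = l <;>
    simp_all [Equiv.swap_apply_of_ne_of_ne, eq_comm]

/-! ### Divisibility by `X i - X j` -/

/-- Substitute `X j` for `X i`. -/
noncomputable def theta {n : ℕ} (i j : Fin n) :
    MvPolynomial (Fin n) ℂ →ₐ[ℂ] MvPolynomial (Fin n) ℂ :=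
  MvPolynomial.aeval (fun k => if k = i then MvPolynomial.X j else MvPolynomial.X k)

theorem dvd_iff_theta {n : ℕ} (i j : Fin n) (p : MvPolynomial (Fin n) ℂ) :
    (MvPolynomial.X i - MvPolynomial.X j : MvPolynomial (Fin n) ℂ) ∣ p ↔ theta i j p = 0 := by
  constructor
  · rintro ⟨q, rfl⟩
    rw [map_mul]
    have : theta i j (MvPolynomial.X i - MvPolynomial.X j) = 0 := by
      simp [theta]
    rw [this, zero_mul]
  · intro h
    let I := Ideal.span {(MvPolynomial.X i - MvPolynomial.X j : MvPolynomial (Fin n) ℂ)}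
    have e : (Ideal.Quotient.mkₐ ℂ I).comp (theta i j) = Ideal.Quotient.mkₐ ℂ I := by
      ext k
      by_cases hk : k = i
      · subst hk
        simp only [theta, AlgHom.comp_apply, MvPolynomial.aeval_X, if_true,
          Ideal.Quotient.mkₐ_eq_mk]
        rw [eq_comm, Ideal.Quotient.eq]
        exact Ideal.subset_span rfl
      · simp [theta, hk]
    have h2 := DFunLike.congr_fun e p
    rw [AlgHom.comp_apply, h, map_zero, eq_comm, Ideal.Quotient.mkₐ_eq_mk,
      Ideal.Quotient.eq_zero_iff_mem] at h2
    exact Ideal.mem_span_singleton.mp h2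

theorem prime_sub {n : ℕ} {i j : Fin n} (h : i ≠ j) :
    Prime (MvPolynomial.X i - MvPolynomial.X j : MvPolynomial (Fin n) ℂ) := by
  refine ⟨?_, ?_, ?_⟩
  · rw [sub_ne_zero]
    exact fun e => h (MvPolynomial.X_injective e)
  · intro hu
    have h1 := (dvd_iff_theta i j 1).mp hu.dvd
    rw [map_one] at h1
    exact one_ne_zero h1
  · intro a b hab
    rw [dvd_iff_theta] at hab ⊢
    rw [dvd_iff_theta]
    rw [map_mul] at hab
    exact mul_eq_zero.mp hab

theorem sq_dvd {n : ℕ} {i j : Fin n} (h : i ≠ j) (F : MvPolynomial (Fin n) ℂ)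
    (hF : MvPolynomial.rename (Equiv.swap i j) F = F)
    (hd : (MvPolynomial.X i - MvPolynomial.X j : MvPolynomial (Fin n) ℂ) ∣ F) :
    (MvPolynomial.X i - MvPolynomial.X j : MvPolynomial (Fin n) ℂ) ^ 2 ∣ F := by
  obtain ⟨H, rfl⟩ := hd
  rw [pow_two]
  apply mul_dvd_mul_left
  have hH : MvPolynomial.rename (Equiv.swap i j) H = - H := by
    apply mul_left_cancel₀ (prime_sub h).ne_zero
    rw [map_mul, map_sub, MvPolynomial.rename_X, MvPolynomial.rename_X, Equiv.swap_apply_left,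
      Equiv.swap_apply_right] at hF
    linear_combination -hF
  rw [dvd_iff_theta]
  have e : theta i j (MvPolynomial.rename (Equiv.swap i j) H) = theta i j H := by
    rw [theta, MvPolynomial.aeval_rename]
    congr 2
    ext1 k
    simp only [Function.comp]
    by_cases hki : k = i
    · subst hki; simp
    · by_cases hkj : k = j
      · subst hkj; simp
      · rw [Equiv.swap_apply_of_ne_of_ne hki hkj]
  rw [hH, map_neg] at e
  have : (2 : MvPolynomial (Fin n) ℂ) * theta i j H = 0 := by linear_combination -e
  exact (mul_eq_zero.mp this).resolve_left two_ne_zero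

theorem transport_dvd {n : ℕ} {i j a b : Fin n} (h : i ≠ j) (hab : a ≠ b)
    (F : MvPolynomial (Fin n) ℂ)
    (hF : ∀ i j : Fin n, i ≠ j → MvPolynomial.rename (Equiv.swap i j) F = F)
    (hd : (MvPolynomial.X i - MvPolynomial.X j : MvPolynomial (Fin n) ℂ) ∣ F) :
    (MvPolynomial.X a - MvPolynomial.X b : MvPolynomial (Fin n) ℂ) ∣ F := by
  have hF' : ∀ i j : Fin n, MvPolynomial.rename (Equiv.swap i j) F = F := by
    intro i j
    by_cases hij : i = j
    · subst hij; simp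
    · exact hF i j hij
  have step : ∀ k l i j : Fin n,
      (MvPolynomial.X i - MvPolynomial.X j : MvPolynomial (Fin n) ℂ) ∣ F →
      (MvPolynomial.X (Equiv.swap k l i) - MvPolynomial.X (Equiv.swap k l j) :
        MvPolynomial (Fin n) ℂ) ∣ F := by
    intro k l i j hd
    have := map_dvd (MvPolynomial.rename (R := ℂ) (Equiv.swap k l)) hd
    rwa [hF', map_sub, MvPolynomial.rename_X, MvPolynomial.rename_X] at this
  have h1 := step i a i j hd
  rw [Equiv.swap_apply_left] at h1
  have hne : a ≠ Equiv.swap i a j := by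
    intro e
    apply h
    apply (Equiv.swap i a).injective
    rw [Equiv.swap_apply_left, ← e]
  have h2 := step (Equiv.swap i a j) b _ _ h1
  rwa [Equiv.swap_apply_left, Equiv.swap_apply_of_ne_of_ne hne hab] at h2

/-- The product of differences. -/
noncomputable def vdm (n : ℕ) : MvPolynomial (Fin n) ℂ :=
  ∏ p ∈ (Finset.univ : Finset (Fin n)).offDiag, (MvPolynomial.X p.1 - MvPolynomial.X p.2)

theorem vdm_ne_zero (n : ℕ) : vdm n ≠ 0 := by
  rw [vdm, Finset.prod_ne_zero_iff]
  intro p hp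
  exact (prime_sub (by simpa using hp)).ne_zero

theorem exists_dvd {n : ℕ} (F : MvPolynomial (Fin n) ℂ) (hF : F ∣ vdm n) (hu : ¬ IsUnit F) :
    ∃ i j : Fin n, i ≠ j ∧
      (MvPolynomial.X i - MvPolynomial.X j : MvPolynomial (Fin n) ℂ) ∣ F := by
  have h0 : F ≠ 0 := fun h => vdm_ne_zero n (by rw [h] at hF; exact zero_dvd_iff.mp hF)
  obtain ⟨p, hp, hpF⟩ := WfDvdMonoid.exists_irreducible_factor hu h0
  have hpp : Prime p := hp.prime
  obtain ⟨q, hq, hpq⟩ := hpp.exists_mem_finset_dvd (hpF.trans hF)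
  have hne : q.1 ≠ q.2 := by simpa using hq
  refine ⟨q.1, q.2, hne, ?_⟩
  exact ((hpp.irreducible.associated_of_dvd (prime_sub hne).irreducible hpq).symm.dvd).trans hpF

theorem unit_or_unit {n : ℕ} (hn : 2 ≤ n) (F G : MvPolynomial (Fin n) ℂ)
    (h : F * G ∣ vdm n)
    (hF : ∀ i j : Fin n, i ≠ j → MvPolynomial.rename (Equiv.swap i j) F = F)
    (hG : ∀ i j : Fin n, i ≠ j → MvPolynomial.rename (Equiv.swap i j) G = G) :
    IsUnit F ∨ IsUnit G := by
  by_contra hcon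
  push Not at hcon
  obtain ⟨hFu, hGu⟩ := hcon
  let a : Fin n := ⟨0, by omega⟩
  let b : Fin n := ⟨1, by omega⟩
  have hab : a ≠ b := by simp [a, b]
  obtain ⟨i, j, hij, hd⟩ := exists_dvd F ((dvd_mul_right _ _).trans h) hFu
  obtain ⟨i', j', hij', hd'⟩ := exists_dvd G ((dvd_mul_left _ _).trans h) hGu
  have h1 := sq_dvd hab F (hF a b hab) (transport_dvd hij hab F hF hd)
  have h2 := sq_dvd hab G (hG a b hab) (transport_dvd hij' hab G hG hd')
  have h4 := (mul_dvd_mul h1 h2).trans h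
  have m1 : (a, b) ∈ (Finset.univ : Finset (Fin n)).offDiag := by simp [hab]
  have m2 : (b, a) ∈ (Finset.univ : Finset (Fin n)).offDiag.erase (a, b) := by
    simp [hab, hab.symm]
  rw [vdm, ← Finset.mul_prod_erase _ _ m1, ← Finset.mul_prod_erase _ _ m2] at h4
  have h5 : (MvPolynomial.X a - MvPolynomial.X b : MvPolynomial (Fin n) ℂ) ∣
      ∏ p ∈ ((Finset.univ : Finset (Fin n)).offDiag.erase (a, b)).erase (b, a),
        (MvPolynomial.X p.1 - MvPolynomial.X p.2) := by
    obtain ⟨c, hc⟩ := h4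
    refine ⟨-(MvPolynomial.X a - MvPolynomial.X b) * c, ?_⟩
    apply mul_left_cancel₀ (pow_ne_zero 2 (prime_sub hab).ne_zero)
    linear_combination -hc
  obtain ⟨p, hp, hdp⟩ := (prime_sub hab).exists_mem_finset_dvd h5
  rw [dvd_iff_theta] at hdp
  simp only [theta, map_sub, MvPolynomial.aeval_X, sub_eq_zero] at hdp
  obtain ⟨k, l⟩ := p
  simp only [Finset.mem_erase, Finset.mem_offDiag, Finset.mem_univ, true_and, ne_eq,
    Prod.mk.injEq, not_and] at hp hdp
  split_ifs at hdp with c1 c2 c2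
  · exact hp.2.2 (c1.trans c2.symm)
  · exact hp.2.1 c1 (MvPolynomial.X_injective hdp).symm
  · exact hp.1 (MvPolynomial.X_injective hdp) c2
  · exact hp.2.2 (MvPolynomial.X_injective hdp)

/-! ### The generic matrix over `ℂ` -/

/-- The generic matrix over `ℂ`. -/
noncomputable def genC (n : ℕ) : Matrix (Fin n) (Fin n) (MvPolynomial (Fin n × Fin n) ℂ) :=
  Matrix.of fun i j => MvPolynomial.X (i, j)

/-- The generic discriminant over `ℂ`. -/
noncomputable def DC (n : ℕ) : MvPolynomial (Fin n × Fin n) ℂ := polyDiscr n (genC n).charpoly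

theorem DC_aeval {S : Type*} [CommRing S] [Algebra ℂ S] (n : ℕ) (M : Matrix (Fin n) (Fin n) S) :
    MvPolynomial.aeval (fun p : Fin n × Fin n => M p.1 p.2) (DC n) = polyDiscr n M.charpoly := by
  have h := polyDiscr_map (MvPolynomial.aeval (R := ℂ)
    (fun p : Fin n × Fin n => M p.1 p.2)).toRingHom n (genC n).charpoly
  rw [← Matrix.charpoly_map] at h
  have e : (genC n).map (MvPolynomial.aeval (R := ℂ)
    (fun p : Fin n × Fin n => M p.1 p.2)).toRingHom = M := by
    ext i j
    simp [genC]
  rw [e] at h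
  exact h

/-- Restriction to diagonal matrices. -/
noncomputable def diagRes (n : ℕ) :
    MvPolynomial (Fin n × Fin n) ℂ →ₐ[ℂ] MvPolynomial (Fin n) ℂ :=
  MvPolynomial.aeval (fun p : Fin n × Fin n =>
    (Matrix.diagonal (MvPolynomial.X : Fin n → MvPolynomial (Fin n) ℂ)) p.1 p.2)

theorem diagRes_DC (n : ℕ) : diagRes n (DC n) = (-1) ^ (n * (n - 1) / 2) * vdm n := by
  rw [diagRes, DC_aeval, polyDiscr_diagonal, vdm]

theorem diagRes_DC_ne_zero (n : ℕ) : diagRes n (DC n) ≠ 0 := by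
  rw [diagRes_DC]
  exact mul_ne_zero (pow_ne_zero _ (neg_ne_zero.mpr one_ne_zero)) (vdm_ne_zero n)

theorem charpoly_conj {S : Type*} [CommRing S] {n : ℕ} (P Q A : Matrix (Fin n) (Fin n) S)
    (hQP : Q * P = 1) : (P * A * Q).charpoly = A.charpoly := by
  rw [Matrix.charpoly_mul_comm, ← Matrix.mul_assoc, hQP, Matrix.one_mul]

theorem aeval_swap {R : Type*} [CommRing R] [IsDomain R] [Algebra ℂ R] {n : ℕ} (x : Fin n → R)
    (hne : polyDiscr n (diagonal x).charpoly ≠ 0)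
    (f g : MvPolynomial (Fin n × Fin n) ℂ) (hfg : f * g = DC n)
    (i j : Fin n) (hij : i ≠ j) :
    MvPolynomial.aeval (fun p : Fin n × Fin n =>
      (diagonal fun k => x (Equiv.swap i j k)) p.1 p.2) f =
    MvPolynomial.aeval (fun p : Fin n × Fin n => (diagonal x) p.1 p.2) f := by
  have hQP : pathP i j (-X : R[X]) * pathP i j X = 1 := by
    have := pathP_mul hij (-X : R[X])
    rwa [neg_neg] at this
  obtain ⟨N, hN⟩ : ∃ N : Matrix (Fin n) (Fin n) R[X],
    N = pathP i j (X : R[X]) * (diagonal x).map (C : R →+* R[X]) * pathP i j (-X) := ⟨_, rfl⟩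
  obtain ⟨φ, hφ⟩ : ∃ φ : MvPolynomial (Fin n × Fin n) ℂ →ₐ[ℂ] R[X],
    φ = MvPolynomial.aeval (fun p : Fin n × Fin n => N p.1 p.2) := ⟨_, rfl⟩
  have hφD : φ (DC n) = C (polyDiscr n (diagonal x).charpoly) := by
    rw [hφ, DC_aeval, hN, charpoly_conj _ _ _ hQP, Matrix.charpoly_map, ← polyDiscr_map]
  have hprod : φ f * φ g = C (polyDiscr n (diagonal x).charpoly) := by
    rw [← map_mul, hfg, hφD]
  have hne : φ f * φ g ≠ 0 := by
    rw [hprod]; exact C_ne_zero.mpr hne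
  have hdeg : (φ f).natDegree = 0 := by
    have := congrArg Polynomial.natDegree hprod
    rw [natDegree_mul (left_ne_zero_of_mul hne) (right_ne_zero_of_mul hne), natDegree_C] at this
    omega
  have hc := Polynomial.eq_C_of_natDegree_eq_zero hdeg
  have key : (φ f).eval 0 = (φ f).eval 1 := by
    rw [hc, eval_C, eval_C]
  have hev : ∀ t : R, (φ f).eval t = MvPolynomial.aeval (fun p : Fin n × Fin n =>
      (pathP i j t * diagonal x * pathP i j (-t)) p.1 p.2) f := by
    intro t
    have hM : N.map (evalRingHom t) = pathP i j t * diagonal x * pathP i j (-t) := by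
      rw [hN]
      have hx : ((diagonal x).map (C : R →+* R[X])).map (evalRingHom t) = diagonal x := by
        ext a b
        simp only [Matrix.map_apply, coe_evalRingHom, eval_C]
      have ht : evalRingHom t X = t := by simp
      simp only [Matrix.map_mul, pathP_map, map_neg, hx, ht]
    have e1 : (evalRingHom t).comp φ.toRingHom =
        (MvPolynomial.aeval (R := ℂ) (fun p : Fin n × Fin n =>
      (pathP i j t * diagonal x * pathP i j (-t)) p.1 p.2)).toRingHom := by
      apply MvPolynomial.ringHom_ext
      · intro r
        simp [hφ, Polynomial.algebraMap_apply]
      · intro p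
        rw [← hM]
        simp [hφ]
    exact DFunLike.congr_fun e1 f
  rw [hev, hev, pathP_one_diag hij, Matrix.mul_assoc, Matrix.mul_assoc, pathP_mul hij, neg_zero,
    pathP_zero, Matrix.mul_one, Matrix.mul_one, Matrix.one_mul] at key
  exact key.symm

theorem rename_diagRes {n : ℕ} (f g : MvPolynomial (Fin n × Fin n) ℂ) (hfg : f * g = DC n)
    (i j : Fin n) (hij : i ≠ j) :
    MvPolynomial.rename (Equiv.swap i j) (diagRes n f) = diagRes n f := by
  have hne := diagRes_DC_ne_zero n
  rw [diagRes, DC_aeval] at hne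
  have key := aeval_swap (MvPolynomial.X : Fin n → MvPolynomial (Fin n) ℂ) hne f g hfg i j hij
  have e2 : (MvPolynomial.rename (Equiv.swap i j)).comp (diagRes n) =
      MvPolynomial.aeval (fun p : Fin n × Fin n =>
        (diagonal fun k => (MvPolynomial.X (Equiv.swap i j k) : MvPolynomial (Fin n) ℂ))
          p.1 p.2) := by
    apply MvPolynomial.algHom_ext
    intro p
    simp only [AlgHom.comp_apply, diagRes, MvPolynomial.aeval_X, Matrix.diagonal_apply]
    split_ifs <;> simp
  rw [← e2] at key
  exact key

/-! ### Scaling -/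

/-- The substitution `X ↦ T X`. -/
noncomputable def psi (σ : Type*) : MvPolynomial σ ℂ →ₐ[ℂ] (MvPolynomial σ ℂ)[X] :=
  MvPolynomial.aeval (fun i => C (MvPolynomial.X i) * X)

theorem psi_eval_one {σ : Type*} (p : MvPolynomial σ ℂ) : (psi σ p).eval 1 = p := by
  let ε : (MvPolynomial σ ℂ)[X] →ₐ[ℂ] MvPolynomial σ ℂ :=
    (Polynomial.aeval (R := MvPolynomial σ ℂ) 1).restrictScalars ℂ
  have e : ε.comp (psi σ) = AlgHom.id ℂ _ := by
    apply MvPolynomial.algHom_ext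
    intro i
    simp [ε, psi]
  have := DFunLike.congr_fun e p
  simpa [ε, Polynomial.coe_aeval_eq_eval] using this

theorem psi_eval_zero {σ : Type*} (p : MvPolynomial σ ℂ) :
    (psi σ p).eval 0 = MvPolynomial.C (MvPolynomial.constantCoeff p) := by
  have e : (evalRingHom (0 : MvPolynomial σ ℂ)).comp (psi σ).toRingHom =
      (MvPolynomial.C).comp MvPolynomial.constantCoeff := by
    apply MvPolynomial.ringHom_ext
    · intro r
      simp [psi, Polynomial.algebraMap_apply, MvPolynomial.algebraMap_eq]
    · intro i
      simp [psi]
  exact DFunLike.congr_fun e p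

theorem constantCoeff_psi_coeff {σ : Type*} (p : MvPolynomial σ ℂ) (k : ℕ) (hk : k ≠ 0) :
    MvPolynomial.constantCoeff ((psi σ p).coeff k) = 0 := by
  have e : ((Polynomial.mapRingHom (MvPolynomial.constantCoeff (σ := σ) (R := ℂ))).comp
      (psi σ).toRingHom) = Polynomial.C.comp MvPolynomial.constantCoeff := by
    apply MvPolynomial.ringHom_ext
    · intro r
      simp [psi, Polynomial.algebraMap_apply, MvPolynomial.algebraMap_eq]
    · intro i
      simp [psi]
  have := DFunLike.congr_fun e p
  have h2 := congrArg (fun q => q.coeff k) this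
  simpa [Polynomial.coeff_C, hk] using h2

theorem psi_DC {n : ℕ} : psi _ (DC n) = C (DC n) * X ^ (n * (n - 1)) := by
  let M : Matrix (Fin n) (Fin n) (MvPolynomial (Fin n × Fin n) ℂ)[X] := (genC n).map C
  have h : psi _ (DC n) = polyDiscr n ((X : (MvPolynomial (Fin n × Fin n) ℂ)[X]) • M).charpoly := by
    rw [← DC_aeval, psi]
    congr 2
    ext1 p
    simp [M, genC, X_mul_C]
  rw [h, polyDiscr_smul _ X_ne_zero, Matrix.charpoly_map, ← polyDiscr_map, mul_comm]
  rfl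

theorem isUnit_of_factor {n : ℕ} (f g : MvPolynomial (Fin n × Fin n) ℂ)
    (hfg : (psi _ f).leadingCoeff * (psi _ g).leadingCoeff = DC n)
    (hu : IsUnit (diagRes n (psi _ f).leadingCoeff)) : IsUnit f := by
  have hf0 : f ≠ 0 := by
    rintro rfl
    simp at hu
  by_cases hk : (psi _ f).natDegree = 0
  · have hc := Polynomial.eq_C_of_natDegree_eq_zero hk
    have h1 := psi_eval_one f
    have h0 := psi_eval_zero f
    rw [hc, eval_C] at h1 h0
    rw [h1] at h0
    rw [h0]
    apply IsUnit.map
    rw [isUnit_iff_ne_zero]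
    intro hz
    rw [hz, map_zero] at h0
    exact hf0 h0
  · exfalso
    have h1 := constantCoeff_psi_coeff f _ hk
    have h2 := hu.map (MvPolynomial.constantCoeff (σ := Fin n) (R := ℂ))
    have e : (MvPolynomial.constantCoeff (σ := Fin n) (R := ℂ)).comp (diagRes n).toRingHom =
        MvPolynomial.constantCoeff := by
      apply MvPolynomial.ringHom_ext
      · intro r; simp [diagRes, MvPolynomial.algebraMap_eq]
      · intro p
        simp only [diagRes, RingHom.comp_apply, AlgHom.toRingHom_eq_coe, RingHom.coe_coe,
          MvPolynomial.aeval_X, Matrix.diagonal_apply]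
        split_ifs <;> simp
    have h3 := DFunLike.congr_fun e (psi _ f).leadingCoeff
    have h4 : MvPolynomial.constantCoeff (diagRes n (psi _ f).leadingCoeff) = 0 := h3.trans h1
    rw [h4] at h2
    exact not_isUnit_zero h2

theorem main {n : ℕ} (hn : 2 ≤ n) (c : ℂ) : Irreducible (DC n - MvPolynomial.C c) := by
  have hD0 : DC n ≠ 0 := fun h => diagRes_DC_ne_zero n (by rw [h, map_zero])
  have hN : 0 < n * (n - 1) := Nat.mul_pos (by omega) (by omega)
  have hpsi : psi _ (DC n - MvPolynomial.C c) =
      C (DC n) * X ^ (n * (n - 1)) - C (MvPolynomial.C c) := by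
    rw [map_sub, psi_DC]
    congr 1
    simp [psi, Polynomial.algebraMap_apply, MvPolynomial.algebraMap_eq]
  have hlt : (C (MvPolynomial.C c : MvPolynomial (Fin n × Fin n) ℂ)).degree <
      (C (DC n) * X ^ (n * (n - 1))).degree := by
    rw [degree_C_mul_X_pow _ hD0]
    exact lt_of_le_of_lt degree_C_le (by exact_mod_cast hN)
  have hlead : (psi _ (DC n - MvPolynomial.C c)).leadingCoeff = DC n := by
    rw [hpsi, leadingCoeff_sub_of_degree_lt hlt, leadingCoeff_C_mul_X_pow]
  have hdeg : (psi _ (DC n - MvPolynomial.C c)).degree = ((n * (n - 1) : ℕ) : WithBot ℕ) := by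
    rw [hpsi, degree_sub_eq_left_of_degree_lt hlt, degree_C_mul_X_pow _ hD0]
  constructor
  · intro hu
    have h1 := (Polynomial.degree_eq_zero_of_isUnit (hu.map (psi _)))
    rw [hdeg] at h1
    have : n * (n - 1) = 0 := by exact_mod_cast h1
    omega
  · intro f g hfg
    have h1 : (psi _ f).leadingCoeff * (psi _ g).leadingCoeff = DC n := by
      rw [← leadingCoeff_mul, ← map_mul, ← hfg, hlead]
    have h2 : (psi _ g).leadingCoeff * (psi _ f).leadingCoeff = DC n := by rw [mul_comm, h1]
    have hdv : diagRes n (psi _ f).leadingCoeff * diagRes n (psi _ g).leadingCoeff ∣ vdm n := by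
      rw [← map_mul, h1, diagRes_DC]
      exact ((isUnit_one.neg.pow _).mul_left_dvd).mpr dvd_rfl
    rcases unit_or_unit hn _ _ hdv (rename_diagRes _ _ h1) (rename_diagRes _ _ h2) with h | h
    · exact Or.inl (isUnit_of_factor f g h1 h)
    · exact Or.inr (isUnit_of_factor g f h2 h)

end DiscrIrr

/-- Lemma 2.5: for any integer `d`, the polynomial `discr(𝐗) - d` in the `n²` variables
`X_{ij}` is absolutely irreducible over `ℚ`, i.e. irreducible after base change to `ℂ`. -/
theorem discr_sub_const_absolutely_irreducible (n : ℕ) (hn : 2 ≤ n) (d : ℤ) :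
    Irreducible (MvPolynomial.map (algebraMap ℚ ℂ)
      (polyDiscr n (Matrix.charpoly (genericMatrix n)) -
        (d : MvPolynomial (Fin n × Fin n) ℚ))) := by
  have h : MvPolynomial.map (algebraMap ℚ ℂ)
      (polyDiscr n (Matrix.charpoly (genericMatrix n)) -
        (d : MvPolynomial (Fin n × Fin n) ℚ)) = DiscrIrr.DC n - MvPolynomial.C (d : ℂ) := by
    have hM : (genericMatrix n).map (MvPolynomial.map (algebraMap ℚ ℂ)) = DiscrIrr.genC n := by
      ext i j : 2
      simp [genericMatrix, DiscrIrr.genC]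
    have hd : MvPolynomial.map (algebraMap ℚ ℂ) (d : MvPolynomial (Fin n × Fin n) ℚ) =
        MvPolynomial.C (d : ℂ) := by
      rw [map_intCast, map_intCast]
    rw [map_sub, DiscrIrr.polyDiscr_map, ← Matrix.charpoly_map, DiscrIrr.DC, hM, hd]
  rw [h]
  exact DiscrIrr.main hn d
end

section
/- Fix an integer n ≥ 2. For every ε > 0 there exists p₀ such that for every prime p ≥ p₀, the number of n×n matrices A over 𝔽_p whose characteristic polynomial is not squarefree in 𝔽_p[X] satisfies |#{A ∈ Mat_n(𝔽_p) : char poly of A not squarefree} − p^(n² − 1)| ≤ ε · p^(n² − 1). -/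
open Matrix Polynomial


set_option linter.unusedSectionVars false

section polys
variable {F : Type*} [Field F] [Fintype F]

/-- monic polynomials of degree m -/
def monS (F : Type*) [Field F] (m : ℕ) : Set F[X] := {f | f.Monic ∧ f.natDegree = m}
/-- squarefree ones -/
def sqS (F : Type*) [Field F] (m : ℕ) : Set F[X] := {f | f ∈ monS F m ∧ Squarefree f}
/-- non-squarefree ones -/
def nsqS (F : Type*) [Field F] (m : ℕ) : Set F[X] := {f | f ∈ monS F m ∧ ¬ Squarefree f}

lemma monS_equiv (m : ℕ) : Nonempty (monS F m ≃ (Fin m → F)) :=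
  ⟨(monicEquivDegreeLT m).trans (degreeLTEquiv F m).toEquiv⟩

lemma monS_finite (m : ℕ) : (monS F m).Finite := by
  obtain ⟨e⟩ := monS_equiv (F := F) m
  exact (Finite.of_equiv _ e.symm : Finite (monS F m))

lemma monS_card (m : ℕ) : (monS F m).ncard = Fintype.card F ^ m := by
  obtain ⟨e⟩ := monS_equiv (F := F) m
  rw [← Nat.card_coe_set_eq, Nat.card_congr e]
  simp

lemma sqS_finite (m : ℕ) : (sqS F m).Finite := (monS_finite m).subset fun _ h => h.1
lemma nsqS_finite (m : ℕ) : (nsqS F m).Finite := (monS_finite m).subset fun _ h => h.1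

lemma sqS_add (m : ℕ) : (sqS F m).ncard + (nsqS F m).ncard = Fintype.card F ^ m := by
  rw [← monS_card, ← Set.ncard_union_eq _ (sqS_finite m) (nsqS_finite m)]
  · congr 1
    ext f
    simp only [sqS, nsqS, Set.mem_union, Set.mem_ofPred_eq]
    tauto
  · rw [Set.disjoint_left]
    intro f h1 h2
    exact h2.2 h1.2

lemma nsqS_subset (m : ℕ) : nsqS F m ⊆ ⋃ d ∈ (Finset.Icc 1 m).filter (fun d => 2 * d ≤ m),
    (fun x : F[X] × F[X] => x.1 ^ 2 * x.2) '' (monS F d ×ˢ monS F (m - 2 * d)) := by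
  rintro f ⟨⟨hf, hd⟩, hs⟩
  simp only [Squarefree, not_forall] at hs
  obtain ⟨x, ⟨y, hy⟩, hu⟩ := hs
  have hf0 := hf.ne_zero
  have hx0 : x ≠ 0 := by rintro rfl; simp at hy; exact hf0 hy
  have hlc : x.leadingCoeff ≠ 0 := leadingCoeff_ne_zero.mpr hx0
  set g := x * C x.leadingCoeff⁻¹ with hg
  have hgm : g.Monic := monic_mul_leadingCoeff_inv hx0
  set h := y * C (x.leadingCoeff ^ 2) with hh
  have hfg : g ^ 2 * h = f := by
    rw [hy, hg, hh]
    have : (C x.leadingCoeff⁻¹ : F[X]) ^ 2 * C (x.leadingCoeff ^ 2) = 1 := by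
      rw [← C_pow, ← C_mul, ← mul_pow, inv_mul_cancel₀ hlc]; simp
    linear_combination x * x * y * this
  have hhm : h.Monic := (hgm.pow 2).of_mul_monic_left (hfg ▸ hf)
  have hdeg : 2 * g.natDegree + h.natDegree = m := by
    rw [← hd, ← hfg, (hgm.pow 2).natDegree_mul hhm, hgm.natDegree_pow]
  have hg1 : 1 ≤ g.natDegree := by
    by_contra hc
    have : g.natDegree = 0 := by omega
    have h1 : g = 1 := by rwa [hgm.natDegree_eq_zero] at this
    exact hu (IsUnit.of_mul_eq_one _ (hg ▸ h1))
  simp only [Set.mem_iUnion, Finset.mem_filter, Finset.mem_Icc]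
  exact ⟨g.natDegree, ⟨⟨hg1, by omega⟩, by omega⟩, (g, h), ⟨⟨hgm, rfl⟩, ⟨hhm, by simp; omega⟩⟩, hfg⟩

lemma nsqS_upper (m : ℕ) : ((nsqS F m).ncard : ℝ) ≤
    (Fintype.card F : ℝ) ^ m * (1 / Fintype.card F + m / (Fintype.card F : ℝ) ^ 2) := by
  set q := Fintype.card F with hq
  have hq0 : 0 < q := Fintype.card_pos
  have hq0' : (0 : ℝ) < q := by exact_mod_cast hq0
  have hq1 : (1 : ℝ) ≤ q := by exact_mod_cast hq0
  have h1 : (nsqS F m).ncard ≤ ∑ d ∈ (Finset.Icc 1 m).filter (fun d => 2 * d ≤ m), q ^ (m - d) := by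
    refine (Set.ncard_le_ncard (nsqS_subset m) ?_).trans ?_
    · refine Set.Finite.biUnion (Finset.finite_toSet _) fun d _ => ?_
      exact ((monS_finite _).prod (monS_finite _)).image _
    · refine (Finset.set_ncard_biUnion_le _ _).trans ?_
      refine Finset.sum_le_sum fun d hd => ?_
      refine (Set.ncard_image_le ((monS_finite _).prod (monS_finite _))).trans ?_
      rw [Set.ncard_prod, monS_card, monS_card, ← pow_add]
      simp only [Finset.mem_filter] at hd
      exact le_of_eq (by congr 1; omega)
  have h2 : ((nsqS F m).ncard : ℝ) ≤
      ∑ d ∈ (Finset.Icc 1 m).filter (fun d => 2 * d ≤ m), (q : ℝ) ^ (m - d) := by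
    exact_mod_cast h1
  refine h2.trans ?_
  have h3 : ∀ d ∈ Finset.Icc 1 m, (q : ℝ) ^ (m - d) ≤
      (q : ℝ) ^ m / q ^ 2 + if d = 1 then (q : ℝ) ^ m * (1 / q) else 0 := by
    intro d hd
    rw [Finset.mem_Icc] at hd
    have : (q : ℝ) ^ (m - d) = (q : ℝ) ^ m / q ^ d := by
      rw [eq_div_iff (by positivity), ← pow_add]; congr 1; omega
    rw [this]
    split_ifs with h
    · subst h
      have : 0 ≤ (q : ℝ) ^ m / q ^ 2 := by positivity
      rw [pow_one, mul_one_div]; linarith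
    · rw [add_zero]
      have : (q : ℝ) ^ 2 ≤ q ^ d := pow_le_pow_right₀ hq1 (by omega)
      gcongr
  calc _ ≤ ∑ d ∈ Finset.Icc 1 m, (q : ℝ) ^ (m - d) :=
        Finset.sum_le_sum_of_subset_of_nonneg (Finset.filter_subset _ _) (fun _ _ _ => by positivity)
    _ ≤ _ := Finset.sum_le_sum h3
    _ ≤ _ := by
        rw [Finset.sum_add_distrib, Finset.sum_const, Finset.sum_ite_eq' ]
        simp only [Nat.card_Icc, nsmul_eq_mul, add_tsub_cancel_right]
        have : 0 ≤ (q : ℝ) ^ m * (1 / q) := by positivity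
        have h5 : (m : ℝ) * ((q : ℝ) ^ m / q ^ 2) = q ^ m * (m / q ^ 2) := by ring
        split_ifs <;> nlinarith

lemma sqS_lower (m : ℕ) : (Fintype.card F : ℝ) ^ m *
    (1 - 1 / Fintype.card F - m / (Fintype.card F : ℝ) ^ 2) ≤ (sqS F m).ncard := by
  have h := nsqS_upper (F := F) m
  have h2 : ((sqS F m).ncard : ℝ) + (nsqS F m).ncard = (Fintype.card F : ℝ) ^ m := by
    exact_mod_cast sqS_add m
  nlinarith

lemma nsqS_inj (m : ℕ) : Fintype.card F * (sqS F m).ncard ≤ (nsqS F (m + 2)).ncard := by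
  have : Fintype.card F = (Set.univ : Set F).ncard := by simp [Set.ncard_univ]
  rw [this, ← Set.ncard_prod]
  refine Set.ncard_le_ncard_of_injOn (fun x => (X - C x.1) ^ 2 * x.2) ?_ ?_ (nsqS_finite _)
  · rintro ⟨a, h⟩ ⟨-, ⟨hm, hd⟩, hs⟩
    have hmm : ((X - C a) ^ 2 : F[X]).Monic := (monic_X_sub_C a).pow 2
    refine ⟨⟨hmm.mul hm, ?_⟩, ?_⟩
    · simp only at hd hm ⊢
      rw [hmm.natDegree_mul hm, (monic_X_sub_C a).natDegree_pow, natDegree_X_sub_C, hd]; ring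
    · intro hc
      exact not_isUnit_X_sub_C a (hc (X - C a) ⟨h, by ring⟩)
  · rintro ⟨a, h⟩ ⟨-, ⟨hm, hd⟩, hs⟩ ⟨b, k⟩ ⟨-, ⟨hm', hd'⟩, hs'⟩ hab
    simp only at hab hs hs'
    by_cases e : a = b
    · subst e
      have := mul_left_cancel₀ (pow_ne_zero 2 (X_sub_C_ne_zero a)) hab
      rw [this]
    · exfalso
      have hco : IsCoprime ((X - C b) ^ 2) ((X - C a) ^ 2) :=
        (isCoprime_X_sub_C_of_isUnit_sub (sub_ne_zero.mpr (Ne.symm e)).isUnit).pow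
      have hdv : (X - C b) ^ 2 ∣ h := hco.dvd_of_dvd_mul_left ⟨k, hab⟩
      exact not_isUnit_X_sub_C b (hs (X - C b) (by rwa [← sq]))

lemma nsqS_lower (m : ℕ) (hm : 2 ≤ m) : (Fintype.card F : ℝ) ^ m *
    (1 / Fintype.card F * (1 - m / Fintype.card F)) ≤ (nsqS F m).ncard := by
  obtain ⟨k, rfl⟩ : ∃ k, m = k + 2 := ⟨m - 2, by omega⟩
  set q := Fintype.card F with hq
  have hq0 : 0 < q := Fintype.card_pos
  have hq0' : (0 : ℝ) < q := by exact_mod_cast hq0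
  have hq1 : (1 : ℝ) ≤ q := by exact_mod_cast hq0
  have h1 := sqS_lower (F := F) k
  have h2 : (q : ℝ) * (sqS F k).ncard ≤ (nsqS F (k + 2)).ncard := by exact_mod_cast nsqS_inj k
  rw [← hq] at h1
  refine le_trans ?_ h2
  refine le_trans ?_ (mul_le_mul_of_nonneg_left h1 hq0'.le)
  have h3 : (k : ℝ) / q ^ 2 ≤ k / q := by
    apply div_le_div_of_nonneg_left (by positivity) hq0'; nlinarith
  have h4 : (0 : ℝ) ≤ 1 / q := by positivity
  have : (q : ℝ) ^ (k + 2) * (1 / q * (1 - ((k + 2 : ℕ) : ℝ) / q)) =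
    q * (q ^ k * (1 - ((k + 2 : ℕ) : ℝ) / q)) := by field_simp; ring
  rw [this]
  refine mul_le_mul_of_nonneg_left (mul_le_mul_of_nonneg_left ?_ (by positivity)) hq0'.le
  push_cast
  have : ((k : ℝ) + 2) / q = k / q + 2 * (1 / q) := by ring
  linarith

/-- pairs (h,a) with h*(X-a) squarefree -/
def pairS (F : Type*) [Field F] (m : ℕ) : Set (F[X] × F) :=
  {x | x.1 ∈ monS F m ∧ Squarefree (x.1 * (X - C x.2))}

lemma pairS_finite (m : ℕ) : (pairS F m).Finite :=
  ((monS_finite m).prod Set.finite_univ).subset fun _ h => ⟨h.1, trivial⟩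

lemma pairS_lower_nat (m : ℕ) : (sqS F m).ncard * Fintype.card F ≤
    (pairS F m).ncard + (sqS F m).ncard * m := by
  classical
  have hF : Fintype.card F = (Set.univ : Set F).ncard := by simp [Set.ncard_univ]
  -- bad pairs
  set B : Set (F[X] × F) := {x | x.1 ∈ sqS F m ∧ x.1.IsRoot x.2} with hB
  have hsub : sqS F m ×ˢ (Set.univ : Set F) ⊆ pairS F m ∪ B := by
    rintro ⟨h, a⟩ ⟨hh, -⟩
    by_cases hr : h.IsRoot a
    · right; exact ⟨hh, hr⟩
    · left
      refine ⟨hh.1, ?_⟩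
      have hco : IsCoprime h (X - C a) := by
        rw [isCoprime_comm, (irreducible_X_sub_C a).coprime_iff_not_dvd, dvd_iff_isRoot]
        exact hr
      exact (squarefree_mul_iff.mpr ⟨hco.isRelPrime, hh.2, (irreducible_X_sub_C a).squarefree⟩)
  have hBf : B.Finite := ((sqS_finite m).prod Set.finite_univ).subset fun _ h => ⟨h.1, trivial⟩
  have hBc : B.ncard ≤ (sqS F m).ncard * m := by
    have hBs : B ⊆ ⋃ h ∈ (sqS_finite (F := F) m).toFinset, (fun a => (h, a)) '' (h.roots.toFinset : Set F) := by
      rintro ⟨h, a⟩ ⟨hh, hr⟩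
      simp only [Set.mem_iUnion, Set.Finite.mem_toFinset]
      refine ⟨h, hh, a, ?_, rfl⟩
      simpa using ⟨hh.1.1.ne_zero, hr⟩
    refine (Set.ncard_le_ncard hBs ?_).trans ?_
    · exact Set.Finite.biUnion (Finset.finite_toSet _) fun d _ => (Finset.finite_toSet _).image _
    · refine (Finset.set_ncard_biUnion_le _ _).trans ?_
      rw [Set.ncard_eq_toFinset_card _ (sqS_finite m), ← smul_eq_mul]
      refine Finset.sum_le_card_nsmul _ _ _ fun h hh => ?_
      refine (Set.ncard_image_le (Finset.finite_toSet _)).trans ?_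
      rw [Set.ncard_coe_finset]
      rw [Set.Finite.mem_toFinset] at hh
      exact (Multiset.toFinset_card_le _).trans ((card_roots' h).trans hh.1.2.le)
  rw [hF, ← Set.ncard_prod]
  refine (Set.ncard_le_ncard hsub ((pairS_finite m).union hBf)).trans ?_
  exact (Set.ncard_union_le _ _).trans (by omega)

end polys

section mats
variable {F : Type*} [Field F] [Fintype F]

/-- shifting basis vectors -/
def Shifts {n : ℕ} (M : Matrix (Fin n) (Fin n) F) (k : ℕ) : Prop :=
  ∀ i : ℕ, ∀ h : i + 1 < n, i + 1 < k →
    M *ᵥ (Pi.single ⟨i, by omega⟩ 1) = Pi.single ⟨i + 1, h⟩ 1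

lemma comp_exists (n : ℕ) (f : F[X]) (hf : f ∈ monS F n) :
    ∃ M : Matrix (Fin n) (Fin n) F, M.charpoly = f ∧ Shifts M n := by
  obtain ⟨hm, hd⟩ := hf
  let pb := AdjoinRoot.powerBasis hm.ne_zero
  have hdim : pb.dim = n := hd
  have hmin : minpoly F pb.gen = f := by
    have : pb.gen = AdjoinRoot.root f := rfl
    rw [this, AdjoinRoot.minpoly_root hm.ne_zero, hm.leadingCoeff]
    simp
  clear_value pb
  subst hdim
  refine ⟨Algebra.leftMulMatrix pb.basis pb.gen, by rw [charpoly_leftMulMatrix, hmin], ?_⟩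
  intro i h _
  have := Algebra.leftMulMatrix_mulVec_repr pb.basis pb.gen (pb.basis ⟨i, by omega⟩)
  have h2 : pb.gen * pb.basis ⟨i, by omega⟩ = pb.basis ⟨i + 1, h⟩ := by
    simp [pb.basis_eq_pow, pow_succ']
  rw [h2, Module.Basis.repr_self, Module.Basis.repr_self, Finsupp.single_eq_pi_single,
    Finsupp.single_eq_pi_single] at this
  exact this

open Classical in
/-- a companion matrix -/
noncomputable def compM (n : ℕ) (f : F[X]) : Matrix (Fin n) (Fin n) F :=
  if h : f ∈ monS F n then (comp_exists n f h).choose else 0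

lemma compM_charpoly {n : ℕ} {f : F[X]} (h : f ∈ monS F n) : (compM n f).charpoly = f := by
  rw [compM, dif_pos h]; exact (comp_exists n f h).choose_spec.1

lemma compM_shifts {n : ℕ} {f : F[X]} (h : f ∈ monS F n) : Shifts (compM n f) n := by
  rw [compM, dif_pos h]; exact (comp_exists n f h).choose_spec.2

/-- block matrix -/
def blk {m : ℕ} (C : Matrix (Fin m) (Fin m) F) (u : Fin m → F) (a : F) :
    Matrix (Fin (m + 1)) (Fin (m + 1)) F :=
  Matrix.reindex finSumFinEquiv finSumFinEquiv
    (Matrix.fromBlocks C (Matrix.of fun i (_ : Fin 1) => u i) 0 (Matrix.of fun (_ _ : Fin 1) => a))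

lemma blk_charpoly {m : ℕ} (M : Matrix (Fin m) (Fin m) F) (u : Fin m → F) (a : F) :
    (blk M u a).charpoly = M.charpoly * (X - C a) := by
  rw [blk, charpoly_reindex, charpoly_fromBlocks_zero₂₁]
  congr 1
  simp [Matrix.charpoly, Matrix.charmatrix]

lemma blk_cc {m : ℕ} (M : Matrix (Fin m) (Fin m) F) (u : Fin m → F) (a : F) (i j : Fin m) :
    blk M u a (Fin.castAdd 1 i) (Fin.castAdd 1 j) = M i j := by
  simp only [blk, reindex_apply, submatrix_apply, finSumFinEquiv_symm_apply_castAdd]; rfl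

lemma blk_cl {m : ℕ} (M : Matrix (Fin m) (Fin m) F) (u : Fin m → F) (a : F) (i : Fin m) (j : Fin 1) :
    blk M u a (Fin.castAdd 1 i) (Fin.natAdd m j) = u i := by
  simp only [blk, reindex_apply, submatrix_apply, finSumFinEquiv_symm_apply_castAdd,
    finSumFinEquiv_symm_apply_natAdd]; rfl

lemma blk_lc {m : ℕ} (M : Matrix (Fin m) (Fin m) F) (u : Fin m → F) (a : F) (i : Fin 1) (j : Fin m) :
    blk M u a (Fin.natAdd m i) (Fin.castAdd 1 j) = 0 := by
  simp only [blk, reindex_apply, submatrix_apply, finSumFinEquiv_symm_apply_castAdd,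
    finSumFinEquiv_symm_apply_natAdd]; rfl

lemma blk_ll {m : ℕ} (M : Matrix (Fin m) (Fin m) F) (u : Fin m → F) (a : F) (i j : Fin 1) :
    blk M u a (Fin.natAdd m i) (Fin.natAdd m j) = a := by
  simp only [blk, reindex_apply, submatrix_apply, 
    finSumFinEquiv_symm_apply_natAdd]; rfl

lemma blk_inj {m : ℕ} {M M' : Matrix (Fin m) (Fin m) F} {u u' : Fin m → F} {a a' : F}
    (h : blk M u a = blk M' u' a') : M = M' ∧ u = u' ∧ a = a' := by
  refine ⟨?_, ?_, ?_⟩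
  · ext i j
    rw [← blk_cc M u a, h, blk_cc]
  · ext i
    rw [← blk_cl M u a i 0, h, blk_cl]
  · rw [← blk_ll M u a 0 0, h, blk_ll]

lemma blk_shifts {m : ℕ} {M : Matrix (Fin m) (Fin m) F} (u : Fin m → F) (a : F)
    (h : Shifts M m) : Shifts (blk M u a) m := by
  intro i hi him
  have := h i him him
  rw [mulVec_single_one] at this ⊢
  have e : (⟨i, by omega⟩ : Fin (m + 1)) = Fin.castAdd 1 ⟨i, by omega⟩ := rfl
  have e' : (⟨i + 1, by omega⟩ : Fin (m + 1)) = Fin.castAdd 1 ⟨i + 1, by omega⟩ := rfl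
  rw [e, e']
  ext j
  refine Fin.addCases (fun j => ?_) (fun j => ?_) j
  · have h2 := congrFun this j
    simp only [Matrix.col_apply] at h2 ⊢
    rw [blk_cc, h2]
    simp only [Pi.single_apply, Fin.ext_iff, Fin.val_castAdd]
  · simp only [Matrix.col_apply]
    rw [blk_lc, Pi.single_eq_of_ne]
    intro h3
    have := congrArg Fin.val h3
    simp at this
    omega

lemma blk_row {m : ℕ} (M : Matrix (Fin m) (Fin m) F) (u : Fin m → F) (a : F) :
    (Pi.single (Fin.last m) 1) ᵥ* blk M u a = a • (Pi.single (Fin.last m) 1) := by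
  rw [single_one_vecMul]
  have e : Fin.last m = Fin.natAdd m (0 : Fin 1) := rfl
  ext j
  refine Fin.addCases (fun j => ?_) (fun j => ?_) j
  · simp only [Matrix.row_apply, e, blk_lc]
    simp [Pi.single_apply]
    intro h3
    have := congrArg Fin.val h3
    simp at this
    omega
  · have : j = 0 := Subsingleton.elim _ _
    subst this
    simp only [Matrix.row_apply, e, blk_ll]
    simp

/-- conjugation -/
def cj {n : ℕ} (g : GL (Fin n) F) (M : Matrix (Fin n) (Fin n) F) : Matrix (Fin n) (Fin n) F :=
  g.val * M * g⁻¹.val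

lemma cj_charpoly {n : ℕ} (g : GL (Fin n) F) (M : Matrix (Fin n) (Fin n) F) :
    (cj g M).charpoly = M.charpoly := by
  have := charpoly_units_conj g M
  rw [← coe_units_inv] at this
  exact this

lemma cj_inj {n : ℕ} (g : GL (Fin n) F) {M N : Matrix (Fin n) (Fin n) F}
    (h : cj g M = cj g N) : M = N := by
  unfold cj at h
  have h2 := congrArg (fun A => g⁻¹.val * A * g.val) h
  simpa [mul_assoc] using h2

lemma cj_shift {m k : ℕ} (g : GL (Fin (m + 1)) F) {M : Matrix (Fin (m + 1)) (Fin (m + 1)) F}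
    (hM : Shifts M k) (i : ℕ) (hi : i < m + 1) (hk : i < k) :
    (cj g M ^ i) *ᵥ (g.val *ᵥ Pi.single 0 1) = g.val *ᵥ Pi.single ⟨i, hi⟩ 1 := by
  induction i with
  | zero => simp
  | succ i ih =>
    rw [pow_succ', ← mulVec_mulVec, ih (by omega) (by omega), ← hM i hi hk, cj, mulVec_mulVec,
      mulVec_mulVec, mul_assoc, mul_assoc]
    simp

lemma GL_ext_cols {n : ℕ} {g g' : GL (Fin n) F}
    (h : ∀ j, g.val *ᵥ Pi.single j 1 = g'.val *ᵥ Pi.single j 1) : g = g' := by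
  apply Units.ext
  ext i j
  have := congrFun (h j) i
  simpa [mulVec_single_one] using this

/-- first type of pairs -/
noncomputable def phi1 (m : ℕ) (x : GL (Fin (m + 1)) F × F[X]) :
    Matrix (Fin (m + 1)) (Fin (m + 1)) F × (Fin (m + 1) → F) :=
  (cj x.1 (compM (m + 1) x.2), x.1.val *ᵥ Pi.single 0 1)

lemma phi1_inj (m : ℕ) : Set.InjOn (phi1 (F := F) m) (Set.univ ×ˢ monS F (m + 1)) := by
  rintro ⟨g, f⟩ ⟨-, hf⟩ ⟨g', f'⟩ ⟨-, hf'⟩ h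
  simp only [phi1, Prod.mk.injEq] at h hf hf' ⊢
  obtain ⟨h1, h2⟩ := h
  refine ⟨GL_ext_cols fun j => ?_, ?_⟩
  · rw [← cj_shift g (compM_shifts hf) j j.2 j.2, ← cj_shift g' (compM_shifts hf') j j.2 j.2, h1, h2]
  · rw [← compM_charpoly hf, ← cj_charpoly g, h1, cj_charpoly, compM_charpoly hf']

/-- second type of triples -/
noncomputable def phi2 (m : ℕ) (x : GL (Fin (m + 1)) F × (Fin m → F) × F[X] × F) :
    (Matrix (Fin (m + 1)) (Fin (m + 1)) F × (Fin (m + 1) → F)) × (Fin (m + 1) → F) :=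
  ((cj x.1 (blk (compM m x.2.2.1) x.2.1 x.2.2.2), x.1.val *ᵥ Pi.single 0 1),
    x.1.val *ᵥ Pi.single (Fin.last m) 1)

lemma phi2_inj (m : ℕ) : Set.InjOn (phi2 (F := F) m)
    (Set.univ ×ˢ (Set.univ ×ˢ pairS F m)) := by
  rintro ⟨g, u, f, a⟩ ⟨-, -, hf⟩ ⟨g', u', f', a'⟩ ⟨-, -, hf'⟩ h
  simp only [phi2, Prod.mk.injEq] at h hf hf' ⊢
  obtain ⟨⟨h1, h2⟩, h3⟩ := h
  have hg : g = g' := by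
    refine GL_ext_cols fun j => ?_
    rcases Nat.lt_or_ge j m with hj | hj
    · have e1 := cj_shift g (blk_shifts u a (compM_shifts hf.1)) j j.2 hj
      have e2 := cj_shift g' (blk_shifts u' a' (compM_shifts hf'.1)) j j.2 hj
      rw [h1, h2] at e1
      exact e1.symm.trans e2
    · have : j = Fin.last m := by ext; simp; omega
      rw [this, h3]
  subst hg
  obtain ⟨i1, i2, i3⟩ := blk_inj (cj_inj g h1)
  refine ⟨rfl, i2, ?_, i3⟩
  have e1 := compM_charpoly hf.1
  have e2 := compM_charpoly hf'.1
  simp only at e1 e2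
  rw [← e1, ← e2, i1]

lemma phi_disj (m : ℕ) (hm : 1 ≤ m) (g : GL (Fin (m + 1)) F) (f : F[X]) (hf : f ∈ monS F (m + 1))
    (y : GL (Fin (m + 1)) F × (Fin m → F) × F[X] × F) :
    phi1 m (g, f) ≠ (phi2 m y).1 := by
  obtain ⟨g', u, f', a⟩ := y
  intro h
  simp only [phi1, phi2, Prod.mk.injEq] at h
  obtain ⟨h1, h2⟩ := h
  set l : Fin (m + 1) → F := Pi.single (Fin.last m) 1 ᵥ* g'⁻¹.val with hl
  set A := cj g' (blk (compM m f') u a) with hA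
  have hlA : l ᵥ* A = a • l := by
    rw [hl, hA, cj, vecMul_vecMul, ← mul_assoc, ← mul_assoc]
    rw [show g'⁻¹.val * g'.val = 1 by simp, one_mul, ← vecMul_vecMul, blk_row, smul_vecMul]
  have hlAi : ∀ i : ℕ, l ᵥ* (A ^ i) = a ^ i • l := by
    intro i
    induction i with
    | zero => simp
    | succ i ih => rw [pow_succ, ← vecMul_vecMul, ih, smul_vecMul, hlA, smul_smul, pow_succ]
  have hl0 : l ⬝ᵥ (g'.val *ᵥ Pi.single 0 1) = 0 := by
    rw [dotProduct_mulVec, hl, vecMul_vecMul]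
    rw [show g'⁻¹.val * g'.val = 1 by simp, vecMul_one]
    simp [Pi.single_apply]
    omega
  have hlg : l ᵥ* g.val = 0 := by
    ext j
    have e := cj_shift g (compM_shifts hf) j j.2 j.2
    rw [h1, h2] at e
    have e2 := congrArg (fun v => l ⬝ᵥ v) e
    rw [dotProduct_mulVec, hlAi, smul_dotProduct, hl0, dotProduct_mulVec] at e2
    simpa using e2.symm
  have hlz : l = 0 := by
    have := congrArg (fun v => v ᵥ* g⁻¹.val) hlg
    simpa [vecMul_vecMul] using this
  have := congrArg (fun v => v ᵥ* g'.val) hlz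
  simp only [hl, vecMul_vecMul, zero_vecMul] at this
  rw [show g'⁻¹.val * g'.val = 1 by simp, vecMul_one] at this
  simp at this

lemma count_nsq (m : ℕ) : Nat.card (GL (Fin (m + 1)) F) * (nsqS F (m + 1)).ncard ≤
    {A : Matrix (Fin (m + 1)) (Fin (m + 1)) F | ¬ Squarefree A.charpoly}.ncard *
      Fintype.card F ^ (m + 1) := by
  have e : Fintype.card F ^ (m + 1) = (Set.univ : Set (Fin (m + 1) → F)).ncard := by
    simp [Set.ncard_univ]
  rw [e, ← Set.ncard_univ, ← Set.ncard_prod, ← Set.ncard_prod]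
  refine Set.ncard_le_ncard_of_injOn (phi1 m) ?_ ?_ (Set.toFinite _)
  · rintro ⟨g, f⟩ ⟨-, hf⟩
    refine ⟨?_, trivial⟩
    simp only [phi1, Set.mem_ofPred_eq] at hf ⊢
    rw [cj_charpoly, compM_charpoly hf.1]
    exact hf.2
  · exact (phi1_inj m).mono (Set.prod_mono le_rfl fun _ h => h.1)

lemma count_sq (m : ℕ) (hm : 1 ≤ m) : Nat.card (GL (Fin (m + 1)) F) *
      ((sqS F (m + 1)).ncard * Fintype.card F ^ (m + 1) +
        Fintype.card F ^ m * (pairS F m).ncard) ≤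
    {A : Matrix (Fin (m + 1)) (Fin (m + 1)) F | Squarefree A.charpoly}.ncard *
      Fintype.card F ^ (m + 1) * Fintype.card F ^ (m + 1) := by
  have e : ∀ k, Fintype.card F ^ k = (Set.univ : Set (Fin k → F)).ncard := by
    simp [Set.ncard_univ]
  rw [e, e, mul_add, ← mul_assoc, ← Set.ncard_univ, ← Set.ncard_prod, ← Set.ncard_prod,
    ← Set.ncard_prod, ← Set.ncard_prod, ← Set.ncard_prod, ← Set.ncard_prod]
  have i1 : Set.InjOn (Prod.map (phi1 (F := F) m) (id : (Fin (m + 1) → F) → _))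
      (((Set.univ : Set (GL (Fin (m + 1)) F)) ×ˢ sqS F (m + 1)) ×ˢ
        (Set.univ : Set (Fin (m + 1) → F))) := by
    rintro ⟨x, w⟩ ⟨hx, -⟩ ⟨x', w'⟩ ⟨hx', -⟩ h
    simp only [Prod.map, Prod.mk.injEq] at h ⊢
    exact ⟨phi1_inj m ⟨trivial, hx.2.1⟩ ⟨trivial, hx'.2.1⟩ h.1, h.2⟩
  rw [← i1.ncard_image, ← (phi2_inj m).ncard_image, ← Set.ncard_union_eq]
  · refine Set.ncard_le_ncard ?_ (Set.toFinite _)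
    rintro z (⟨⟨⟨g, f⟩, w⟩, ⟨⟨-, hf⟩, -⟩, rfl⟩ | ⟨⟨g, u, f, a⟩, ⟨-, -, hf⟩, rfl⟩)
    · refine ⟨⟨?_, trivial⟩, trivial⟩
      simp only [phi1, Set.mem_ofPred_eq, Prod.map] at hf ⊢
      rw [cj_charpoly, compM_charpoly hf.1]
      exact hf.2
    · refine ⟨⟨?_, trivial⟩, trivial⟩
      simp only [phi2, Set.mem_ofPred_eq] at hf ⊢
      rw [cj_charpoly, blk_charpoly, compM_charpoly hf.1]
      exact hf.2
  · rw [Set.disjoint_left]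
    rintro z ⟨⟨⟨g, f⟩, w⟩, ⟨⟨-, hf⟩, -⟩, rfl⟩ ⟨y, -, hy⟩
    exact phi_disj m hm g f hf.1 y (congrArg Prod.fst hy).symm

end mats

section final
variable {F : Type*} [Field F] [Fintype F]

lemma prod_lower {ι : Type*} (s : Finset ι) (x : ι → ℝ) (h0 : ∀ i ∈ s, 0 ≤ x i)
    (h1 : ∀ i ∈ s, x i ≤ 1) : 1 - ∑ i ∈ s, x i ≤ ∏ i ∈ s, (1 - x i) := by
  classical
  induction s using Finset.induction_on with
  | empty => simp
  | insert a s ha ih =>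
    rw [Finset.sum_insert ha, Finset.prod_insert ha]
    have ih' := ih (fun i hi => h0 i (Finset.mem_insert_of_mem hi))
      (fun i hi => h1 i (Finset.mem_insert_of_mem hi))
    have ha0 := h0 a (Finset.mem_insert_self _ _)
    have ha1 := h1 a (Finset.mem_insert_self _ _)
    have hs : 0 ≤ ∑ i ∈ s, x i := Finset.sum_nonneg fun i hi => h0 i (Finset.mem_insert_of_mem hi)
    nlinarith [mul_le_mul_of_nonneg_left ih' (sub_nonneg.mpr ha1), mul_nonneg ha0 hs]

lemma GL_lower (n : ℕ) : (Fintype.card F : ℝ) ^ (n ^ 2) *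
    (1 - 1 / Fintype.card F - n / (Fintype.card F : ℝ) ^ 2) ≤ Nat.card (GL (Fin n) F) := by
  rw [Matrix.card_GL_field]
  set q := Fintype.card F with hq
  have hq0 : 0 < q := Fintype.card_pos
  have hq0' : (0 : ℝ) < q := by exact_mod_cast hq0
  have hq1 : (1 : ℝ) ≤ q := by exact_mod_cast hq0
  have e : ((∏ i : Fin n, (q ^ n - q ^ (i : ℕ)) : ℕ) : ℝ) =
      (q : ℝ) ^ (n ^ 2) * ∏ i : Fin n, (1 - (q : ℝ) ^ (i : ℕ) / q ^ n) := by
    have e1 : (q : ℝ) ^ (n ^ 2) = ∏ _i : Fin n, (q : ℝ) ^ n := by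
      rw [Finset.prod_const, Finset.card_univ, Fintype.card_fin, ← pow_mul, sq]
    rw [e1, ← Finset.prod_mul_distrib]
    push_cast
    refine Finset.prod_congr rfl fun i _ => ?_
    rw [Nat.cast_sub (Nat.pow_le_pow_right hq0 i.2.le)]
    push_cast
    field_simp
  rw [e]
  refine mul_le_mul_of_nonneg_left ?_ (by positivity)
  refine le_trans ?_ (prod_lower _ _ (fun i _ => by positivity) (fun i _ => ?_))
  · have h3 : ∀ i : Fin n, (q : ℝ) ^ (i : ℕ) / q ^ n ≤
        1 / (q : ℝ) ^ 2 + if (i : ℕ) = n - 1 then (1 / q : ℝ) else 0 := by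
      intro i
      have : (q : ℝ) ^ (i : ℕ) / q ^ n = 1 / q ^ (n - i) := by
        rw [div_eq_div_iff (by positivity) (by positivity), ← pow_add, one_mul]
        congr 1; omega
      rw [this]
      split_ifs with h
      · have : n - (i : ℕ) = 1 := by omega
        rw [this, pow_one]
        have : (0 : ℝ) ≤ 1 / q ^ 2 := by positivity
        linarith
      · rw [add_zero]
        have : (q : ℝ) ^ 2 ≤ q ^ (n - (i : ℕ)) := pow_le_pow_right₀ hq1 (by omega)
        gcongr
    have h4 := Finset.sum_le_sum fun i (_ : i ∈ Finset.univ) => h3 i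
    rw [Finset.sum_add_distrib] at h4
    have h5 : ∑ i : Fin n, (if (i : ℕ) = n - 1 then (1 / q : ℝ) else 0) ≤ 1 / q := by
      rw [Fin.sum_univ_eq_sum_range (fun i => if i = n - 1 then (1 / q : ℝ) else 0),
        Finset.sum_ite_eq']
      have : (0 : ℝ) ≤ 1 / q := by positivity
      split_ifs <;> linarith
    simp only [Finset.sum_const, Finset.card_univ, Fintype.card_fin, nsmul_eq_mul] at h4
    have h6 : (n : ℝ) * (1 / q ^ 2) = n / q ^ 2 := by ring
    linarith
  · rw [div_le_one (by positivity)]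
    exact pow_le_pow_right₀ hq1 i.2.le

lemma pairS_lower (m : ℕ) (hmq : (m : ℝ) + 1 ≤ Fintype.card F) :
    (Fintype.card F : ℝ) ^ (m + 1) * (1 - 2 * (m + 1) * (1 / Fintype.card F)) ≤
      (pairS F m).ncard := by
  have h1 : ((sqS F m).ncard : ℝ) * Fintype.card F ≤ (pairS F m).ncard + (sqS F m).ncard * m := by
    exact_mod_cast pairS_lower_nat m
  have h2 := sqS_lower (F := F) m
  set q := Fintype.card F with hq
  have hq0 : 0 < q := Fintype.card_pos
  have hq0' : (0 : ℝ) < q := by exact_mod_cast hq0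
  have hq1 : (1 : ℝ) ≤ q := by exact_mod_cast hq0
  set d : ℝ := 1 / q with hd
  have hd0 : 0 ≤ d := by positivity
  have hd1 : d ≤ 1 := by rw [hd, div_le_one hq0']; exact hq1
  have hqd : q * d = 1 := by rw [hd]; field_simp
  have e1 : (m : ℝ) / q ^ 2 = m * d ^ 2 := by rw [hd]; field_simp
  rw [e1] at h2
  have hm0 : (0 : ℝ) ≤ m := by positivity
  have hmd : m * d ≤ 1 := by nlinarith
  have h3 := mul_le_mul_of_nonneg_right h2 (show (0 : ℝ) ≤ q - m by linarith)
  have e2 : (q : ℝ) - m = q * (1 - m * d) := by linear_combination (m : ℝ) * hqd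
  have h4 : (q : ℝ) ^ (m + 1) * (1 - 2 * (m + 1) * d) ≤ q ^ m * (1 - d - m * d ^ 2) * (q - m) := by
    rw [e2]
    have : (q : ℝ) ^ m * (1 - d - m * d ^ 2) * (q * (1 - m * d)) =
      q ^ (m + 1) * ((1 - d - m * d ^ 2) * (1 - m * d)) := by ring
    rw [this]
    refine mul_le_mul_of_nonneg_left ?_ (by positivity)
    have : (m : ℝ) * d ^ 2 ≤ m * d := by nlinarith [mul_nonneg hm0 hd0]
    have : 0 ≤ (d + m * d ^ 2) * (m * d) := by positivity
    nlinarith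
  linarith

lemma sq_add_nsq (n : ℕ) : {A : Matrix (Fin n) (Fin n) F | Squarefree A.charpoly}.ncard +
    {A : Matrix (Fin n) (Fin n) F | ¬ Squarefree A.charpoly}.ncard = Fintype.card F ^ (n ^ 2) := by
  classical
  have := Set.ncard_add_ncard_compl {A : Matrix (Fin n) (Fin n) F | Squarefree A.charpoly}
  have e : Nat.card (Matrix (Fin n) (Fin n) F) = Fintype.card F ^ (n ^ 2) := by
    change Nat.card (Fin n → Fin n → F) = _
    simp [Nat.card_eq_fintype_card, sq, pow_mul]
  rw [← e, ← this]
  rfl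

lemma real_bound {S T G s P t N d Q R : ℝ}
    (hS' : G * (s * R + R * d * P) ≤ S * R * R) (hT' : G * t ≤ T * R) (hST' : S + T = Q)
    (hG : Q * (1 - d - N * d ^ 2) ≤ G) (hs : R * (1 - d - N * d ^ 2) ≤ s)
    (hns : R * (d * (1 - N * d)) ≤ t) (hP : R * (1 - 2 * N * d) ≤ P) (hG0 : 0 ≤ G)
    (hN2 : 2 ≤ N) (hd0 : 0 < d) (hNd : 3 * (N * d) ≤ 1) (hQ0 : 0 < Q) (hR0 : 0 < R) :
    |T - Q * d| ≤ 4 * (N * d) * (Q * d) := by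
  have hd2 : N * d ^ 2 ≤ N * d := by
    have : d ≤ 1 := by nlinarith
    nlinarith [mul_pos (show 0 < N by linarith) hd0]
  have hNd0 : 0 < N * d := mul_pos (by linarith) hd0
  have hdN : 2 * d ≤ N * d := by nlinarith
  have hd1 : d ≤ 1 := by linarith
  have hNd2 : 0 ≤ N * d ^ 2 := by positivity
  -- upper bound
  have hSlow : Q * (1 - d - 4 * (N * d ^ 2)) ≤ S := by
    have a1 : R * R * (1 - 3 * (N * d ^ 2)) ≤ s * R + R * d * P := by
      have b1 := mul_le_mul_of_nonneg_right hs hR0.le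
      have b2 := mul_le_mul_of_nonneg_left hP (mul_pos hR0 hd0).le
      linarith
    have a2 := (mul_le_mul_of_nonneg_left a1 hG0).trans hS'
    have a3 : G * (1 - 3 * (N * d ^ 2)) ≤ S := by
      refine le_of_mul_le_mul_right ?_ (mul_pos hR0 hR0)
      linarith
    refine le_trans ?_ a3
    refine le_trans ?_ (mul_le_mul_of_nonneg_right hG (by nlinarith))
    rw [mul_assoc]
    refine mul_le_mul_of_nonneg_left ?_ hQ0.le
    have : 0 ≤ (d + N * d ^ 2) * (3 * (N * d ^ 2)) := by positivity
    nlinarith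
  have hTlow : Q * d * (1 - 3 * (N * d)) ≤ T := by
    have a2 := (mul_le_mul_of_nonneg_left hns hG0).trans hT'
    have a3 : G * (d * (1 - N * d)) ≤ T := by
      refine le_of_mul_le_mul_right ?_ hR0
      linarith
    refine le_trans ?_ a3
    refine le_trans ?_ (mul_le_mul_of_nonneg_right hG
      (mul_nonneg hd0.le (by linarith)))
    have : Q * (1 - d - N * d ^ 2) * (d * (1 - N * d)) =
      Q * d * ((1 - d - N * d ^ 2) * (1 - N * d)) := by ring
    rw [this]
    refine mul_le_mul_of_nonneg_left ?_ (by positivity)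
    have : 0 ≤ (d + N * d ^ 2) * (N * d) := by positivity
    nlinarith
  have hpos : 0 ≤ Q * d * (N * d) := by positivity
  rw [abs_le]
  constructor
  · nlinarith
  · nlinarith

lemma final_bound (n : ℕ) (hn : 2 ≤ n) (hnq : 3 * (n : ℝ) ≤ Fintype.card F) :
    |({A : Matrix (Fin n) (Fin n) F | ¬ Squarefree A.charpoly}.ncard : ℝ) -
      (Fintype.card F : ℝ) ^ (n ^ 2 - 1)| ≤
      (4 * n / Fintype.card F) * (Fintype.card F : ℝ) ^ (n ^ 2 - 1) := by
  obtain ⟨m, rfl⟩ : ∃ m, n = m + 1 := ⟨n - 1, by omega⟩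
  have hG := GL_lower (F := F) (m + 1)
  have hs := sqS_lower (F := F) (m + 1)
  have hns := nsqS_lower (F := F) (m + 1) hn
  have hP := pairS_lower (F := F) m (by push_cast at hnq; linarith [Nat.cast_nonneg (α := ℝ) m])
  have hT := count_nsq (F := F) m
  have hS := count_sq (F := F) m (by omega)
  have hST := sq_add_nsq (F := F) (m + 1)
  set S := {A : Matrix (Fin (m + 1)) (Fin (m + 1)) F | Squarefree A.charpoly}.ncard
  set T := {A : Matrix (Fin (m + 1)) (Fin (m + 1)) F | ¬ Squarefree A.charpoly}.ncard
  set G := Nat.card (GL (Fin (m + 1)) F)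
  set s := (sqS F (m + 1)).ncard
  set P := (pairS F m).ncard
  set t := (nsqS F (m + 1)).ncard
  set q := Fintype.card F with hq
  have hq0 : 0 < q := Fintype.card_pos
  have hq0' : (0 : ℝ) < q := by exact_mod_cast hq0
  have hT' : (G : ℝ) * t ≤ T * q ^ (m + 1) := by exact_mod_cast hT
  have hS' : (G : ℝ) * (s * q ^ (m + 1) + q ^ m * P) ≤ S * q ^ (m + 1) * q ^ (m + 1) := by
    exact_mod_cast hS
  have hST' : (S : ℝ) + T = q ^ ((m + 1) ^ 2) := by exact_mod_cast hST
  have hG0 : (0 : ℝ) ≤ G := by positivity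
  have eN : ((m : ℝ) + 1) = ((m + 1 : ℕ) : ℝ) := by push_cast; ring
  rw [eN] at hP
  set N : ℝ := ((m + 1 : ℕ) : ℝ) with hN
  have hN2 : 2 ≤ N := by rw [hN]; exact_mod_cast hn
  set d : ℝ := 1 / q with hd
  have hd0 : 0 < d := by positivity
  have hqd : q * d = 1 := by rw [hd]; field_simp
  have hNd : 3 * (N * d) ≤ 1 := by nlinarith
  have e1 : N / (q : ℝ) ^ 2 = N * d ^ 2 := by rw [hd]; field_simp
  have e2 : N / (q : ℝ) = N * d := by rw [hd]; field_simp
  have e3 : 4 * N / (q : ℝ) = 4 * (N * d) := by rw [hd]; field_simp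
  rw [e1] at hG hs
  rw [e2] at hns
  rw [e3]
  have eQ : (q : ℝ) ^ ((m + 1) ^ 2 - 1) = q ^ ((m + 1) ^ 2) * d := by
    have : (m + 1) ^ 2 = ((m + 1) ^ 2 - 1) + 1 := by
      have : 0 < (m + 1) ^ 2 := by positivity
      omega
    conv_rhs => rw [this, pow_succ, mul_assoc, hqd, mul_one]
  rw [eQ]
  set Q : ℝ := (q : ℝ) ^ ((m + 1) ^ 2) with hQ
  have hQ0 : 0 < Q := by positivity
  have eqm : (q : ℝ) ^ m = q ^ (m + 1) * d := by rw [pow_succ, mul_assoc, hqd, mul_one]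
  rw [eqm] at hS'
  set R : ℝ := (q : ℝ) ^ (m + 1) with hR
  have hR0 : 0 < R := by positivity
  exact real_bound hS' hT' hST' hG hs hns hP hG0 hN2 hd0 hNd hQ0 hR0

end final

/-- Count (2.7)–(2.9): the number of `n × n` matrices over `𝔽_p` whose characteristic
polynomial is not squarefree is `(1+o(1)) p^(n²-1)` as `p → ∞`. -/
theorem non_squarefree_charpoly_count_finite_field (n : ℕ) (hn : 2 ≤ n) :
    ∀ ε : ℝ, 0 < ε → ∃ p₀ : ℕ, ∀ p : ℕ, p.Prime → p₀ ≤ p →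
      |(Set.ncard {A : Matrix (Fin n) (Fin n) (ZMod p) | ¬ Squarefree A.charpoly} : ℝ) -
          (p : ℝ) ^ (n ^ 2 - 1)| ≤ ε * (p : ℝ) ^ (n ^ 2 - 1) := by
  intro ε hε
  obtain ⟨K, hK⟩ := exists_nat_ge (4 * (n : ℝ) / ε)
  refine ⟨max K (3 * n), fun p hp hpl => ?_⟩
  have : Fact p.Prime := ⟨hp⟩
  have h1 : (K : ℝ) ≤ p := by exact_mod_cast (le_max_left _ _).trans hpl
  have h2 : 3 * (n : ℝ) ≤ p := by exact_mod_cast (le_max_right _ _).trans hpl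
  have hp0 : (0 : ℝ) < p := by exact_mod_cast hp.pos
  have := final_bound (F := ZMod p) n hn (by rwa [ZMod.card])
  rw [ZMod.card] at this
  refine this.trans ?_
  refine mul_le_mul_of_nonneg_right ?_ (by positivity)
  rw [div_le_iff₀ hp0]
  rw [div_le_iff₀ hε] at hK
  nlinarith
end

section
/- Fix integers n ≥ 2 and r ≥ 0. There exists a constant C > 0 (depending only on n and r) such that for all integers H ≥ 2, the number Q_{n,r}(H) of matrices A in M_n(ℤ;H) such that every monic irreducible factor over ℚ of the characteristic polynomial of A has degree at least r+1 and the characteristic polynomial has a repeated root in ℂ, satisfies Q_{n,r}(H) ≤ C · H^(n² − r − 1). -/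
open Matrix Polynomial

/-- The matrix `[[a, b], [c, D]]`. -/
def bord {F : Type*} {m : ℕ} (a : F) (b c : Fin m → F) (D : Matrix (Fin m) (Fin m) F) :
    Matrix (Unit ⊕ Fin m) (Unit ⊕ Fin m) F :=
  fromBlocks (Matrix.of fun _ _ => a) (Matrix.of fun _ j => b j) (Matrix.of fun i _ => c i) D

noncomputable def resolv {F : Type*} [Field F] {m : ℕ} (D : Matrix (Fin m) (Fin m) F) :
    Matrix (Fin m) (Fin m) (PowerSeries F) :=
  Matrix.of fun i j => PowerSeries.mk fun k => (D ^ k) i j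

lemma resolv_inv {F : Type*} [Field F] {m : ℕ} (D : Matrix (Fin m) (Fin m) F) :
    (1 - (PowerSeries.X : PowerSeries F) • D.map (PowerSeries.C (R := F))) * resolv D = 1 := by
  ext i j k
  rw [sub_mul, one_mul, Matrix.smul_mul, Matrix.sub_apply, Matrix.smul_apply, smul_eq_mul, map_sub]
  rcases k with _ | k
  · simp [resolv, Matrix.one_apply]
  · rw [PowerSeries.coeff_succ_X_mul, Matrix.mul_apply, map_sum]
    simp only [resolv, Matrix.of_apply, PowerSeries.coeff_mk, Matrix.map_apply,
      PowerSeries.coeff_C_mul]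
    rw [pow_succ', Matrix.mul_apply, sub_self, Matrix.one_apply]
    split_ifs <;> simp [PowerSeries.coeff_one]

lemma bord_charpoly {F : Type*} [Field F] {m : ℕ} {a a' : F} {b b' c : Fin m → F}
    {D : Matrix (Fin m) (Fin m) F} (h : (bord a b c D).charpoly = (bord a' b' c D).charpoly) :
    a = a' ∧ ∀ k, (b - b') ⬝ᵥ ((D ^ k) *ᵥ c) = 0 := by
  have ha : a = a' := by
    have h1 := trace_eq_neg_charpoly_coeff (bord a b c D)
    have h2 := trace_eq_neg_charpoly_coeff (bord a' b' c D)
    rw [h, ← h2] at h1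
    simpa [bord, Matrix.trace] using h1
  refine ⟨ha, ?_⟩
  subst ha
  let inv : Invertible (1 - (PowerSeries.X : PowerSeries F) • D.map (PowerSeries.C (R := F))) :=
    invertibleOfRightInverse _ _ (resolv_inv D)
  have hinv : ⅟(1 - (PowerSeries.X : PowerSeries F) • D.map (PowerSeries.C (R := F))) = resolv D := rfl
  have key : ∀ b : Fin m → F, (((bord a b c D).charpoly.reverse : F[X]) : PowerSeries F) =
      (1 - (PowerSeries.X : PowerSeries F) • D.map (PowerSeries.C (R := F))).det *
      (1 - PowerSeries.X * PowerSeries.C a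
        - PowerSeries.X ^ 2 * PowerSeries.mk (fun k => b ⬝ᵥ ((D ^ k) *ᵥ c))) := by
    intro b
    rw [reverse_charpoly, charpolyRev, ← Polynomial.coeToPowerSeries.ringHom_apply, RingHom.map_det]
    have : (Polynomial.coeToPowerSeries.ringHom (R := F)).mapMatrix
        (1 - (X : F[X]) • (bord a b c D).map C) =
        fromBlocks (Matrix.of fun _ _ => 1 - PowerSeries.X * PowerSeries.C a)
          (Matrix.of fun _ j => - (PowerSeries.X * PowerSeries.C (b j)))
          (Matrix.of fun i _ => - (PowerSeries.X * PowerSeries.C (c i)))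
          (1 - (PowerSeries.X : PowerSeries F) • D.map (PowerSeries.C (R := F))) := by
      ext i j : 1
      rcases i with i | i <;> rcases j with j | j <;>
        simp [bord, Matrix.one_apply]
      · exact mul_comm _ _
      · exact mul_comm _ _
      · exact mul_comm _ _
      · split_ifs <;> simp [mul_comm]
    rw [this, det_fromBlocks₂₂, hinv]
    congr 1
    rw [Matrix.det_unique]
    simp only [Matrix.sub_apply, Matrix.of_apply]
    congr 1
    simp only [Matrix.mul_apply, Matrix.of_apply, Finset.sum_mul]
    rw [Finset.sum_comm]
    have h2 : PowerSeries.mk (fun k => b ⬝ᵥ ((D ^ k) *ᵥ c)) =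
        ∑ i, ∑ j, PowerSeries.C (b i) * resolv D i j * PowerSeries.C (c j) := by
      ext k
      simp [dotProduct, mulVec, resolv, Finset.mul_sum, mul_assoc, map_sum]
    rw [h2, Finset.mul_sum]
    refine Finset.sum_congr rfl fun i _ => ?_
    rw [Finset.mul_sum]
    refine Finset.sum_congr rfl fun j _ => ?_
    ring
  have e := (key b).symm.trans ((congrArg (fun p : F[X] => ((p.reverse : F[X]) : PowerSeries F)) h).trans (key b'))
  have hu : IsUnit (1 - (PowerSeries.X : PowerSeries F) • D.map (PowerSeries.C (R := F))).det :=
    isUnit_det_of_invertible _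
  have e2 := hu.mul_left_cancel e
  rw [sub_right_inj] at e2
  have e3 := mul_left_cancel₀ (pow_ne_zero 2 PowerSeries.X_ne_zero) e2
  intro k
  have e4 := congrArg (PowerSeries.coeff k) e3
  simp only [PowerSeries.coeff_mk] at e4
  rw [sub_dotProduct, e4, sub_self]

lemma krylov {F : Type*} [Field F] {m : ℕ} (D : Matrix (Fin m) (Fin m) F) (c : Fin m → F) :
    ∃ k ≤ m, LinearIndependent F (fun i : Fin k => (D ^ (i : ℕ)) *ᵥ c) ∧
      (D ^ k) *ᵥ c ∈ Submodule.span F (Set.range fun i : Fin k => (D ^ (i : ℕ)) *ᵥ c) := by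
  classical
  let P : ℕ → Prop := fun k => LinearIndependent F (fun i : Fin k => (D ^ (i : ℕ)) *ᵥ c)
  have hle : ∀ k, P k → k ≤ m := fun k hk => by
    simpa using hk.fintype_card_le_finrank
  have h0 : P 0 := linearIndependent_empty_type
  have hk : P (Nat.findGreatest P m) := Nat.findGreatest_spec (Nat.zero_le m) h0
  refine ⟨Nat.findGreatest P m, Nat.findGreatest_le m, hk, ?_⟩
  by_contra hcon
  have h1 : P (Nat.findGreatest P m + 1) := by
    have := linearIndependent_finSnoc.2 ⟨hk, hcon⟩
    have h2 : (Fin.snoc (fun i : Fin (Nat.findGreatest P m) => (D ^ (i : ℕ)) *ᵥ c)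
        ((D ^ (Nat.findGreatest P m)) *ᵥ c) : Fin (Nat.findGreatest P m + 1) → Fin m → F) =
        fun i : Fin (Nat.findGreatest P m + 1) => (D ^ (i : ℕ)) *ᵥ c := by
      funext i
      refine Fin.lastCases ?_ (fun j => ?_) i <;> simp
    rw [h2] at this
    exact this
  have := Nat.le_findGreatest (hle _ h1) h1
  omega

lemma exists_compl {F : Type*} [Field F] {m k : ℕ} (w : Fin k → Fin m → F) :
    ∃ e : Fin (m - k) → Fin m → F, LinearIndependent F w →
      Submodule.span F (Set.range w) ⊔ Submodule.span F (Set.range e) = ⊤ := by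
  by_cases hw : LinearIndependent F w
  · obtain ⟨Q, hQ⟩ := Submodule.exists_isCompl (Submodule.span F (Set.range w))
    have h1 := Submodule.finrank_add_eq_of_isCompl hQ
    rw [finrank_span_eq_card hw] at h1
    have h2 : Module.finrank F Q = m - k := by simp at h1; omega
    let B := Module.finBasisOfFinrankEq F Q h2
    refine ⟨fun i => (B i : Fin m → F), fun _ => ?_⟩
    have : Submodule.span F (Set.range fun i => (B i : Fin m → F)) = Q := by
      have h3 := congrArg (Submodule.map Q.subtype) B.span_eq
      rw [Submodule.map_span, ← Set.range_comp] at h3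
      simpa [Function.comp_def] using h3
    rw [this]
    exact hQ.sup_eq_top
  · exact ⟨0, fun h => absurd h hw⟩

lemma count_k {F : Type*} [Field F] [Finite F] {m k : ℕ} (hk : k ≤ m) :
    Set.ncard {t : Matrix (Fin m) (Fin m) F × (Fin m → F) × (Fin m → F) |
      (LinearIndependent F (fun i : Fin k => (t.1 ^ (i : ℕ)) *ᵥ t.2.1) ∧
      (t.1 ^ k) *ᵥ t.2.1 ∈ Submodule.span F (Set.range fun i : Fin k => (t.1 ^ (i : ℕ)) *ᵥ t.2.1)) ∧
      ∀ i : ℕ, t.2.2 ⬝ᵥ ((t.1 ^ i) *ᵥ t.2.1) = 0} ≤ Nat.card F ^ (m * m + m) := by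
  classical
  choose e he using fun w : Fin k → Fin m → F => exists_compl w
  have hc : ∀ (w : Fin k → Fin m → F) (x : Fin m → F), ∃ α : Fin k → F,
      x ∈ Submodule.span F (Set.range w) → ∑ i, α i • w i = x := by
    intro w x
    by_cases hx : x ∈ Submodule.span F (Set.range w)
    · obtain ⟨α, hα⟩ := (Submodule.mem_span_range_iff_exists_fun F).1 hx
      exact ⟨α, fun _ => hα⟩
    · exact ⟨0, fun h => absurd h hx⟩
  choose co hco using hc
  let w : Matrix (Fin m) (Fin m) F × (Fin m → F) × (Fin m → F) → Fin k → Fin m → F :=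
    fun t i => (t.1 ^ (i : ℕ)) *ᵥ t.2.1
  let Φ : Matrix (Fin m) (Fin m) F × (Fin m → F) × (Fin m → F) →
      ((Fin k → Fin m → F) × (Fin k → F)) × (Fin (m - k) → Fin m → F) × (Fin (m - k) → F) :=
    fun t => ((w t, co (w t) ((t.1 ^ k) *ᵥ t.2.1)),
      (fun j => t.1 *ᵥ (e (w t) j)), fun j => t.2.2 ⬝ᵥ (e (w t) j))
  have hcard : Nat.card (((Fin k → Fin m → F) × (Fin k → F)) × (Fin (m - k) → Fin m → F) ×
      (Fin (m - k) → F)) = Nat.card F ^ (m * m + m) := by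
    simp only [Nat.card_prod, Nat.card_fun, Nat.card_fin, ← pow_mul, ← pow_add]
    congr 1
    obtain ⟨l, rfl⟩ := Nat.exists_eq_add_of_le hk
    rw [Nat.add_sub_cancel_left]
    ring
  rw [← hcard, ← Set.ncard_univ]
  refine Set.ncard_le_ncard_of_injOn Φ (fun _ _ => Set.mem_univ _) ?_
  rintro ⟨D, c, b⟩ ⟨⟨hli, hsp⟩, hb⟩ ⟨D', c', b'⟩ ⟨⟨hli', hsp'⟩, hb'⟩ hΦ
  dsimp only at hli hsp hb hli' hsp' hb'
  simp only [Φ, Prod.mk.injEq] at hΦ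
  obtain ⟨⟨hw, hcoe⟩, hDe, hbe⟩ := hΦ
  have hsum : (D ^ k) *ᵥ c = (D' ^ k) *ᵥ c' := by
    have h1 := hco (w (D, c, b)) _ hsp
    have h2 := hco (w (D', c', b')) _ hsp'
    rw [← h1, ← h2, hcoe, hw]
  have hpow : ∀ i ≤ k, (D ^ i) *ᵥ c = (D' ^ i) *ᵥ c' := by
    intro i hi
    rcases hi.lt_or_eq with h | rfl
    · exact congrFun hw ⟨i, h⟩
    · exact hsum
  have hcc : c = c' := by simpa using hpow 0 (Nat.zero_le k)
  have htop := he (w (D, c, b)) hli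
  have ext_gen : ∀ {V : Type _} [AddCommMonoid V] [Module F V] (f g : (Fin m → F) →ₗ[F] V),
      (∀ i, f (w (D, c, b) i) = g (w (D, c, b) i)) →
      (∀ j, f (e (w (D, c, b)) j) = g (e (w (D, c, b)) j)) → f = g := by
    intro V _ _ f g h1 h2
    have : (⊤ : Submodule F (Fin m → F)) ≤ LinearMap.eqLocus f g := by
      rw [← htop, sup_le_iff, Submodule.span_le, Submodule.span_le]
      constructor
      · rintro _ ⟨i, rfl⟩; exact h1 i
      · rintro _ ⟨i, rfl⟩; exact h2 i
    exact LinearMap.ext fun x => this (Submodule.mem_top (x := x))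
  have hD : D = D' := by
    apply Matrix.toLin'.injective
    apply ext_gen
    · intro i
      have h1 := hpow (i + 1) i.2
      have h2 : w (D, c, b) i = (D' ^ (i : ℕ)) *ᵥ c' := congrFun hw i
      rw [pow_succ', ← mulVec_mulVec, pow_succ', ← mulVec_mulVec] at h1
      simp only [toLin'_apply]
      conv_rhs => rw [h2]
      exact h1
    · intro j
      have := congrFun hDe j
      rw [← hw] at this
      exact this
  have hbb : b = b' := by
    have : dotProductBilin F F b = dotProductBilin F F b' := by
      apply ext_gen
      · intro i
        have h2 : w (D, c, b) i = (D' ^ (i : ℕ)) *ᵥ c' := congrFun hw i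
        exact (hb i).trans ((hb' i).symm.trans (by rw [← h2]; rfl))
      · intro j
        have := congrFun hbe j
        rw [← hw] at this
        exact this
    apply dotProduct_eq
    intro u
    exact congrArg (fun f => f u) this
  rw [hD, hcc, hbb]

lemma count_T {F : Type*} [Field F] [Finite F] (m : ℕ) :
    Set.ncard {t : Matrix (Fin m) (Fin m) F × (Fin m → F) × (Fin m → F) |
      ∀ i : ℕ, t.2.2 ⬝ᵥ ((t.1 ^ i) *ᵥ t.2.1) = 0} ≤ (m + 1) * Nat.card F ^ (m * m + m) := by
  classical
  let S : ℕ → Set (Matrix (Fin m) (Fin m) F × (Fin m → F) × (Fin m → F)) := fun k => {t |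
      (LinearIndependent F (fun i : Fin k => (t.1 ^ (i : ℕ)) *ᵥ t.2.1) ∧
      (t.1 ^ k) *ᵥ t.2.1 ∈ Submodule.span F (Set.range fun i : Fin k => (t.1 ^ (i : ℕ)) *ᵥ t.2.1)) ∧
      ∀ i : ℕ, t.2.2 ⬝ᵥ ((t.1 ^ i) *ᵥ t.2.1) = 0}
  refine (Set.ncard_le_ncard (t := ⋃ k ∈ Finset.range (m + 1), S k) ?_).trans ?_
  · intro t ht
    obtain ⟨k, hk, h⟩ := krylov t.1 t.2.1
    simp only [Set.mem_iUnion]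
    exact ⟨k, Finset.mem_range.2 (by omega), h, ht⟩
  · refine (Finset.set_ncard_biUnion_le _ _).trans ?_
    refine (Finset.sum_le_card_nsmul _ _ (Nat.card F ^ (m * m + m)) ?_).trans (by simp)
    intro k hk
    exact count_k (by simpa [Nat.lt_succ_iff] using hk)

lemma count_charpoly {F : Type*} [Field F] [Finite F] (m : ℕ) (f : F[X]) :
    Set.ncard {A : Matrix (Unit ⊕ Fin m) (Unit ⊕ Fin m) F | A.charpoly = f} ≤
      (m + 1) * Nat.card F ^ (m * m + m) := by
  classical
  have hA : ∀ A : Matrix (Unit ⊕ Fin m) (Unit ⊕ Fin m) F, A =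
      bord (A (.inl ()) (.inl ())) (fun j => A (.inl ()) (.inr j)) (fun j => A (.inr j) (.inl ()))
        A.toBlocks₂₂ := by
    intro A
    ext i j
    rcases i with i | i <;> rcases j with j | j <;> rfl
  have hch : ∀ (D : Matrix (Fin m) (Fin m) F) (c : Fin m → F), ∃ b0 : Fin m → F,
      ∀ a b, (bord a b c D).charpoly = f → ∃ a', (bord a' b0 c D).charpoly = f := by
    intro D c
    by_cases h : ∃ a b, (bord a b c D).charpoly = f
    · obtain ⟨a, b, h⟩ := h
      exact ⟨b, fun _ _ _ => ⟨a, h⟩⟩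
    · exact ⟨0, fun a b hab => absurd ⟨a, b, hab⟩ h⟩
  choose b0 hb0 using hch
  refine le_trans ?_ (count_T (F := F) m)
  refine Set.ncard_le_ncard_of_injOn (fun A => (A.toBlocks₂₂, (fun j => A (.inr j) (.inl ())),
    (fun j => A (.inl ()) (.inr j)) - b0 A.toBlocks₂₂ (fun j => A (.inr j) (.inl ())))) ?_ ?_
  · intro A h
    simp only [Set.mem_ofPred_eq] at h ⊢
    rw [hA A] at h
    obtain ⟨a', h'⟩ := hb0 _ _ _ _ h
    exact (bord_charpoly (h.trans h'.symm)).2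
  · intro A h A' h' heq
    simp only [Set.mem_ofPred_eq] at h h'
    simp only [Prod.mk.injEq] at heq
    obtain ⟨h1, h2, h3⟩ := heq
    rw [h1, h2, sub_left_inj] at h3
    rw [hA A] at h ⊢
    rw [hA A'] at h' ⊢
    rw [h1, h2, h3] at h ⊢
    rw [(bord_charpoly (h.trans h'.symm)).1]

lemma count_charpoly_fin {F : Type*} [Field F] [Finite F] (n : ℕ) (hn : 1 ≤ n) (f : F[X]) :
    Set.ncard {A : Matrix (Fin n) (Fin n) F | A.charpoly = f} ≤ n * Nat.card F ^ (n * n - n) := by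
  obtain ⟨m, rfl⟩ : ∃ m, n = m + 1 := ⟨n - 1, by omega⟩
  have e : Fin (m + 1) ≃ Unit ⊕ Fin m := Fintype.equivOfCardEq (by simp; omega)
  have h := count_charpoly m f
  have h2 : (m + 1) * (m + 1) - (m + 1) = m * m + m := by
    rw [Nat.sub_eq_iff_eq_add] <;> nlinarith
  rw [h2]
  refine le_trans ?_ h
  refine Set.ncard_le_ncard_of_injOn (Matrix.reindex e e) ?_ (Matrix.reindex e e).injective.injOn
  intro A hA
  simp only [Set.mem_ofPred_eq] at hA ⊢
  rw [charpoly_reindex, hA]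

lemma monic_param {F : Type*} [Field F] (g : F[X]) (hg : g.Monic) (d : ℕ) (hd : g.natDegree = d) :
    ∃ v : Fin d → F, g = X ^ d + ∑ i : Fin d, C (v i) * X ^ (i : ℕ) := by
  refine ⟨fun i => g.coeff i, ?_⟩
  subst hd
  conv_lhs => rw [hg.as_sum]
  rw [Fin.sum_univ_eq_sum_range (fun i => C (g.coeff i) * X ^ i)]

lemma count_sq_s15 {F : Type*} [Field F] [Finite F] (n d : ℕ) (hn : 1 ≤ n) :
    Set.ncard {A : Matrix (Fin n) (Fin n) F | ∃ g : F[X], g.Monic ∧ g.natDegree = d ∧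
      g * g ∣ A.charpoly} ≤ n * Nat.card F ^ (n * n - d) := by
  classical
  have : Fintype F := Fintype.ofFinite F
  by_cases hd : 2 * d ≤ n
  swap
  · have : {A : Matrix (Fin n) (Fin n) F | ∃ g : F[X], g.Monic ∧ g.natDegree = d ∧
      g * g ∣ A.charpoly} = ∅ := by
      ext A
      simp only [Set.mem_ofPred_eq, Set.mem_empty_iff_false, iff_false]
      rintro ⟨g, hg, hgd, hdvd⟩
      have := natDegree_le_of_dvd hdvd A.charpoly_monic.ne_zero
      rw [hg.natDegree_mul hg, charpoly_natDegree_eq_dim, Fintype.card_fin] at this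
      omega
    rw [this]; simp
  let Q : (Fin d → F) × (Fin (n - 2 * d) → F) → F[X] := fun p =>
    (X ^ d + ∑ i : Fin d, C (p.1 i) * X ^ (i : ℕ)) * (X ^ d + ∑ i : Fin d, C (p.1 i) * X ^ (i : ℕ)) *
    (X ^ (n - 2 * d) + ∑ i : Fin (n - 2 * d), C (p.2 i) * X ^ (i : ℕ))
  refine (Set.ncard_le_ncard (t := ⋃ p ∈ (Finset.univ : Finset ((Fin d → F) × (Fin (n - 2 * d) → F))),
    {A : Matrix (Fin n) (Fin n) F | A.charpoly = Q p}) ?_).trans ?_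
  · rintro A ⟨g, hg, hgd, h, hh⟩
    have hhm : h.Monic := Monic.of_mul_monic_left (hg.mul hg) (hh ▸ A.charpoly_monic)
    have hhd : h.natDegree = n - 2 * d := by
      have := congrArg natDegree hh
      rw [(hg.mul hg).natDegree_mul hhm, hg.natDegree_mul hg, charpoly_natDegree_eq_dim,
        Fintype.card_fin] at this
      omega
    obtain ⟨v, hv⟩ := monic_param g hg d hgd
    obtain ⟨u, hu⟩ := monic_param h hhm _ hhd
    simp only [Set.mem_iUnion]
    refine ⟨(v, u), Finset.mem_univ _, ?_⟩
    simp only [Set.mem_ofPred_eq, Q]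
    rw [← hv, ← hu, hh]
  · refine (Finset.set_ncard_biUnion_le _ _).trans ?_
    refine (Finset.sum_le_card_nsmul _ _ _ (fun p _ => count_charpoly_fin n hn (Q p))).trans ?_
    rw [Finset.card_univ, ← Nat.card_eq_fintype_card, Nat.card_prod, Nat.card_fun, Nat.card_fun,
      Nat.card_fin, Nat.card_fin, smul_eq_mul, mul_left_comm, ← pow_add, ← pow_add]
    apply le_of_eq
    have : n ≤ n * n := Nat.le_mul_self n
    congr 2
    omega

lemma exists_int_factor (n r : ℕ) (A : Matrix (Fin n) (Fin n) ℤ)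
    (h1 : ∀ g : Polynomial ℚ, g.Monic → Irreducible g →
          g ∣ Polynomial.map (Int.castRingHom ℚ) A.charpoly → r + 1 ≤ g.natDegree)
    (h2 : ¬ Squarefree (Polynomial.map (Int.castRingHom ℂ) A.charpoly)) :
    ∃ g : ℤ[X], g.Monic ∧ r + 1 ≤ g.natDegree ∧ g * g ∣ A.charpoly := by
  have hsq : ¬ Squarefree (Polynomial.map (Int.castRingHom ℚ) A.charpoly) := by
    intro h
    apply h2
    rw [← PerfectField.separable_iff_squarefree] at h
    have h3 := h.map (f := algebraMap ℚ ℂ)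
    rw [Polynomial.map_map] at h3
    have : (algebraMap ℚ ℂ).comp (Int.castRingHom ℚ) = Int.castRingHom ℂ := RingHom.ext_int _ _
    rw [this] at h3
    exact h3.squarefree
  have hne : Polynomial.map (Int.castRingHom ℚ) A.charpoly ≠ 0 :=
    (A.charpoly_monic.map _).ne_zero
  rw [squarefree_iff_irreducible_sq_not_dvd_of_ne_zero hne] at hsq
  push Not at hsq
  obtain ⟨g, hgi, hg⟩ := hsq
  obtain ⟨u, hu⟩ : ∃ u, u = g * C g.leadingCoeff⁻¹ := ⟨_, rfl⟩
  have hum : u.Monic := hu ▸ monic_mul_leadingCoeff_inv hgi.ne_zero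
  have hass : Associated u g := by
    rw [hu]
    refine associated_mul_unit_left _ _ ?_
    rw [isUnit_C, isUnit_iff_ne_zero]
    exact inv_ne_zero (leadingCoeff_ne_zero.2 hgi.ne_zero)
  have hui : Irreducible u := hass.irreducible_iff.2 hgi
  have hud : u * u ∣ Polynomial.map (Int.castRingHom ℚ) A.charpoly :=
    ((hass.mul_mul hass).dvd).trans hg
  have hdeg := h1 u hum hui ((dvd_mul_right u u).trans hud)
  obtain ⟨v, hv⟩ := IsIntegrallyClosed.eq_map_mul_C_of_dvd ℚ A.charpoly_monic
    (g := u) ((dvd_mul_right u u).trans hud)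
  rw [hum.leadingCoeff, C_1, mul_one] at hv
  have hinj : Function.Injective (algebraMap ℤ ℚ) := (algebraMap ℤ ℚ).injective_int
  have hvm : v.Monic := Polynomial.monic_of_injective hinj (hv ▸ hum)
  refine ⟨v, hvm, ?_, ?_⟩
  · rw [← hv, natDegree_map_eq_of_injective hinj] at hdeg
    exact hdeg
  · rw [← Polynomial.map_dvd_map (algebraMap ℤ ℚ) hinj (hvm.mul hvm), Polynomial.map_mul, hv]
    exact hud

lemma count_nat (n r H : ℕ) (hn : 2 ≤ n) (hH : 2 ≤ H) :
      Set.ncard {A : Matrix (Fin n) (Fin n) ℤ | (∀ i j, |A i j| ≤ (H : ℤ)) ∧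
        (∀ g : Polynomial ℚ, g.Monic → Irreducible g →
          g ∣ Polynomial.map (Int.castRingHom ℚ) A.charpoly → r + 1 ≤ g.natDegree) ∧
        ¬ Squarefree (Polynomial.map (Int.castRingHom ℂ) A.charpoly)} ≤
      (n + 1) * (n * (6 * H) ^ (n * n - (r + 1))) := by
  classical
  obtain ⟨p, hp, hp1, hp2⟩ := Nat.exists_prime_lt_and_le_two_mul (2 * H + 1) (by omega)
  have : Fact p.Prime := ⟨hp⟩
  let S : ℕ → Set (Matrix (Fin n) (Fin n) (ZMod p)) := fun d => {A | ∃ g : (ZMod p)[X], g.Monic ∧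
    g.natDegree = d ∧ g * g ∣ A.charpoly}
  have hle : Set.ncard (⋃ d ∈ Finset.Icc (r + 1) n, S d) ≤
      (n + 1) * (n * (6 * H) ^ (n * n - (r + 1))) := by
    refine (Finset.set_ncard_biUnion_le _ _).trans ?_
    refine (Finset.sum_le_card_nsmul _ _ (n * (6 * H) ^ (n * n - (r + 1))) ?_).trans ?_
    · intro d hd
      rw [Finset.mem_Icc] at hd
      refine (count_sq_s15 n d (by omega)).trans ?_
      rw [Nat.card_zmod]
      refine Nat.mul_le_mul_left _ ?_
      refine (Nat.pow_le_pow_left (show p ≤ 6 * H by omega) _).trans ?_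
      exact Nat.pow_le_pow_right (by omega) (by omega)
    · rw [smul_eq_mul]
      refine Nat.mul_le_mul_right _ ?_
      simp
      omega
  refine le_trans ?_ hle
  refine Set.ncard_le_ncard_of_injOn (fun A => A.map (Int.castRingHom (ZMod p))) ?_ ?_
  · rintro A ⟨-, h1, h2⟩
    obtain ⟨g, hg, hgd, hdvd⟩ := exists_int_factor n r A h1 h2
    simp only [Set.mem_iUnion]
    refine ⟨g.natDegree, Finset.mem_Icc.2 ⟨hgd, ?_⟩, g.map (Int.castRingHom (ZMod p)), hg.map _,
      hg.natDegree_map _, ?_⟩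
    · have := natDegree_le_of_dvd hdvd A.charpoly_monic.ne_zero
      rw [hg.natDegree_mul hg, charpoly_natDegree_eq_dim, Fintype.card_fin] at this
      omega
    · rw [charpoly_map, ← Polynomial.map_mul]
      exact Polynomial.map_dvd _ hdvd
  · rintro A ⟨hA, -⟩ B ⟨hB, -⟩ hAB
    ext i j
    have h := congrFun (congrFun hAB i) j
    simp only [Matrix.map_apply, Int.coe_castRingHom] at h
    rw [← sub_eq_zero, ← Int.cast_sub, ZMod.intCast_zmod_eq_zero_iff_dvd] at h
    have hAi := abs_le.1 (hA i j)
    have hBi := abs_le.1 (hB i j)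
    have := Int.eq_zero_of_abs_lt_dvd h (by rw [abs_lt]; constructor <;> omega)
    omega

/-- Bound (3.2): the number of matrices `A ∈ M_n(ℤ;H)` whose characteristic polynomial has
all monic irreducible factors over `ℚ` of degree at least `r+1` and has a repeated complex
root is `O(H^(n²-r-1))`. -/
theorem high_degree_repeated_eigenvalue_count (n r : ℕ) (hn : 2 ≤ n) :
    ∃ C : ℝ, 0 < C ∧ ∀ H : ℕ, 2 ≤ H →
      (Set.ncard {A : Matrix (Fin n) (Fin n) ℤ | (∀ i j, |A i j| ≤ (H : ℤ)) ∧
        (∀ g : Polynomial ℚ, g.Monic → Irreducible g →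
          g ∣ Polynomial.map (Int.castRingHom ℚ) A.charpoly → r + 1 ≤ g.natDegree) ∧
        ¬ Squarefree (Polynomial.map (Int.castRingHom ℂ) A.charpoly)} : ℝ) ≤
      C * (H : ℝ) ^ ((n : ℤ) ^ 2 - r - 1) := by
  refine ⟨(n + 1) * (n * 6 ^ (n * n - (r + 1))), by positivity, fun H hH => ?_⟩
  by_cases hr : r + 1 ≤ n * n
  · have h := count_nat n r H hn hH
    have h' := (Nat.cast_le (α := ℝ)).2 h
    refine h'.trans (le_of_eq ?_)
    have he : ((n : ℤ) ^ 2 - r - 1) = ((n * n - (r + 1) : ℕ) : ℤ) := by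
      rw [Nat.cast_sub hr]; push_cast; ring
    rw [he, zpow_natCast]
    push_cast
    rw [mul_pow]
    ring
  · have hempty : {A : Matrix (Fin n) (Fin n) ℤ | (∀ i j, |A i j| ≤ (H : ℤ)) ∧
        (∀ g : Polynomial ℚ, g.Monic → Irreducible g →
          g ∣ Polynomial.map (Int.castRingHom ℚ) A.charpoly → r + 1 ≤ g.natDegree) ∧
        ¬ Squarefree (Polynomial.map (Int.castRingHom ℂ) A.charpoly)} = ∅ := by
      ext A
      simp only [Set.mem_ofPred_eq, Set.mem_empty_iff_false, iff_false]
      rintro ⟨-, h1, h2⟩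
      obtain ⟨g, hg, hgd, hdvd⟩ := exists_int_factor n r A h1 h2
      have := natDegree_le_of_dvd hdvd A.charpoly_monic.ne_zero
      rw [hg.natDegree_mul hg, charpoly_natDegree_eq_dim, Fintype.card_fin] at this
      have := Nat.le_mul_self n
      omega
    rw [hempty, Set.ncard_empty, Nat.cast_zero]
    positivity
end

section
/- Fix an integer n ≥ 2. There exists a constant C > 0 (depending only on n) such that for all integers q ≥ 1 and H with H ≥ 2q, every integer d, and every n×n integer matrix B with all entries in {0, 1, …, q−1}, the number of matrices A ∈ M_n(ℤ;H) with A ≡ B (mod q) entrywise and det A = d is at most C · (H/q)^(n² − n) · log(H/q); the bound is uniform in d and B. -/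
open Matrix Polynomial

open Classical in
/-- one-row replacement -/
lemma step_aux {n : ℕ} (q : ℤ) (hq : q ≠ 0) (R : Fin n → Finset (Fin n → ℤ)) (T : Finset (Fin n → ℤ))
    (i : Fin n) (d : ℤ)
    (hT : ∀ x ∈ R i, ∀ y ∈ R i, ∃ z ∈ T, x - y = q • z) :
    ((Fintype.piFinset R).filter (fun A : Fin n → Fin n → ℤ => Matrix.det A = d)).card ≤
    ((Fintype.piFinset (Function.update R i T)).filter
      (fun A : Fin n → Fin n → ℤ => Matrix.det A = 0)).card := by
  have hex : ∀ g : Fin n → Fin n → ℤ, ∃ x0 : Fin n → ℤ,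
      (∃ x ∈ R i, Matrix.det (Function.update g i x : Matrix (Fin n) (Fin n) ℤ) = d) →
      x0 ∈ R i ∧ Matrix.det (Function.update g i x0 : Matrix (Fin n) (Fin n) ℤ) = d := by
    intro g
    by_cases h : ∃ x ∈ R i, Matrix.det (Function.update g i x : Matrix (Fin n) (Fin n) ℤ) = d
    · obtain ⟨x, hx⟩ := h
      exact ⟨x, fun _ => hx⟩
    · exact ⟨0, fun h' => absurd h' h⟩
  choose X0 hX0 using hex
  have hz : ∀ A : Fin n → Fin n → ℤ, ∃ z : Fin n → ℤ, 
      (A ∈ Fintype.piFinset R ∧ Matrix.det (A : Matrix (Fin n) (Fin n) ℤ) = d) →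
      z ∈ T ∧ A i - X0 (Function.update A i 0) = q • z ∧
        Matrix.det (Function.update A i z : Matrix (Fin n) (Fin n) ℤ) = 0 := by
    intro A
    by_cases h : A ∈ Fintype.piFinset R ∧ Matrix.det (A : Matrix (Fin n) (Fin n) ℤ) = d
    · have hAi : A i ∈ R i := (Fintype.mem_piFinset.1 h.1) i
      obtain ⟨h1, h2⟩ := hX0 (Function.update A i 0) ⟨A i, hAi, by simpa using h.2⟩
      obtain ⟨z, hz, hz2⟩ := hT _ hAi _ h1
      refine ⟨z, fun _ => ⟨hz, hz2, ?_⟩⟩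
      have e1 : Matrix.det (Function.update A i (q • z) : Matrix (Fin n) (Fin n) ℤ) = 0 := by
        rw [← hz2]
        have := (Matrix.detRowAlternating (n := Fin n) (R := ℤ)).map_update_sub A i (A i)
          (X0 (Function.update A i 0))
        simp only [Function.update_idem, Function.update_eq_self] at this h2
        refine this.trans ?_
        have h3 : Matrix.detRowAlternating (A : Matrix (Fin n) (Fin n) ℤ) = d := h.2
        have h4 : Matrix.detRowAlternating (Function.update A i (X0 (Function.update A i 0)) : Matrix (Fin n) (Fin n) ℤ) = d := h2
        exact (congrArg₂ (· - ·) h3 h4).trans (sub_self d)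
      have e2 := (Matrix.detRowAlternating (n := Fin n) (R := ℤ)).map_update_smul A i q z
      have e3 := e2.symm.trans e1
      rcases smul_eq_zero.1 e3 with h | h
      · exact absurd h hq
      · exact h
    · exact ⟨0, fun h' => absurd h' h⟩
  choose Z hZ using hz
  refine Finset.card_le_card_of_injOn (fun A => Function.update A i (Z A)) ?_ ?_
  · intro (A : Fin n → Fin n → ℤ) hA
    have hA' := Finset.mem_filter.1 hA
    obtain ⟨h1, h2, h3⟩ := hZ A hA'
    refine Finset.mem_coe.2 (Finset.mem_filter.2 ⟨?_, h3⟩)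
    rw [Fintype.mem_piFinset]
    intro k
    by_cases hk : k = i
    · subst hk; simpa using h1
    · simpa [hk] using (Fintype.mem_piFinset.1 hA'.1) k
  · intro (A : Fin n → Fin n → ℤ) hA (A' : Fin n → Fin n → ℤ) hA' hAA
    have hA1 := Finset.mem_filter.1 hA
    have hA2 := Finset.mem_filter.1 hA'
    obtain ⟨-, h2, -⟩ := hZ A hA1
    obtain ⟨-, h2', -⟩ := hZ A' hA2
    simp only at hAA
    have hoff : Function.update A i 0 = Function.update A' i 0 := by
      have := congrArg (fun B : Fin n → Fin n → ℤ => Function.update B i 0) hAA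
      simpa using this
    have hzz : Z A = Z A' := by
      have := congrFun hAA i
      simpa using this
    rw [hoff, hzz, ← h2'] at h2
    have hi : A i = A' i := sub_left_injective h2
    have := congrArg (fun B : Fin n → Fin n → ℤ => Function.update B i (A i)) hoff
    simp only [Function.update_idem, Function.update_eq_self] at this
    rw [this, hi, Function.update_eq_self]

open Classical in
lemma reduce_aux {n : ℕ} (hn : 1 ≤ n) (q : ℤ) (hq : q ≠ 0) (R : Fin n → Finset (Fin n → ℤ)) (T : Finset (Fin n → ℤ))
    (d : ℤ)
    (hT : ∀ i, ∀ x ∈ R i, ∀ y ∈ R i, ∃ z ∈ T, x - y = q • z) :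
    ((Fintype.piFinset R).filter (fun A : Fin n → Fin n → ℤ => Matrix.det A = d)).card ≤
    ((Fintype.piFinset (fun _ : Fin n => T)).filter
      (fun A : Fin n → Fin n → ℤ => Matrix.det A = 0)).card := by
  have key : ∀ I : Finset (Fin n), ∃ d' : ℤ, (I.Nonempty → d' = 0) ∧
    ((Fintype.piFinset R).filter (fun A : Fin n → Fin n → ℤ => Matrix.det A = d)).card ≤
    ((Fintype.piFinset (fun i : Fin n => if i ∈ I then T else R i)).filter
      (fun A : Fin n → Fin n → ℤ => Matrix.det A = d')).card := by
    intro I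
    induction I using Finset.induction_on with
    | empty => exact ⟨d, by simp, by simp⟩
    | insert a I ha ih =>
      obtain ⟨d', -, h⟩ := ih
      refine ⟨0, fun _ => rfl, h.trans ?_⟩
      refine (step_aux q hq _ T a d' ?_).trans (le_of_eq ?_)
      · simpa [ha] using hT a
      · congr 2
        congr 1
        funext k
        by_cases hk : k = a
        · subst hk; simp
        · simp [hk]
  obtain ⟨d', h1, h2⟩ := key Finset.univ
  rw [h1 ⟨⟨0, hn⟩, Finset.mem_univ _⟩] at h2
  simpa using h2

lemma exists_int_primitive {n : ℕ} (u : Fin n → ℚ) (hu : u ≠ 0) :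
    ∃ (w : Fin n → ℤ) (a : ℚ), a ≠ 0 ∧ (∀ k, (w k : ℚ) = a * u k) ∧ ∃ x : Fin n → ℤ, w ⬝ᵥ x = 1 := by
  obtain ⟨b, hb⟩ := IsLocalization.exist_integer_multiples_of_finite (nonZeroDivisors ℤ) u
  choose w0 hw0 using hb
  have hb0 : (b : ℤ) ≠ 0 := nonZeroDivisors.ne_zero b.2
  have hw0' : ∀ k, (w0 k : ℚ) = (b : ℤ) * u k := by
    intro k
    have := hw0 k
    simpa [Algebra.smul_def] using this
  obtain ⟨k0, hk0⟩ : ∃ k, u k ≠ 0 := by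
    by_contra h
    push Not at h
    exact hu (funext h)
  have hwk : w0 k0 ≠ 0 := by
    intro h
    have := hw0' k0
    rw [h, Int.cast_zero] at this
    exact mul_ne_zero (by exact_mod_cast hb0) hk0 this.symm
  obtain ⟨g, hg⟩ := (IsPrincipalIdealRing.principal (Ideal.span (Set.range w0))).principal
  have hmem : ∀ k, g ∣ w0 k := by
    intro k
    have : w0 k ∈ Ideal.span (Set.range w0) := Ideal.subset_span ⟨k, rfl⟩
    rw [hg] at this
    exact Ideal.mem_span_singleton.1 this
  have hg0 : g ≠ 0 := by
    rintro rfl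
    exact hwk (zero_dvd_iff.1 (hmem k0))
  choose w hw using hmem
  have hgm : g ∈ Ideal.span (Set.range w0) := by
    rw [hg]; exact Ideal.mem_span_singleton_self g
  obtain ⟨x, hx⟩ := (Ideal.mem_span_range_iff_exists_fun).1 hgm
  refine ⟨w, (b : ℤ) / g, ?_, ?_, x, ?_⟩
  · exact div_ne_zero (by exact_mod_cast hb0) (by exact_mod_cast hg0)
  · intro k
    have h := hw0' k
    rw [hw k] at h
    push_cast at h
    have : (g : ℚ) ≠ 0 := by exact_mod_cast hg0
    field_simp
    linarith
  · apply mul_left_cancel₀ hg0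
    rw [mul_one, ← hx, dotProduct, Finset.mul_sum] 
    refine (Finset.sum_congr rfl fun k _ => ?_)
    rw [hx, hw k]; ring

lemma exists_normal {n : ℕ} (K : ℕ) (hK : 1 ≤ K) (Z : Matrix (Fin n) (Fin n) ℤ)
    (hZ : ∀ i j, |Z i j| ≤ (K : ℤ)) (hdet : Z.det = 0) :
    ∃ (w : Fin n → ℤ), (∀ i, w ⬝ᵥ Z i = 0) ∧ (∃ x : Fin n → ℤ, w ⬝ᵥ x = 1) ∧
      ∃ v : Fin n ⊕ Fin n → Fin n → ℤ, (∀ s k, |v s k| ≤ (K : ℤ)) ∧ (∀ s, w ⬝ᵥ v s = 0) ∧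
        ∀ y : Fin n → ℚ, ∑ k, (w k : ℚ) * y k = 0 →
          ∃ c : Fin n ⊕ Fin n → ℚ, ∀ k, y k = ∑ s, c s * v s k := by
  classical
  -- rational kernel vector with maximal zero set
  let Q : Finset (Fin n) → Prop := fun J => ∃ u : Fin n → ℚ, u ≠ 0 ∧ (∀ i, ∑ k, (Z i k : ℚ) * u k = 0) ∧
    ∀ j ∈ J, u j = 0
  have hQ0 : Q ∅ := by
    have : (Z.map (Int.castRingHom ℚ)).det = 0 := by
      rw [← RingHom.mapMatrix_apply, ← RingHom.map_det, hdet, map_zero]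
    obtain ⟨u, hu, hu2⟩ := Matrix.exists_mulVec_eq_zero_iff.2 this
    refine ⟨u, hu, fun i => ?_, by simp⟩
    have := congrFun hu2 i
    simpa [Matrix.mulVec, dotProduct] using this
  obtain ⟨J, hJ⟩ : ∃ J, Maximal Q J := by
    obtain ⟨J, -, hJ⟩ := Finite.exists_le_maximal hQ0
    exact ⟨J, hJ⟩
  obtain ⟨⟨u, hu, hu1, hu2⟩, hmax⟩ := hJ
  have huJ : ∀ j, u j = 0 → j ∈ J := by
    intro j hj
    have : Q (insert j J) := ⟨u, hu, hu1, by
      intro k hk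
      rcases Finset.mem_insert.1 hk with rfl | hk
      · exact hj
      · exact hu2 k hk⟩
    exact hmax this (Finset.subset_insert _ _) (Finset.mem_insert_self _ _)
  obtain ⟨w, a, ha, hwa, hx⟩ := exists_int_primitive u hu
  have hcast : ∀ z : Fin n → ℤ, ∑ k, (z k : ℚ) * u k = 0 → w ⬝ᵥ z = 0 := by
    intro z hz
    have : ((w ⬝ᵥ z : ℤ) : ℚ) = 0 := by
      simp only [dotProduct]
      push_cast
      calc ∑ k, (w k : ℚ) * z k = ∑ k, a * ((z k : ℚ) * u k) := by
            refine Finset.sum_congr rfl fun k _ => ?_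
            rw [hwa]; ring
        _ = 0 := by rw [← Finset.mul_sum, hz, mul_zero]
    exact_mod_cast this
  refine ⟨w, fun i => hcast _ (hu1 i), hx, 
    Sum.elim (fun i => Z i) (fun j => if j ∈ J then Pi.single j 1 else 0), ?_, ?_, ?_⟩
  · rintro (i | j) k
    · exact hZ i k
    · have : (1 : ℤ) ≤ K := by exact_mod_cast hK
      simp only [Sum.elim_inr]
      split_ifs
      · rw [Pi.single_apply]
        split_ifs <;> simp <;> omega
      · simp
  · rintro (i | j)
    · exact hcast _ (hu1 i)
    · simp only [Sum.elim_inr]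
      split_ifs with h
      · have := hwa j
        rw [hu2 j h, mul_zero] at this
        simpa using this
      · simp
  · intro y hy
    set v : Fin n ⊕ Fin n → Fin n → ℤ := 
      Sum.elim (fun i => Z i) (fun j => if j ∈ J then Pi.single j 1 else 0) with hv
    let vq : Fin n ⊕ Fin n → Fin n → ℚ := fun s k => (v s k : ℚ)
    have hy' : ∑ k, u k * y k = 0 := by
      have : a * ∑ k, u k * y k = 0 := by
        rw [Finset.mul_sum, ← hy]
        exact Finset.sum_congr rfl fun k _ => by rw [hwa]; ring
      exact (mul_eq_zero.1 this).resolve_left ha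
    have hmem : y ∈ Submodule.span ℚ (Set.range vq) := by
      rw [← Subspace.forall_mem_dualAnnihilator_apply_eq_zero_iff]
      intro φ hφ
      rw [Submodule.mem_dualAnnihilator] at hφ
      let p : Fin n → ℚ := fun k => φ (Pi.single k 1)
      have hp : ∀ z : Fin n → ℚ, φ z = ∑ k, z k * p k := by
        intro z
        have := LinearMap.pi_apply_eq_sum_univ φ z
        rw [this]
        refine Finset.sum_congr rfl fun k _ => ?_
        simp only [smul_eq_mul, p]
        congr 2
        funext m
        simp [Pi.single_apply, eq_comm]
      have hφv : ∀ s, φ (vq s) = 0 := fun s => hφ _ (Submodule.subset_span ⟨s, rfl⟩)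
      have hpZ : ∀ i, ∑ k, (Z i k : ℚ) * p k = 0 := by
        intro i
        have := hφv (Sum.inl i)
        rw [hp] at this
        simpa [vq, hv] using this
      have hpJ : ∀ j ∈ J, p j = 0 := by
        intro j hj
        have := hφv (Sum.inr j)
        rw [hp] at this
        simpa [vq, hv, hj, Pi.single_apply] using this
      obtain ⟨k0, hk0⟩ : ∃ k, u k ≠ 0 := by
        by_contra h
        push Not at h
        exact hu (funext h)
      have hprop : ∀ k, u k0 * p k = p k0 * u k := by
        by_contra hne
        push Not at hne
        obtain ⟨k1, hk1⟩ := hne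
        have hQ : Q (insert k0 J) := by
          refine ⟨fun k => u k0 * p k - p k0 * u k, ?_, ?_, ?_⟩
          · intro h
            have := congrFun h k1
            simp only [Pi.zero_apply] at this
            exact hk1 (sub_eq_zero.1 this)
          · intro i
            have e : ∀ k, (Z i k : ℚ) * (u k0 * p k - p k0 * u k) = 
              u k0 * ((Z i k : ℚ) * p k) - p k0 * ((Z i k : ℚ) * u k) := fun k => by ring
            simp only [e, Finset.sum_sub_distrib, ← Finset.mul_sum, hpZ, hu1]
            simp
          · intro j hj
            rcases Finset.mem_insert.1 hj with rfl | hj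
            · ring
            · simp [hpJ j hj, hu2 j hj]
        exact hk0 (hu2 k0 (hmax hQ (Finset.subset_insert _ _) (Finset.mem_insert_self _ _)))
      rw [hp]
      have : u k0 * ∑ k, y k * p k = 0 := by
        rw [Finset.mul_sum]
        calc ∑ k, u k0 * (y k * p k) = ∑ k, p k0 * (u k * y k) := by
              refine Finset.sum_congr rfl fun k _ => ?_
              have := hprop k
              linear_combination y k * this
          _ = 0 := by rw [← Finset.mul_sum, hy', mul_zero]
      exact (mul_eq_zero.1 this).resolve_left hk0
    obtain ⟨c, hc⟩ := (Submodule.mem_span_range_iff_exists_fun ℚ).1 hmem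
    refine ⟨c, fun k => ?_⟩
    have := congrFun hc k
    simp only [Finset.sum_apply, Pi.smul_apply, smul_eq_mul] at this
    exact this.symm

/-- integer vectors in the box of size `K` -/
noncomputable def ibox (n K : ℕ) : Finset (Fin n → ℤ) :=
  Fintype.piFinset (fun _ : Fin n => Finset.Icc (-(K : ℤ)) K)

lemma mem_ibox {n K : ℕ} {z : Fin n → ℤ} : z ∈ ibox n K ↔ ∀ k, |z k| ≤ (K : ℤ) := by
  simp [ibox, abs_le]

/-- box vectors orthogonal to `w` -/
noncomputable def nset {n : ℕ} (K : ℕ) (w : Fin n → ℤ) : Finset (Fin n → ℤ) :=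
  (ibox n K).filter (fun z => w ⬝ᵥ z = 0)

lemma nset_bound {n : ℕ} (K : ℕ) (hK : 1 ≤ K) (w x : Fin n → ℤ) (hx : w ⬝ᵥ x = 1)
    (v : Fin n ⊕ Fin n → Fin n → ℤ) (hvK : ∀ s k, |v s k| ≤ (K : ℤ)) (hv : ∀ s, w ⬝ᵥ v s = 0)
    (hspan : ∀ y : Fin n → ℚ, ∑ k, (w k : ℚ) * y k = 0 →
          ∃ c : Fin n ⊕ Fin n → ℚ, ∀ k, y k = ∑ s, c s * v s k) (j : Fin n) (hj : w j ≠ 0) :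
    (nset K w).card * (w j).natAbs ≤ ((4 * n + 5) * K) ^ (n - 1) := by
  classical
  have hjq : (w j : ℚ) ≠ 0 := by exact_mod_cast hj
  have hK1 : (1 : ℤ) ≤ K := by exact_mod_cast hK
  -- representatives
  have hrep : ∀ r : ℕ, ∃ y : Fin n → ℤ, r < (w j).natAbs →
      (w ⬝ᵥ y = r ∧ ∀ k, |y k| ≤ ((2 * n + 1) * K : ℤ)) := by
    intro r
    by_cases hr : r < (w j).natAbs
    swap
    · exact ⟨0, fun h => absurd h hr⟩
    have hxq : ∑ k, (w k : ℚ) * x k = 1 := by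
      have : ((w ⬝ᵥ x : ℤ) : ℚ) = 1 := by rw [hx]; norm_num
      simpa [dotProduct] using this
    obtain ⟨c, hc⟩ := hspan (fun k => (r : ℚ) * x k - if k = j then (r : ℚ) / w j else 0) (by
      have e : ∀ k, (w k : ℚ) * ((r : ℚ) * x k - if k = j then (r : ℚ) / w j else 0) =
        r * ((w k : ℚ) * x k) - if k = j then (w k : ℚ) * (r / w j) else 0 := by
        intro k; split_ifs <;> ring
      simp only [e, Finset.sum_sub_distrib, ← Finset.mul_sum, hxq]
      simp
      field_simp
      ring)
    refine ⟨fun k => r * x k - ∑ s, ⌊c s⌋ * v s k, fun _ => ⟨?_, ?_⟩⟩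
    · have e1 : w ⬝ᵥ (fun k => (r : ℤ) * x k - ∑ s, ⌊c s⌋ * v s k) =
          r * (w ⬝ᵥ x) - ∑ s, ⌊c s⌋ * (w ⬝ᵥ v s) := by
        simp only [dotProduct, mul_sub, Finset.sum_sub_distrib, Finset.mul_sum]
        congr 1
        · exact Finset.sum_congr rfl fun k _ => by ring
        · rw [Finset.sum_comm]
          exact Finset.sum_congr rfl fun k _ => Finset.sum_congr rfl fun s _ => by ring
      rw [e1, hx]
      simp [hv]
    · intro k
      have hk := hc k
      have e2 : (((r : ℤ) * x k - ∑ s, ⌊c s⌋ * v s k : ℤ) : ℚ) =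
          (∑ s, Int.fract (c s) * v s k) + if k = j then (r : ℚ) / w j else 0 := by
        push_cast
        have : ∑ s, Int.fract (c s) * (v s k : ℚ) = ∑ s, c s * v s k - ∑ s, (⌊c s⌋ : ℚ) * v s k := by
          rw [← Finset.sum_sub_distrib]
          exact Finset.sum_congr rfl fun s _ => by rw [Int.fract]; ring
        rw [this, ← hk]
        ring
      have b1 : |∑ s, Int.fract (c s) * (v s k : ℚ)| ≤ 2 * n * K := by
        calc |∑ s, Int.fract (c s) * (v s k : ℚ)| ≤ ∑ s, |Int.fract (c s) * (v s k : ℚ)| :=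
              Finset.abs_sum_le_sum_abs _ _
          _ ≤ ∑ s : Fin n ⊕ Fin n, (K : ℚ) := by
              refine Finset.sum_le_sum fun s _ => ?_
              rw [abs_mul, abs_of_nonneg (Int.fract_nonneg _)]
              have h1 : |(v s k : ℚ)| ≤ K := by exact_mod_cast hvK s k
              have h2 := (Int.fract_lt_one (c s)).le
              have h3 := Int.fract_nonneg (c s)
              have h4 := abs_nonneg (v s k : ℚ)
              nlinarith
          _ = 2 * n * K := by
              simp only [Finset.sum_const, Finset.card_univ, Fintype.card_sum, Fintype.card_fin, nsmul_eq_mul]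
              push_cast; ring
      have b2 : |if k = j then (r : ℚ) / w j else 0| ≤ 1 := by
        split_ifs
        · rw [abs_div, div_le_one (abs_pos.2 hjq)]
          have : (r : ℤ) ≤ |w j| := by rw [Int.abs_eq_natAbs]; omega
          have h2 : ((r : ℤ) : ℚ) ≤ ((|w j| : ℤ) : ℚ) := by exact_mod_cast this
          push_cast at h2
          simpa using h2
        · simp
      have b3 : |(((r : ℤ) * x k - ∑ s, ⌊c s⌋ * v s k : ℤ) : ℚ)| ≤ (((2 * n + 1) * K : ℤ) : ℚ) := by
        rw [e2]
        refine (abs_add_le _ _).trans ?_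
        have : (1 : ℚ) ≤ K := by exact_mod_cast hK
        push_cast
        linarith
      exact_mod_cast b3
  choose y hy using hrep
  have hinj : ((nset K w) ×ˢ Finset.range (w j).natAbs).card ≤
      (Fintype.piFinset (fun _ : {k : Fin n // k ≠ j} =>
        Finset.Icc (-(((2 * n + 2) * K : ℕ) : ℤ)) ((2 * n + 2) * K : ℕ))).card := by
    refine Finset.card_le_card_of_injOn (fun p k => p.1 k + y p.2 k) ?_ ?_
    · rintro ⟨l, r⟩ hp
      have hp' := Finset.mem_product.1 hp
      obtain ⟨hl, hr⟩ := hp'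
      simp only [nset, Finset.mem_filter, mem_ibox] at hl
      have hr' := hy r (Finset.mem_range.1 hr)
      refine Finset.mem_coe.2 (Fintype.mem_piFinset.2 fun k => ?_)
      rw [Finset.mem_Icc, ← abs_le]
      refine (abs_add_le _ _).trans ?_
      have h1 := hl.1 k
      have h2 := hr'.2 k
      push_cast
      linarith
    · rintro ⟨l, r⟩ hp ⟨l', r'⟩ hp' heq
      obtain ⟨hl, hr⟩ := Finset.mem_product.1 hp
      obtain ⟨hl', hr'⟩ := Finset.mem_product.1 hp'
      simp only [nset, Finset.mem_filter, mem_ibox] at hl hl'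
      have h1 := hy r (Finset.mem_range.1 hr)
      have h2 := hy r' (Finset.mem_range.1 hr')
      have hrl := Finset.mem_range.1 hr
      have hrl' := Finset.mem_range.1 hr'
      simp only at hrl hrl' h1 h2
      have hoff : ∀ k, k ≠ j → l k + y r k = l' k + y r' k := fun k hk => congrFun heq ⟨k, hk⟩
      have hd : w ⬝ᵥ (l + y r - (l' + y r')) = (r : ℤ) - r' := by
        rw [dotProduct_sub, dotProduct_add, dotProduct_add, hl.2, hl'.2, h1.1, h2.1]
        ring
      have hd2 : w ⬝ᵥ (l + y r - (l' + y r')) = w j * (l j + y r j - (l' j + y r' j)) := by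
        rw [dotProduct, Finset.sum_eq_single j]
        · simp
        · intro k _ hk
          have := hoff k hk
          simp [this]
        · simp
      rw [hd2] at hd
      have hz : (r : ℤ) - r' = 0 := by
        refine Int.eq_zero_of_abs_lt_dvd (m := ((w j).natAbs : ℤ)) (Int.natAbs_dvd.2 ⟨_, hd.symm⟩) ?_
        rw [abs_lt]
        omega
      have hrr : r = r' := by omega
      subst hrr
      rw [hz] at hd
      have hjj := (mul_eq_zero.1 hd).resolve_left hj
      have : l = l' := by
        funext k
        by_cases hk : k = j
        · subst hk; linarith
        · have := hoff k hk; linarith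
      rw [this]
  rw [Finset.card_product, Finset.card_range] at hinj
  refine hinj.trans ?_
  rw [Fintype.card_piFinset, Finset.prod_const, Int.card_Icc, Finset.card_univ]
  have hc : Fintype.card {k : Fin n // k ≠ j} = n - 1 := by
    simp [Fintype.card_subtype_compl]
  rw [hc]
  refine Nat.pow_le_pow_left ?_ _
  have : (((2 * n + 2) * K : ℕ) + 1 - -(((2 * n + 2) * K : ℕ) : ℤ)).toNat = 2 * ((2 * n + 2) * K) + 1 := by omega
  rw [this]
  nlinarith

open Classical in
lemma singular_count {n : ℕ} (hn : 1 ≤ n) (K : ℕ) (hK : 1 ≤ K) :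
    (((Fintype.piFinset (fun _ : Fin n => ibox n K)).filter
      (fun A : Fin n → Fin n → ℤ => Matrix.det A = 0)).card : ℝ) ≤
    n * (2 * 3 ^ (n - 1)) * ((((4 * n + 5) * K) ^ (n - 1) : ℕ) : ℝ) ^ n *
      (1 + Real.log (((4 * n + 5) * K) ^ (n - 1) : ℕ)) := by
  set M : ℕ := ((4 * n + 5) * K) ^ (n - 1) with hM
  let P : ℕ → Fin n → Finset (Fin n → ℤ) := fun D j =>
    Fintype.piFinset (fun k => if k = j then {(D : ℤ), -(D : ℤ)} else Finset.Icc (-(D : ℤ)) D)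
  let G : ℕ → Fin n → Finset (Fin n → ℤ) := fun D j =>
    (P D j).filter (fun w => (nset K w).card * D ≤ M)
  have hsub : ((Fintype.piFinset (fun _ : Fin n => ibox n K)).filter
      (fun A : Fin n → Fin n → ℤ => Matrix.det A = 0)) ⊆
      (Finset.Icc 1 M).biUnion (fun D => Finset.univ.biUnion (fun j => (G D j).biUnion
        (fun w => Fintype.piFinset (fun _ : Fin n => nset K w)))) := by
    intro (A : Fin n → Fin n → ℤ) hA
    rw [Finset.mem_filter, Fintype.mem_piFinset] at hA
    have hA1 : ∀ i j, |A i j| ≤ (K : ℤ) := fun i j => mem_ibox.1 (hA.1 i) j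
    obtain ⟨w, hw, ⟨x, hx⟩, v, hv1, hv2, hv3⟩ := exists_normal K hK A hA1 hA.2
    obtain ⟨j, -, hj⟩ := Finset.exists_max_image Finset.univ (fun k => (w k).natAbs)
      ⟨⟨0, hn⟩, Finset.mem_univ _⟩
    have hj0 : w j ≠ 0 := by
      intro h
      have : w = 0 := by
        funext k
        have := hj k (Finset.mem_univ _)
        simp only [h] at this
        simpa using this
      rw [this] at hx
      simp at hx
    have hb := nset_bound K hK w x hx v hv1 hv2 hv3 j hj0
    have hpos : 1 ≤ (nset K w).card := by
      refine Finset.card_pos.2 ⟨0, ?_⟩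
      simp [nset, mem_ibox]
    simp only [Finset.mem_biUnion, Finset.mem_univ, true_and]
    refine ⟨(w j).natAbs, ?_, j, w, ?_, ?_⟩
    · rw [Finset.mem_Icc]
      refine ⟨by omega, ?_⟩
      nlinarith
    · refine Finset.mem_filter.2 ⟨Fintype.mem_piFinset.2 fun k => ?_, hb⟩
      split_ifs with h
      · subst h
        simp only [Finset.mem_insert, Finset.mem_singleton]
        omega
      · have := hj k (Finset.mem_univ _)
        rw [Finset.mem_Icc]
        omega
    · exact Fintype.mem_piFinset.2 fun i => Finset.mem_filter.2 ⟨hA.1 i, hw i⟩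
  have hcard := Finset.card_le_card hsub
  have hPc : ∀ D j, 1 ≤ D → (P D j).card ≤ 2 * 3 ^ (n - 1) * D ^ (n - 1) := by
    intro D j hD
    rw [Fintype.card_piFinset, ← Finset.mul_prod_erase _ _ (Finset.mem_univ j)]
    rw [mul_assoc, ← mul_pow]
    refine Nat.mul_le_mul ?_ ?_
    · simp only [if_true]
      exact Finset.card_le_two
    · have : ∀ k ∈ Finset.univ.erase j, (if k = j then {(D : ℤ), -(D : ℤ)} else Finset.Icc (-(D : ℤ)) D).card ≤ 3 * D := by
        intro k hk
        rw [if_neg (Finset.ne_of_mem_erase hk), Int.card_Icc]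
        omega
      refine (Finset.prod_le_pow_card _ _ _ this).trans ?_
      rw [Finset.card_erase_of_mem (Finset.mem_univ _)]
      simp
  have hG : ∀ D ∈ Finset.Icc 1 M, ∀ j : Fin n, (((G D j).biUnion
        (fun w => Fintype.piFinset (fun _ : Fin n => nset K w))).card : ℝ) ≤
        (2 * 3 ^ (n - 1)) * (M : ℝ) ^ n * (D : ℝ)⁻¹ := by
    intro D hD j
    have hD1 : 1 ≤ D := (Finset.mem_Icc.1 hD).1
    have hDr : (0 : ℝ) < D := by exact_mod_cast hD1
    have h1 : (((G D j).biUnion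
        (fun w => Fintype.piFinset (fun _ : Fin n => nset K w))).card : ℝ) ≤
        ∑ w ∈ G D j, ((nset K w).card : ℝ) ^ n := by
      have := Finset.card_biUnion_le (s := G D j)
        (t := fun w => Fintype.piFinset (fun _ : Fin n => nset K w))
      have h' : (((G D j).biUnion
        (fun w => Fintype.piFinset (fun _ : Fin n => nset K w))).card : ℝ) ≤ 
        ((∑ w ∈ G D j, (Fintype.piFinset (fun _ : Fin n => nset K w)).card : ℕ) : ℝ) := by
        exact_mod_cast this
      refine h'.trans (le_of_eq ?_)
      push_cast
      refine Finset.sum_congr rfl fun w _ => ?_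
      simp
    have h2 : ∑ w ∈ G D j, ((nset K w).card : ℝ) ^ n ≤ (G D j).card • ((M : ℝ) / D) ^ n := by
      refine Finset.sum_le_card_nsmul _ _ _ fun w hw => ?_
      have := (Finset.mem_filter.1 hw).2
      refine pow_le_pow_left₀ (by positivity) ?_ _
      rw [le_div_iff₀ hDr]
      exact_mod_cast this
    have h3 : ((G D j).card : ℝ) ≤ 2 * 3 ^ (n - 1) * D ^ (n - 1) := by
      have := (Finset.card_filter_le (P D j) (fun w => (nset K w).card * D ≤ M)).trans (hPc D j hD1)
      exact_mod_cast this
    refine h1.trans (h2.trans ?_)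
    rw [nsmul_eq_mul]
    refine (mul_le_mul_of_nonneg_right h3 (by positivity)).trans (le_of_eq ?_)
    obtain ⟨m, rfl⟩ : ∃ m, n = m + 1 := ⟨n - 1, by omega⟩
    simp only [Nat.add_sub_cancel]
    rw [div_pow]
    field_simp
    ring
  have hfin : (((Finset.Icc 1 M).biUnion (fun D => Finset.univ.biUnion (fun j => (G D j).biUnion
        (fun w => Fintype.piFinset (fun _ : Fin n => nset K w))))).card : ℝ) ≤
        ∑ D ∈ Finset.Icc 1 M, n * ((2 * 3 ^ (n - 1)) * (M : ℝ) ^ n * (D : ℝ)⁻¹) := by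
    refine le_trans (Nat.cast_le.2 Finset.card_biUnion_le) ?_
    push_cast
    refine Finset.sum_le_sum fun D hD => ?_
    refine le_trans (Nat.cast_le.2 Finset.card_biUnion_le) ?_
    push_cast
    refine (Finset.sum_le_sum fun j _ => hG D hD j).trans (le_of_eq ?_)
    simp
  have hh := harmonic_le_one_add_log M
  rw [harmonic_eq_sum_Icc] at hh
  push_cast at hh
  calc _ ≤ _ := Nat.cast_le.2 hcard
    _ ≤ _ := hfin
    _ = n * (2 * 3 ^ (n - 1)) * (M : ℝ) ^ n * ∑ D ∈ Finset.Icc 1 M, (D : ℝ)⁻¹ := by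
      rw [Finset.mul_sum]
      exact Finset.sum_congr rfl fun D _ => by ring
    _ ≤ _ := mul_le_mul_of_nonneg_left hh (by positivity)

/-- Bound (5.1): uniformly over `d` and over residue matrices `B` modulo `q`, for `H ≥ 2q`
the number of matrices `A ∈ M_n(ℤ;H)` with `A ≡ B (mod q)` and `det A = d` is
`O((H/q)^(n²-n) log(H/q))`. -/
theorem matrix_lift_count (n : ℕ) (hn : 2 ≤ n) :
    ∃ C : ℝ, 0 < C ∧ ∀ q H : ℕ, 1 ≤ q → 2 * q ≤ H → ∀ d : ℤ,
      ∀ B : Matrix (Fin n) (Fin n) ℤ, (∀ i j, 0 ≤ B i j ∧ B i j < (q : ℤ)) →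
        (Set.ncard {A : Matrix (Fin n) (Fin n) ℤ | (∀ i j, |A i j| ≤ (H : ℤ)) ∧
          (∀ i j, (q : ℤ) ∣ (A i j - B i j)) ∧ A.det = d} : ℝ) ≤
        C * ((H : ℝ) / q) ^ (n ^ 2 - n) * Real.log ((H : ℝ) / q) := by
  classical
  set c : ℝ := 2 * (4 * n + 5) with hc
  have hn1 : (1 : ℝ) ≤ n := by exact_mod_cast (by omega : 1 ≤ n)
  have hc1 : 1 ≤ c := by rw [hc]; linarith
  have hlogc : 0 ≤ Real.log c := Real.log_nonneg hc1
  have hlog2 : 0 < Real.log 2 := Real.log_pos (by norm_num)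
  refine ⟨n * (2 * 3 ^ (n - 1)) * (c ^ (n - 1)) ^ n *
    ((1 + n * Real.log c) / Real.log 2 + n), by positivity, ?_⟩
  intro q H hq hH d B hB
  have hqr : (0 : ℝ) < q := by exact_mod_cast hq
  set X : ℝ := (H : ℝ) / q with hX
  have hX2 : 2 ≤ X := by
    rw [hX, le_div_iff₀ hqr]; exact_mod_cast hH
  set K : ℕ := 2 * H / q with hKdef
  have hK1 : 1 ≤ K := by
    rw [hKdef, Nat.one_le_div_iff (by omega)]; omega
  have hKX : (K : ℝ) ≤ 2 * X := by
    have : (K : ℝ) ≤ ((2 * H : ℕ) : ℝ) / q := Nat.cast_div_le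
    refine this.trans (le_of_eq ?_)
    push_cast; ring
  -- reduction
  let R : Fin n → Finset (Fin n → ℤ) := fun i =>
    (ibox n H).filter (fun x => ∀ k, (q : ℤ) ∣ x k - B i k)
  have hset : {A : Matrix (Fin n) (Fin n) ℤ | (∀ i j, |A i j| ≤ (H : ℤ)) ∧
          (∀ i j, (q : ℤ) ∣ (A i j - B i j)) ∧ A.det = d} =
      (((Fintype.piFinset R).filter (fun A : Fin n → Fin n → ℤ => Matrix.det A = d) :
        Finset (Fin n → Fin n → ℤ)) : Set (Fin n → Fin n → ℤ)) := by
    have hm : ∀ A : Fin n → Fin n → ℤ, A ∈ (Fintype.piFinset R).filter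
        (fun A : Fin n → Fin n → ℤ => Matrix.det A = d) ↔
        A ∈ Fintype.piFinset R ∧ Matrix.det A = d := fun A => by rw [Finset.mem_filter]
    refine Set.ext fun (A : Fin n → Fin n → ℤ) => ?_
    constructor
    · rintro ⟨h1, h2, h3⟩
      exact Finset.mem_coe.2 ((hm A).2 ⟨Fintype.mem_piFinset.2 fun i =>
        Finset.mem_filter.2 ⟨mem_ibox.2 (h1 i), h2 i⟩, h3⟩)
    · intro h
      obtain ⟨h1, h2⟩ := (hm A).1 (Finset.mem_coe.1 h)
      have h1' := fun i => Finset.mem_filter.1 (Fintype.mem_piFinset.1 h1 i)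
      exact ⟨fun i => mem_ibox.1 (h1' i).1, fun i => (h1' i).2, h2⟩
  have hncard : (Set.ncard {A : Matrix (Fin n) (Fin n) ℤ | (∀ i j, |A i j| ≤ (H : ℤ)) ∧
          (∀ i j, (q : ℤ) ∣ (A i j - B i j)) ∧ A.det = d}) =
      ((Fintype.piFinset R).filter (fun A : Fin n → Fin n → ℤ => Matrix.det A = d)).card :=
    (congrArg Set.ncard hset).trans (Set.ncard_coe_finset _)
  have hred := reduce_aux (n := n) (by omega) (q : ℤ) (by omega) R (ibox n K) d (by
    intro i x hx y hy
    simp only [R, Finset.mem_filter, mem_ibox] at hx hy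
    have hdv : ∀ k, (q : ℤ) ∣ x k - y k := by
      intro k
      have := dvd_sub (hx.2 k) (hy.2 k)
      simpa using this
    choose z hz using hdv
    refine ⟨z, mem_ibox.2 fun k => ?_, ?_⟩
    · have h1 : |x k - y k| ≤ 2 * H := by
        refine (abs_sub _ _).trans ?_
        have := hx.1 k
        have := hy.1 k
        linarith
      rw [hz k, abs_mul] at h1
      have hq0 : (0 : ℤ) < q := by omega
      rw [abs_of_pos hq0] at h1
      rw [hKdef]
      push_cast
      rw [Int.le_ediv_iff_mul_le hq0]
      linarith
    · funext k
      simpa using hz k)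
  rw [hncard]
  refine (Nat.cast_le.2 hred).trans ((singular_count (by omega) K hK1).trans ?_)
  have hMX : ((((4 * n + 5) * K) ^ (n - 1) : ℕ) : ℝ) ≤ (c * X) ^ (n - 1) := by
    push_cast
    refine pow_le_pow_left₀ (by positivity) ?_ _
    rw [hc]
    nlinarith
  have hMpos : (0 : ℝ) < ((((4 * n + 5) * K) ^ (n - 1) : ℕ) : ℝ) := by
    have : 0 < ((4 * n + 5) * K) ^ (n - 1) := by positivity
    exact_mod_cast this
  have hlogX : Real.log 2 ≤ Real.log X := Real.log_le_log (by norm_num) hX2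
  have hXpos : 0 < X := by linarith
  have hlog : 1 + Real.log (((4 * n + 5) * K) ^ (n - 1) : ℕ) ≤
      ((1 + n * Real.log c) / Real.log 2 + n) * Real.log X := by
    have h1 := Real.log_le_log hMpos hMX
    rw [Real.log_pow, Real.log_mul (by positivity) (by positivity)] at h1
    have h2 : ((n - 1 : ℕ) : ℝ) ≤ n := by exact_mod_cast Nat.sub_le _ _
    have h3 : ((n - 1 : ℕ) : ℝ) * (Real.log c + Real.log X) ≤ n * (Real.log c + Real.log X) :=
      mul_le_mul_of_nonneg_right h2 (by linarith)
    have h4 : (1 + n * Real.log c) ≤ (1 + n * Real.log c) / Real.log 2 * Real.log X := by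
      rw [div_mul_eq_mul_div, le_div_iff₀ hlog2]
      exact mul_le_mul_of_nonneg_left hlogX (by positivity)
    rw [add_mul _ _ (Real.log X)]
    linarith
  have hexp : (X ^ (n - 1)) ^ n = X ^ (n ^ 2 - n) := by
    rw [← pow_mul]
    congr 1
    rw [Nat.sub_mul, one_mul, sq]
  have hlogX0 : 0 ≤ Real.log X := by linarith
  calc _ ≤ n * (2 * 3 ^ (n - 1)) * ((c * X) ^ (n - 1)) ^ n * 
        (((1 + n * Real.log c) / Real.log 2 + n) * Real.log X) := by
        refine mul_le_mul ?_ hlog ?_ (by positivity)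
        · exact mul_le_mul_of_nonneg_left (pow_le_pow_left₀ hMpos.le hMX _) (by positivity)
        · have := Real.log_natCast_nonneg (((4 * n + 5) * K) ^ (n - 1))
          linarith
    _ = _ := by
        rw [mul_pow c X, mul_pow, hexp]
        ring
end
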